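/- The sequence of probability measures (ν_m)_{m≥1} supported on the periodic points of T of period m converges in the weak* topology to μ*, the unique Borel probability measure satisfying μ_n^{(w₀,z₀)} → μ* weak* for every (w₀,z₀) ∈ J̃. -/

import Mathlib

open MeasureTheory Filter Topology Polynomial
open scoped OnePoint Classical ENNReal

noncomputable section

namespace SkewRational

/-- The Riemann sphere, modelled as the one-point compactification of `ℂ`. -/
abbrev Sphere : Type := OnePoint ℂ

/-- The product space `X = Σ_N⁺ × ℂ̂`. -/
abbrev SymX (N : ℕ) : Type := (ℕ → Fin N) × Sphere

variable {N : ℕ}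

/-- The left shift on `Σ_N⁺`. -/
def shiftW (w : ℕ → Fin N) : ℕ → Fin N := fun n => w (n + 1)

/-- Prepending a letter to an infinite word. -/
def consW (v : Fin N) (w : ℕ → Fin N) : ℕ → Fin N := fun n => if n = 0 then v else w (n - 1)

/-- Evaluation of the rational map `P/Q` (in irreducible form) on the Riemann sphere. -/
def ratEval (P Q : ℂ[X]) : Sphere → Sphere := fun z =>
  OnePoint.elim z
    (if Q.natDegree < P.natDegree then (OnePoint.infty : Sphere)
     else if P.natDegree < Q.natDegree then ((0 : ℂ) : Sphere)
     else ((P.leadingCoeff / Q.leadingCoeff : ℂ) : Sphere))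
    (fun a => if Q.eval a = 0 then (OnePoint.infty : Sphere) else ((P.eval a / Q.eval a : ℂ) : Sphere))

/-- The multiset of preimages (with multiplicity) of a point of the sphere under `P/Q`. -/
def fiber (P Q : ℂ[X]) (a : Sphere) : Multiset Sphere :=
  OnePoint.elim a
    ((Q.roots.map fun z => (z : Sphere)) +
      Multiset.replicate (max P.natDegree Q.natDegree - Q.natDegree) (OnePoint.infty : Sphere))
    (fun b =>
      (((P - Polynomial.C b * Q).roots.map fun z => (z : Sphere)) +
        Multiset.replicate
          (max P.natDegree Q.natDegree - (P - Polynomial.C b * Q).natDegree) (OnePoint.infty : Sphere)))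

variable (p q : Fin N → ℂ[X])

/-- The degree `d_i` of the rational map `R_i = p i / q i`. -/
def degR (i : Fin N) : ℕ := max (p i).natDegree (q i).natDegree

/-- `D = d₁ + ⋯ + d_N`. -/
def Dtot : ℕ := ∑ i, degR p q i

/-- Standing assumptions: `N ≥ 1`, each `R_i = p i / q i` in irreducible form, all degrees
at least `1`, and at least one degree at least `2`. -/
def Good : Prop :=
  1 ≤ N ∧ (∀ i, IsCoprime (p i) (q i)) ∧ (∀ i, 1 ≤ degR p q i) ∧ (∃ i, 2 ≤ degR p q i)

/-- The skew-product map `T(w, z) = (σ w, R_{w 0} z)`. -/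
def Tmap : SymX N → SymX N := fun x => (shiftW x.1, ratEval (p (x.1 0)) (q (x.1 0)) x.2)

/-- The multiset of preimages of a point under `T`, counted with multiplicity. -/
def preimT (x : SymX N) : Multiset (SymX N) :=
  ∑ v : Fin N, (fiber (p v) (q v) x.2).map fun z => (consW v x.1, z)

/-- The multiset of `n`-th order preimages under `T^n`, counted with multiplicity. -/
def preimTn : ℕ → SymX N → Multiset (SymX N)
  | 0, x => {x}
  | n + 1, x => (preimT p q x).bind fun y => preimTn n y

/-- The chordal (spherical) metric on the Riemann sphere. -/
def sphDist : Sphere → Sphere → ℝ := fun z w =>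
  OnePoint.elim z
    (OnePoint.elim w 0 fun b => 2 / Real.sqrt (1 + ‖b‖ ^ 2))
    (fun a =>
      OnePoint.elim w (2 / Real.sqrt (1 + ‖a‖ ^ 2))
        (fun b => 2 * dist a b / (Real.sqrt (1 + ‖a‖ ^ 2) * Real.sqrt (1 + ‖b‖ ^ 2))))

/-- The metric `d(w, w') = 2^{-n(w,w')}` on `Σ_N⁺`. -/
def shiftDist (w w' : ℕ → Fin N) : ℝ :=
  if h : ∃ n, w n ≠ w' n then (2 : ℝ)⁻¹ ^ (Nat.find h + 1) else 0

/-- The metric on `X`: maximum of the two coordinate metrics. -/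
def dX : SymX N → SymX N → ℝ := fun x y => max (shiftDist x.1 y.1) (sphDist x.2 y.2)

/-- Montel normality of a family of self-maps of the sphere on a set `U`. -/
def NormalOn (F : Set (Sphere → Sphere)) (U : Set Sphere) : Prop :=
  ∀ s : ℕ → Sphere → Sphere, (∀ n, s n ∈ F) →
    ∃ φ : ℕ → ℕ, StrictMono φ ∧ ∃ g : Sphere → Sphere,
      ∀ K : Set Sphere, K ⊆ U → IsCompact K → ∀ ε : ℝ, 0 < ε →
        ∀ᶠ n in atTop, ∀ z ∈ K, sphDist (s (φ n) z) (g z) < ε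

/-- The compositions `R_{w (n-1)} ∘ ⋯ ∘ R_{w 0}`. -/
def itComp (w : ℕ → Fin N) : ℕ → Sphere → Sphere
  | 0 => id
  | n + 1 => ratEval (p (w n)) (q (w n)) ∘ itComp w n

/-- The fibrewise Fatou set `F_w`. -/
def fatouW (w : ℕ → Fin N) : Set Sphere :=
  {z | ∃ U : Set Sphere, IsOpen U ∧ z ∈ U ∧
    NormalOn {g | ∃ n, 1 ≤ n ∧ g = itComp p q w n} U}

/-- The fibrewise Julia set `J_w`. -/
def juliaW (w : ℕ → Fin N) : Set Sphere := (fatouW p q w)ᶜ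

/-- The Julia set `J̃` of the skew-product map `T`. -/
def juliaSet : Set (SymX N) :=
  closure (⋃ w : ℕ → Fin N, {w} ×ˢ juliaW p q w)

/-- The critical points of `T`: `(w, z)` with `z` a critical point of `R_{w 0}`. -/
def critSet : Set (SymX N) :=
  {x | 2 ≤ (fiber (p (x.1 0)) (q (x.1 0))
        (ratEval (p (x.1 0)) (q (x.1 0)) x.2)).count x.2}

/-- Assumption (A1): no super-attracting periodic point of `T` lies in the Julia set
(a periodic point is super-attracting exactly when its orbit meets the critical set,
i.e. the derivative of the return composition vanishes). -/
def NoSuperAttract : Prop :=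
  ∀ x ∈ juliaSet p q, ∀ m : ℕ, 1 ≤ m → (Tmap p q)^[m] x = x →
    ∀ k < m, (Tmap p q)^[k] x ∉ critSet p q

instance : MeasurableSpace (SymX N) := borel _
instance : BorelSpace (SymX N) := ⟨rfl⟩

instance : MeasurableSpace ↥(juliaSet p q) := borel _
instance : BorelSpace ↥(juliaSet p q) := ⟨rfl⟩

/-! ### Fixed points counted with multiplicity -/

/-- Formal composition of rational maps as pairs of polynomials: `compPair a b = a ∘ b`. -/
def compPair (a b : ℂ[X] × ℂ[X]) : ℂ[X] × ℂ[X] :=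
  (∑ i ∈ Finset.range (max a.1.natDegree a.2.natDegree + 1),
      Polynomial.C (a.1.coeff i) * b.1 ^ i * b.2 ^ (max a.1.natDegree a.2.natDegree - i),
   ∑ i ∈ Finset.range (max a.1.natDegree a.2.natDegree + 1),
      Polynomial.C (a.2.coeff i) * b.1 ^ i * b.2 ^ (max a.1.natDegree a.2.natDegree - i))

/-- For a word `[v₁, …, v_m]`, the composite `R_{v_m} ∘ ⋯ ∘ R_{v₁}` as a pair of
polynomials. -/
def wordPair : List (Fin N) → ℂ[X] × ℂ[X]
  | [] => (Polynomial.X, 1)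
  | v :: t => compPair (wordPair t) (p v, q v)

/-- The multiset of fixed points (with multiplicity) on the sphere of the rational map given
by a pair of polynomials; a degree-`k` map has `k + 1` fixed points with multiplicity. -/
def fixMul (a : ℂ[X] × ℂ[X]) : Multiset Sphere :=
  ((a.1 - Polynomial.X * a.2).roots.map fun z => (z : Sphere)) +
    Multiset.replicate
      (max a.1.natDegree a.2.natDegree + 1 - (a.1 - Polynomial.X * a.2).natDegree) (OnePoint.infty : Sphere)

/-- The periodic word `(v₁ ⋯ v_m v₁ ⋯ v_m ⋯)`. -/
def perW {m : ℕ} (hm : 0 < m) (v : Fin m → Fin N) : ℕ → Fin N :=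
  fun n => v ⟨n % m, Nat.mod_lt n hm⟩

/-- The multiset `Fix_m(T)` of fixed points of `T^m`, counted with multiplicity. -/
def fixMultiset (m : ℕ) : Multiset (SymX N) :=
  if hm : 0 < m then
    ∑ v : Fin m → Fin N, (fixMul (wordPair p q (List.ofFn v))).map fun z => (perW hm v, z)
  else 0

/-! ### Thermodynamic formalism -/

/-- The ergodic (Birkhoff) sum `f^n`. -/
def birk (f : SymX N → ℝ) (n : ℕ) (y : SymX N) : ℝ :=
  ∑ k ∈ Finset.range n, f ((Tmap p q)^[k] y)

/-- `(L_f^n 1)(x) = Σ_{T^n y = x} e^{f^n(y)}`. -/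
def LSum (f : SymX N → ℝ) (n : ℕ) (x : SymX N) : ℝ :=
  ((preimTn p q n x).map fun y => Real.exp (birk p q f n y)).sum

/-- The pressure `P(f) = sup_{x ∈ J̃} limsup (1/n) log (L_f^n 1)(x)`. -/
def pressure (f : SymX N → ℝ) : ℝ :=
  ⨆ x : ↥(juliaSet p q), limsup (fun n : ℕ => (n : ℝ)⁻¹ * Real.log (LSum p q f n ↑x)) atTop

/-- Extension by zero of a function on `J̃` to all of `X`; since `T⁻¹ J̃ = J̃`, the values
outside `J̃` are irrelevant in all expressions below. -/
def jextend (f : ↥(juliaSet p q) → ℝ) : SymX N → ℝ :=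
  fun x => if hx : x ∈ juliaSet p q then f ⟨x, hx⟩ else 0

/-- Hölder continuity on `J̃` with respect to the metric `d_X`. -/
def HolderOnJ (f : ↥(juliaSet p q) → ℝ) : Prop :=
  ∃ C : ℝ, 0 < C ∧ ∃ α : ℝ, α ∈ Set.Ioc (0 : ℝ) 1 ∧
    ∀ x y : ↥(juliaSet p q), |f x - f y| ≤ C * dX (x : SymX N) (y : SymX N) ^ α

/-- `Q(g) = P(f + g) − P(f)`. -/
def Qfun (f g : ↥(juliaSet p q) → ℝ) : ℝ :=
  pressure p q (jextend p q fun x => f x + g x) - pressure p q (jextend p q f)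

/-- The Legendre transform `L(m) = sup_g (∫ g dm − Q(g)) ∈ [0, (OnePoint.infty : Sphere)]`. -/
def LLfun (f : ↥(juliaSet p q) → ℝ) (m : ProbabilityMeasure ↥(juliaSet p q)) : EReal :=
  ⨆ g : C(↥(juliaSet p q), ℝ),
    (((∫ x, g x ∂(m : Measure ↥(juliaSet p q))) - Qfun p q f g : ℝ) : EReal)

/-- `ρ(K) = inf_{m ∈ K} L(m)`. -/
def rho (f : ↥(juliaSet p q) → ℝ) (K : Set (ProbabilityMeasure ↥(juliaSet p q))) : EReal :=
  ⨅ m ∈ K, LLfun p q f m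

/-- Membership in `M_T`: `T`-invariance of a probability measure on `J̃`. -/
def MTinv (m : ProbabilityMeasure ↥(juliaSet p q)) : Prop :=
  ∀ A : Set (SymX N), MeasurableSet A →
    ((m : Measure ↥(juliaSet p q)).map Subtype.val) (Tmap p q ⁻¹' A) =
      ((m : Measure ↥(juliaSet p q)).map Subtype.val) A

/-- The orbital measure `μ_{y,n} = (1/n)(δ_y + δ_{Ty} + ⋯ + δ_{T^{n-1}y})`, viewed as a
measure on `J̃`. -/
def orbMeas (y : SymX N) (n : ℕ) : Measure ↥(juliaSet p q) :=
  Measure.comap Subtype.val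
    ((n : ℝ≥0∞)⁻¹ • ∑ k ∈ Finset.range n, Measure.dirac ((Tmap p q)^[k] y))

/-- The (unique, if it exists) probability-measure avatar of `μ` lies in `K`. -/
def inK (μ : Measure ↥(juliaSet p q)) (K : Set (ProbabilityMeasure ↥(juliaSet p q))) : Prop :=
  ∃ ν : ProbabilityMeasure ↥(juliaSet p q), (ν : Measure ↥(juliaSet p q)) = μ ∧ ν ∈ K

/-- The sequence `(1/n) log [Σ_{T^n y = x, μ_{y,n} ∈ K} e^{f^n(y)} / Σ_{T^n y = x} e^{f^n(y)}]`,
valued in `EReal` with the convention `log 0 = ⊥`. -/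
def preimLDSeq (f : ↥(juliaSet p q) → ℝ) (x : SymX N)
    (K : Set (ProbabilityMeasure ↥(juliaSet p q))) : ℕ → EReal := fun n =>
  if (((preimTn p q n x).filter fun y => inK p q (orbMeas p q y n) K).map
        fun y => Real.exp (birk p q (jextend p q f) n y)).sum = 0 then ⊥
  else
    (((n : ℝ)⁻¹ * Real.log
      (((((preimTn p q n x).filter fun y => inK p q (orbMeas p q y n) K).map
          fun y => Real.exp (birk p q (jextend p q f) n y)).sum) /
        LSum p q (jextend p q f) n x) : ℝ) : EReal)

/-- `Fix_m(T) ∩ J̃` as a multiset. -/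
def fixJ (m : ℕ) : Multiset (SymX N) := (fixMultiset p q m).filter fun y => y ∈ juliaSet p q

/-- `Σ_{(ω,ζ) ∈ Fix_m(T) ∩ J̃} e^{f^m(ω,ζ)}`. -/
def fixSum (f : SymX N → ℝ) (m : ℕ) : ℝ :=
  ((fixJ p q m).map fun y => Real.exp (birk p q f m y)).sum

/-- The periodic-point analogue of `preimLDSeq`, with the convention `log 0 = ⊥`. -/
def fixLDSeq (f : ↥(juliaSet p q) → ℝ)
    (K : Set (ProbabilityMeasure ↥(juliaSet p q))) : ℕ → EReal := fun m =>
  if (((fixJ p q m).filter fun y => inK p q (orbMeas p q y m) K).map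
        fun y => Real.exp (birk p q (jextend p q f) m y)).sum = 0 then ⊥
  else
    (((m : ℝ)⁻¹ * Real.log
      (((((fixJ p q m).filter fun y => inK p q (orbMeas p q y m) K).map
          fun y => Real.exp (birk p q (jextend p q f) m y)).sum) /
        fixSum p q (jextend p q f) m) : ℝ) : EReal)

/-! ### Inverse branches -/

/-- Projection of a subset of `X` to the sphere coordinate. -/
def projC (E : Set (SymX N)) : Set Sphere := Prod.snd '' E

/-- For a word `[v₁, …, v_m]`, the composite map `R_{v₁} ∘ R_{v₂} ∘ ⋯ ∘ R_{v_m}`. -/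
def mapWord (l : List (Fin N)) : Sphere → Sphere :=
  l.foldr (fun i f => ratEval (p i) (q i) ∘ f) id

/-- `γ_m(U)`: the total number of analytic inverse branches of `T^m` on `U`, counted over
all `m`-strings.  (A continuous section of a rational map off its critical values is
automatically holomorphic.) -/
def gammaCount (U : Set (SymX N)) (m : ℕ) : ℕ :=
  Nat.card ((v : Fin m → Fin N) ×
    { s : C(↥(projC U), Sphere) // ∀ z : ↥(projC U), mapWord p q (List.ofFn v) (s z) = ↑z })

/-- `C_n = ⋃_{k=1}^n T^k(C)`, the critical values of `T` of order up to `n`. -/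
def critValSet (n : ℕ) : Set (SymX N) :=
  ⋃ k ∈ Finset.Icc 1 n, (Tmap p q)^[k] '' critSet p q

/-- `τ`: the number of distinct critical values of `T` in `U` (projected to the sphere). -/
def tauCount (U : Set (SymX N)) : ℕ := (Prod.snd '' (Tmap p q '' critSet p q ∩ U)).ncard

/-! ### The averaging operator `G` -/

/-- `(G^m h)(x) = D^{-m} Σ_{T^m y = x} h(y)`. -/
def GmFun (h : SymX N → ℝ) (m : ℕ) (x : SymX N) : ℝ :=
  ((Dtot p q : ℝ) ^ m)⁻¹ * ((preimTn p q m x).map h).sum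

/-- The supremum norm on functions on `J̃`. -/
def supJ (f : ↥(juliaSet p q) → ℝ) : ℝ := ⨆ x, |f x|

/-! ### Complex analysis -/

lemma bloch {f : ℂ → ℂ} {z0 : ℂ} {ρ R : ℝ} (hρ : 0 < ρ) (hR : ρ < R)
    (hf : DifferentiableOn ℂ f (Metric.ball z0 R)) (hd : deriv f z0 ≠ 0) :
    ∃ c, Metric.ball c (ρ * ‖deriv f z0‖ / 64) ⊆ f '' Metric.ball z0 R := by
  have hf' : DifferentiableOn ℂ (deriv f) (Metric.ball z0 R) := hf.deriv Metric.isOpen_ball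
  have hsub : Metric.closedBall z0 ρ ⊆ Metric.ball z0 R := Metric.closedBall_subset_ball hR
  have hcont : ContinuousOn (fun z => (ρ - dist z z0) * ‖deriv f z‖) (Metric.closedBall z0 ρ) := by
    apply ContinuousOn.mul (by fun_prop)
    exact (hf'.continuousOn.mono hsub).norm
  obtain ⟨z1, hz1, hmax⟩ := (isCompact_closedBall z0 ρ).exists_isMaxOn
    ⟨z0, Metric.mem_closedBall_self hρ.le⟩ hcont
  have hmax' : ∀ z ∈ Metric.closedBall z0 ρ,
    (ρ - dist z z0) * ‖deriv f z‖ ≤ (ρ - dist z1 z0) * ‖deriv f z1‖ := fun z hz => hmax hz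
  have h0 := hmax' z0 (Metric.mem_closedBall_self hρ.le)
  simp only [dist_self, sub_zero] at h0
  have hd0 : 0 < ‖deriv f z0‖ := norm_pos_iff.mpr hd
  have hpos : 0 < (ρ - dist z1 z0) * ‖deriv f z1‖ := lt_of_lt_of_le (mul_pos hρ hd0) h0
  have hz1' : dist z1 z0 ≤ ρ := hz1
  have ha : 0 < ‖deriv f z1‖ := by
    rcases (norm_nonneg (deriv f z1)).eq_or_lt with h | h
    · rw [← h] at hpos; simp at hpos
    · exact h
  have ht2 : 0 < ρ - dist z1 z0 := by
    by_contra h; push Not at h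
    nlinarith
  set a := ‖deriv f z1‖ with ha_def
  obtain ⟨t, ht_def⟩ : ∃ t, t = (ρ - dist z1 z0) / 2 := ⟨_, rfl⟩
  have ht : 0 < t := by linarith
  have hball : ∀ z ∈ Metric.ball z1 t, dist z z0 ≤ ρ - t ∧ z ∈ Metric.closedBall z0 ρ := by
    intro z hz
    have h1 := dist_triangle z z1 z0
    have h2 : dist z z1 < t := hz
    exact ⟨by linarith, by rw [Metric.mem_closedBall]; linarith⟩
  have hbd : ∀ z ∈ Metric.ball z1 t, ‖deriv f z‖ ≤ 2 * a := by
    intro z hz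
    obtain ⟨h1, h2⟩ := hball z hz
    have h3 := hmax' z h2
    have h4 : t * ‖deriv f z‖ ≤ (2 * t) * a := by
      calc t * ‖deriv f z‖ ≤ (ρ - dist z z0) * ‖deriv f z‖ := by gcongr; linarith
        _ ≤ _ := h3
        _ = _ := by rw [ht_def]; ring
    nlinarith
  have hsubt : Metric.ball z1 t ⊆ Metric.ball z0 R := fun z hz => hsub (hball z hz).2
  have hmaps : Set.MapsTo (deriv f) (Metric.ball z1 t) (Metric.closedBall (deriv f z1) (4 * a)) := by
    intro z hz
    rw [Metric.mem_closedBall, dist_eq_norm]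
    have := norm_sub_le (deriv f z) (deriv f z1)
    have := hbd z hz
    linarith
  have hschw : ∀ z ∈ Metric.ball z1 t, ‖deriv f z - deriv f z1‖ ≤ 4 * a / t * ‖z - z1‖ := by
    intro z hz
    have := Complex.dist_le_div_mul_dist_of_mapsTo_ball (hf'.mono hsubt) hmaps hz
    simpa [dist_eq_norm] using this
  set r := t / 8 with hr
  have hr0 : 0 < r := by positivity
  have hcb : Metric.closedBall z1 r ⊆ Metric.ball z1 t := Metric.closedBall_subset_ball (by linarith)
  have hlow : ∀ z ∈ Metric.sphere z1 r, a * r / 2 ≤ ‖f z - f z1‖ := by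
    intro z hz
    have hz' : ‖z - z1‖ = r := by simpa [dist_eq_norm] using hz
    have key := (convex_closedBall z1 r).norm_image_sub_le_of_norm_hasDerivWithin_le
      (f := fun z => f z - deriv f z1 * z) (f' := fun z => deriv f z - deriv f z1) (C := a / 2)
      (x := z1) (y := z) ?_ ?_ (Metric.mem_closedBall_self hr0.le) (Metric.sphere_subset_closedBall hz)
    · have e : f z - deriv f z1 * z - (f z1 - deriv f z1 * z1)
          = (f z - f z1) - deriv f z1 * (z - z1) := by ring
      simp only [e] at key
      have h1 := norm_sub_norm_le (deriv f z1 * (z - z1)) (f z - f z1)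
      rw [norm_sub_rev (deriv f z1 * (z - z1)), norm_mul, hz', ← ha_def] at h1
      rw [hz'] at key
      linarith
    · intro x hx
      have hx' := hsubt (hcb hx)
      have := (hf.differentiableAt (Metric.isOpen_ball.mem_nhds hx')).hasDerivAt
      exact (this.sub (by simpa using (hasDerivAt_id x).const_mul (deriv f z1))).hasDerivWithinAt
    · intro x hx
      refine (hschw x (hcb hx)).trans ?_
      have : ‖x - z1‖ ≤ r := by simpa [dist_eq_norm] using hx
      calc 4 * a / t * ‖x - z1‖ ≤ 4 * a / t * r := by gcongr
        _ = a / 2 := by rw [hr]; field_simp; norm_num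
  have hfr : ∃ᶠ z in 𝓝 z1, f z ≠ f z1 := by
    have hda : HasDerivAt f (deriv f z1) z1 :=
      (hf.differentiableAt (Metric.isOpen_ball.mem_nhds (hsub hz1))).hasDerivAt
    have := hda.eventually_ne (c := f z1) (norm_pos_iff.mp ha)
    exact this.frequently.filter_mono nhdsWithin_le_nhds
  have hdc : DiffContOnCl ℂ f (Metric.ball z1 r) := by
    apply DifferentiableOn.diffContOnCl
    rw [closure_ball _ hr0.ne']
    exact hf.mono (hcb.trans hsubt)
  have := hdc.ball_subset_image_closedBall hr0 hlow hfr
  refine ⟨f z1, (Metric.ball_subset_ball ?_).trans (this.trans (Set.image_mono (hcb.trans hsubt)))⟩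
  have : ρ * ‖deriv f z0‖ ≤ 2 * t * a := by rw [ht_def]; linarith
  rw [hr]
  nlinarith

lemma logLip {s : ℂ → ℂ} {z0 : ℂ} {ρ : ℝ} (hρ : 0 < ρ)
    (hs : DifferentiableOn ℂ s (Metric.ball z0 ρ)) (hinj : Set.InjOn s (Metric.ball z0 ρ))
    (hne : ∀ z ∈ Metric.ball z0 ρ, s z ≠ 0) :
    ‖deriv s z0‖ ≤ 512 / ρ * ‖s z0‖ := by
  have hz0 : z0 ∈ Metric.ball z0 ρ := Metric.mem_ball_self hρ
  have hs' := hs.deriv Metric.isOpen_ball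
  obtain ⟨g, hg⟩ := (hs'.div hs hne).isExactOn_ball
  have hg' : ∀ z ∈ Metric.ball z0 ρ, HasDerivAt g (deriv s z / s z) z := fun z hz => by
    simpa using hg z hz
  have hconst : ∀ z ∈ Metric.ball z0 ρ, ∀ z' ∈ Metric.ball z0 ρ,
      s z * Complex.exp (-g z) = s z' * Complex.exp (-g z') := by
    intro z hz z' hz'
    have := (convex_ball z0 ρ).norm_image_sub_le_of_norm_hasDerivWithin_le
      (f := fun z => s z * Complex.exp (-g z)) (f' := fun _ => 0) (C := 0) (x := z') (y := z)
      ?_ ?_ hz' hz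
    · simpa [sub_eq_zero] using this
    · intro x hx
      have h1 := (hs.differentiableAt (Metric.isOpen_ball.mem_nhds hx)).hasDerivAt
      have h2 := h1.mul (hg' x hx).neg.cexp
      have h3 := hne x hx
      refine HasDerivAt.hasDerivWithinAt (h2.congr_deriv ?_)
      field_simp
      simp
    · simp
  have hgd : DifferentiableOn ℂ g (Metric.ball z0 ρ) := fun z hz =>
    (hg' z hz).differentiableAt.differentiableWithinAt
  have hnz := hne z0 hz0
  have hnz' : 0 < ‖s z0‖ := norm_pos_iff.mpr hnz
  by_contra hcon
  push Not at hcon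
  have hdg : deriv g z0 = deriv s z0 / s z0 := (hg' z0 hz0).deriv
  have hbig : 512 / ρ < ‖deriv g z0‖ := by
    rw [hdg, norm_div, lt_div_iff₀ hnz']; exact hcon
  have hne' : deriv g z0 ≠ 0 := by
    intro h; rw [h] at hbig; simp at hbig
    have : 0 < 512 / ρ := by positivity
    linarith
  obtain ⟨c, hc⟩ := bloch (half_pos hρ) (half_lt_self hρ) hgd hne'
  have hrad : Real.pi < ρ / 2 * ‖deriv g z0‖ / 64 := by
    have : ρ / 2 * (512 / ρ) / 64 < ρ / 2 * ‖deriv g z0‖ / 64 := by gcongr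
    have e : ρ / 2 * (512 / ρ) / 64 = 4 := by field_simp; norm_num
    rw [e] at this
    exact Real.pi_lt_four.trans_le this.le
  have hn : ‖(Real.pi : ℂ) * Complex.I‖ = Real.pi := by
    simp [abs_of_pos Real.pi_pos]
  obtain ⟨x, hx, hx'⟩ := hc (show c + Real.pi * Complex.I ∈ _ by
    rw [Metric.mem_ball, dist_eq_norm, add_sub_cancel_left, hn]; exact hrad)
  obtain ⟨y, hy, hy'⟩ := hc (show c - Real.pi * Complex.I ∈ _ by
    rw [Metric.mem_ball, dist_eq_norm, sub_sub_cancel_left, norm_neg, hn]; exact hrad)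
  have hE : Complex.exp (-g x) = Complex.exp (-g y) := by
    rw [Complex.exp_eq_exp_iff_exists_int]
    refine ⟨-1, ?_⟩
    rw [hx', hy']; push_cast; ring
  have h1 := hconst x hx y hy
  rw [hE] at h1
  have h2 := mul_right_cancel₀ (Complex.exp_ne_zero _) h1
  have h3 := hinj hx hy h2
  rw [h3, hy'] at hx'
  have : (Real.pi : ℂ) * Complex.I = 0 := by linear_combination (-1/2) * hx'
  rw [this] at hn
  simp at hn
  exact Real.pi_pos.ne hn

/-- Injective zero-free holomorphic functions. -/
def NiceSec (A : Set ℂ) (s : ℂ → ℂ) : Prop :=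
  DifferentiableOn ℂ s A ∧ Set.InjOn s A ∧ ∀ z ∈ A, s z ≠ 0

lemma exists_star_compact {A K : Set ℂ} {c : ℂ} (hA : StarConvex ℝ c A) (hcA : c ∈ A)
    (hK : IsCompact K) (hKA : K ⊆ A) :
    ∃ K' : Set ℂ, IsCompact K' ∧ K ⊆ K' ∧ K' ⊆ A ∧ StarConvex ℝ c K' ∧ c ∈ K' := by
  refine ⟨(fun x : ℝ × ℂ => c + x.1 • (x.2 - c)) '' (Set.Icc (0 : ℝ) 1 ×ˢ insert c K), ?_, ?_, ?_, ?_, ?_⟩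
  · exact (isCompact_Icc.prod (hK.insert c)).image (by fun_prop)
  · intro z hz
    exact ⟨(1, z), ⟨⟨by norm_num, le_rfl⟩, Set.mem_insert_of_mem _ hz⟩, by simp⟩
  · rintro _ ⟨⟨t, z⟩, ⟨ht, hz⟩, rfl⟩
    exact hA.add_smul_sub_mem (Set.insert_subset hcA hKA hz) ht.1 ht.2
  · rintro _ ⟨⟨t, z⟩, ⟨ht, hz⟩, rfl⟩ a b ha hb hab
    refine ⟨(b * t, z), ⟨⟨mul_nonneg hb ht.1, mul_le_one₀ (by linarith) ht.1 ht.2⟩, hz⟩, ?_⟩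
    have : (a : ℂ) = 1 - b := by rw [← Complex.ofReal_one, ← hab]; push_cast; ring
    simp only [Complex.real_smul, this]; push_cast; ring
  · exact ⟨(0, c), ⟨⟨le_rfl, zero_le_one⟩, Set.mem_insert _ _⟩, by simp⟩

lemma exists_ball_margin {A K : Set ℂ} (hAo : IsOpen A) (hK : IsCompact K) (hKA : K ⊆ A) :
    ∃ ρ > 0, ∀ z ∈ K, Metric.ball z ρ ⊆ A := by
  obtain ⟨ρ, hρ, h⟩ := hK.exists_thickening_subset_open hAo hKA
  exact ⟨ρ, hρ, fun z hz => (Metric.ball_subset_thickening hz ρ).trans h⟩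

lemma harnack_seg {A : Set ℂ} {ρ : ℝ} (hρ : 0 < ρ) {s : ℂ → ℂ} (hs : NiceSec A s) {x y : ℂ}
    (hseg : ∀ z ∈ segment ℝ x y, Metric.ball z ρ ⊆ A) :
    ‖s y‖ ≤ ‖s x‖ * Real.exp (512 / ρ * ‖y - x‖) := by
  have hmem : ∀ t ∈ Set.Icc (0 : ℝ) 1, x + t * (y - x) ∈ segment ℝ x y := by
    intro t ht
    rw [segment_eq_image']
    exact ⟨t, ht, by simp⟩
  have hder : ∀ t ∈ Set.Icc (0 : ℝ) 1, HasDerivAt (fun t : ℝ => s (x + t * (y - x)))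
      (deriv s (x + t * (y - x)) * (y - x)) t := by
    intro t ht
    have hz := hseg _ (hmem t ht)
    have h1 : HasDerivAt s (deriv s (x + t * (y - x))) (x + t * (y - x)) :=
      ((hs.1.mono hz).differentiableAt (Metric.ball_mem_nhds _ hρ)).hasDerivAt
    have h2 : HasDerivAt (fun t : ℂ => x + t * (y - x)) (y - x) (t : ℂ) := by
      simpa using ((hasDerivAt_id (t : ℂ)).mul_const (y - x)).const_add x
    exact (HasDerivAt.comp (t : ℂ) h1 h2).comp_ofReal
  have := norm_le_gronwallBound_of_norm_deriv_right_le (f := fun t : ℝ => s (x + t * (y - x)))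
    (f' := fun t => deriv s (x + t * (y - x)) * (y - x)) (δ := ‖s x‖) (K := 512 / ρ * ‖y - x‖)
    (ε := 0) (a := 0) (b := 1) (fun t ht => (hder t ht).continuousAt.continuousWithinAt)
    (fun t ht => (hder t (Set.Ico_subset_Icc_self ht)).hasDerivWithinAt) (by simp) ?_ 1 (by simp)
  · simpa [gronwallBound_ε0] using this
  · intro t ht
    have hz := hseg _ (hmem t (Set.Ico_subset_Icc_self ht))
    have := logLip hρ (hs.1.mono hz) (hs.2.1.mono hz) (fun z h => hs.2.2 z (hz h))
    rw [norm_mul, add_zero]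
    calc _ ≤ 512 / ρ * ‖s (x + t * (y - x))‖ * ‖y - x‖ := by gcongr
      _ = _ := by ring

lemma harnack {A K : Set ℂ} {c : ℂ} (hAo : IsOpen A) (hA : StarConvex ℝ c A) (hcA : c ∈ A)
    (hK : IsCompact K) (hKA : K ⊆ A) :
    ∃ Λ : ℝ, 0 < Λ ∧ ∀ s, NiceSec A s → ∀ z ∈ K, ∀ z' ∈ K, ‖s z'‖ ≤ Λ * ‖s z‖ := by
  obtain ⟨K', hK', hKK', hK'A, hst, hc⟩ := exists_star_compact hA hcA hK hKA
  obtain ⟨ρ, hρ, hball⟩ := exists_ball_margin hAo hK' hK'A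
  obtain ⟨R, hR⟩ := hK'.isBounded.subset_closedBall c
  refine ⟨Real.exp (512 / ρ * R) * Real.exp (512 / ρ * R), by positivity, fun s hs z hz z' hz' => ?_⟩
  have h1 : ∀ x ∈ K', ‖s x‖ ≤ ‖s c‖ * Real.exp (512 / ρ * R) := by
    intro x hx
    refine (harnack_seg hρ hs fun y hy => hball y (hst.segment_subset hx hy)).trans ?_
    have : ‖x - c‖ ≤ R := by simpa [dist_eq_norm] using hR hx
    gcongr
  have h2 : ∀ x ∈ K', ‖s c‖ ≤ ‖s x‖ * Real.exp (512 / ρ * R) := by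
    intro x hx
    refine (harnack_seg hρ hs (x := x) (y := c) fun y hy => hball y (hst.segment_subset hx
      (by rwa [segment_symm]))).trans ?_
    have : ‖c - x‖ ≤ R := by rw [norm_sub_rev]; simpa [dist_eq_norm] using hR hx
    gcongr
  calc ‖s z'‖ ≤ ‖s c‖ * Real.exp (512 / ρ * R) := h1 z' (hKK' hz')
    _ ≤ (‖s z‖ * Real.exp (512 / ρ * R)) * Real.exp (512 / ρ * R) := by gcongr; exact h2 z (hKK' hz)
    _ = _ := by ring

lemma packing {A K : Set ℂ} {c : ℂ} (hAo : IsOpen A) (hA : StarConvex ℝ c A) (hcA : c ∈ A)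
    (hK : IsCompact K) (hKA : K ⊆ A) (M δ : ℝ) (hδ : 0 < δ) :
    ∃ B : ℕ, ∀ F : Finset (ℂ → ℂ), (∀ s ∈ F, NiceSec A s) →
      (∀ s ∈ F, ∀ t ∈ F, s ≠ t → ∀ z ∈ A, ∀ z' ∈ A, s z ≠ t z') →
      (∀ s ∈ F, ∃ z ∈ K, ‖s z‖ ≤ M) → (∀ s ∈ F, ∃ z ∈ K, δ ≤ ‖deriv s z‖) → F.card ≤ B := by
  obtain ⟨ρ, hρ, hsub⟩ := hK.exists_cthickening_subset_open hAo hKA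
  have hK2 : IsCompact (Metric.cthickening ρ K) := hK.cthickening
  obtain ⟨Λ, hΛ, hH⟩ := harnack hAo hA hcA hK2 hsub
  have hKsub : K ⊆ Metric.cthickening ρ K := Metric.self_subset_cthickening K
  have hbs : ∀ z ∈ K, Metric.ball z ρ ⊆ Metric.cthickening ρ K := fun z hz =>
    (Metric.ball_subset_thickening hz ρ).trans (Metric.thickening_subset_cthickening _ _)
  set κ := ρ / 2 * δ / 64 with hκ
  have hκ0 : 0 < κ := by positivity
  obtain ⟨t, -, htf, hcov⟩ := (isCompact_closedBall (0 : ℂ) (Λ * M)).finite_cover_balls hκ0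
  refine ⟨htf.toFinset.card, fun F hnice hdisj hM hd => ?_⟩
  have key : ∀ s ∈ F, ∃ x ∈ htf.toFinset, x ∈ s '' A := by
    intro s hs
    obtain ⟨z, hz, hzM⟩ := hM s hs
    obtain ⟨y, hy, hyd⟩ := hd s hs
    have hyA : Metric.ball y ρ ⊆ A := (hbs y hy).trans hsub
    have hne : deriv s y ≠ 0 := by
      intro h; rw [h] at hyd; simp at hyd; linarith
    obtain ⟨b, hb⟩ := bloch (half_pos hρ) (half_lt_self hρ) ((hnice s hs).1.mono hyA) hne
    have hb' : Metric.ball b κ ⊆ s '' Metric.ball y ρ :=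
      (Metric.ball_subset_ball (by rw [hκ]; gcongr)).trans hb
    obtain ⟨x0, hx0, hx0b⟩ := hb' (Metric.mem_ball_self hκ0)
    have hbM : b ∈ Metric.closedBall (0 : ℂ) (Λ * M) := by
      rw [← hx0b]; simp only [Metric.mem_closedBall, dist_zero_right]
      refine (hH s (hnice s hs) z (hKsub hz) x0 (hbs y hy hx0)).trans ?_
      gcongr
    obtain ⟨x, hx, hxb⟩ := Set.mem_iUnion₂.mp (hcov hbM)
    refine ⟨x, by simpa using hx, Set.image_mono hyA (hb' ?_)⟩
    rw [Metric.mem_ball, dist_comm]; exact hxb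
  choose! φ hφ hφ2 using key
  refine Finset.card_le_card_of_injOn φ hφ ?_
  intro s hs t ht hst
  by_contra hne
  obtain ⟨z, hz, e1⟩ := hφ2 s hs
  obtain ⟨z', hz', e2⟩ := hφ2 t ht
  exact hdisj s hs t ht hne z hz z' hz' (by rw [e1, e2, hst])

/-- `b` is a value over which `P/Q` has the maximal number of distinct finite preimages. -/
def GoodVal (P Q : ℂ[X]) (b : ℂ) : Prop :=
  (P - C b * Q).natDegree = max P.natDegree Q.natDegree ∧ (P - C b * Q).roots.Nodup

lemma coprime_ne {P Q : ℂ[X]} (h : IsCoprime P Q) {y : ℂ} (hQ : Q.eval y = 0) : P.eval y ≠ 0 := by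
  intro hP
  obtain ⟨a, b, hab⟩ := h
  have := congrArg (Polynomial.eval y) hab
  simp [hP, hQ] at this

lemma natDegree_sub_le_max (P Q : ℂ[X]) (b : ℂ) :
    (P - C b * Q).natDegree ≤ max P.natDegree Q.natDegree :=
  (natDegree_sub_le _ _).trans (max_le_max le_rfl (natDegree_C_mul_le _ _))

lemma finite_not_goodVal {P Q : ℂ[X]} (hcop : IsCoprime P Q) (hd : 1 ≤ max P.natDegree Q.natDegree) :
    {b | ¬ GoodVal P Q b}.Finite := by
  set d := max P.natDegree Q.natDegree with hdd
  have hW : wronskian P Q ≠ 0 := by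
    intro h
    obtain ⟨h1, h2⟩ := hcop.wronskian_eq_zero_iff.mp h
    have := derivative_eq_zero.mp h1
    have := derivative_eq_zero.mp h2
    omega
  apply Set.Finite.subset (((wronskian P Q).roots.toFinset.image
    (fun y => P.eval y / Q.eval y) ∪ {P.coeff d / Q.coeff d} : Finset ℂ).finite_toSet)
  intro b hb
  simp only [Finset.coe_union, Finset.coe_image, Finset.coe_singleton, Set.union_singleton,
    Set.mem_insert_iff, Set.mem_image, Finset.mem_coe, Multiset.mem_toFinset]
  by_contra hcon
  push Not at hcon
  obtain ⟨hc1, hc2⟩ := hcon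
  apply hb
  have hdeg : (P - C b * Q).natDegree = d := by
    apply le_antisymm (natDegree_sub_le_max P Q b)
    apply le_natDegree_of_ne_zero
    rw [coeff_sub, coeff_C_mul]
    intro h
    by_cases hq : Q.coeff d = 0
    · have hp : P.coeff d = 0 := by rw [hq, mul_zero, sub_zero] at h; exact h
      rcases max_choice P.natDegree Q.natDegree with e | e
      · rw [← hdd] at e
        have : P = 0 := leadingCoeff_eq_zero.mp (by rw [leadingCoeff, ← e]; exact hp)
        subst this; simp at e; omega
      · rw [← hdd] at e
        have : Q = 0 := leadingCoeff_eq_zero.mp (by rw [leadingCoeff, ← e]; exact hq)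
        subst this; simp at e; omega
    · apply hc1; rw [eq_div_iff hq]; linear_combination -h
  refine ⟨hdeg, ?_⟩
  apply nodup_roots
  rw [separable_def]
  have hne : P - C b * Q ≠ 0 := by intro h; rw [h] at hdeg; simp at hdeg; omega
  by_contra hnc
  have : ∃ y, (P - C b * Q).eval y = 0 ∧ (derivative (P - C b * Q)).eval y = 0 := by
    by_contra hno
    push Not at hno
    apply hnc
    exact (Polynomial.isCoprime_iff_aeval_ne_zero_of_isAlgClosed ℂ ℂ _ _).mpr (fun a => by
      by_cases ha : (P - C b * Q).eval a = 0
      · right; simpa using hno a ha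
      · left; simpa using ha)
  obtain ⟨y, hy1, hy2⟩ := this
  simp only [eval_sub, eval_mul, eval_C, derivative_sub, derivative_mul, derivative_C, zero_mul,
    zero_add] at hy1 hy2
  have hQ : Q.eval y ≠ 0 := by
    intro h
    exact coprime_ne hcop h (by simpa [h] using hy1)
  apply hc2 y
  · rw [mem_roots hW, IsRoot, wronskian]
    simp only [eval_sub, eval_mul]
    have e1 : P.eval y = b * Q.eval y := by linear_combination hy1
    have e2 : (derivative P).eval y = b * (derivative Q).eval y := by linear_combination hy2
    rw [e1, e2]; ring
  · rw [div_eq_iff hQ]; linear_combination hy1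

lemma root_bounded {P Q : ℂ[X]} (hd : 1 ≤ max P.natDegree Q.natDegree) {x : ℂ} (hx : GoodVal P Q x) :
    ∃ M : ℝ, ∀ᶠ x' in 𝓝 x, ∀ y : ℂ, P.eval y = x' * Q.eval y → ‖y‖ ≤ M := by
  set d := max P.natDegree Q.natDegree with hdd
  set l : ℂ → ℂ := fun x' => (P - C x' * Q).coeff d with hl
  have hlx : l x ≠ 0 := by
    have : (P - C x * Q).leadingCoeff = l x := by rw [leadingCoeff, hx.1]
    rw [← this]; intro h
    rw [leadingCoeff_eq_zero] at h
    have := hx.1; rw [h] at this; simp at this; omega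
  have hlc : ∀ k, Continuous (fun x' : ℂ => (P - C x' * Q).coeff k) := by
    intro k; simp only [coeff_sub, coeff_C_mul]; fun_prop
  set g : ℂ → ℝ := fun x' => (∑ k ∈ Finset.range d, ‖(P - C x' * Q).coeff k‖) / ‖l x'‖ with hg
  have hgc : ContinuousAt g x := by
    apply ContinuousAt.div
    · exact (continuous_finsetSum _ fun k _ => (hlc k).norm).continuousAt
    · exact (hlc d).norm.continuousAt
    · simpa using hlx
  refine ⟨max 1 (g x + 1), ?_⟩
  filter_upwards [hgc.eventually_lt continuousAt_const (show g x < g x + 1 by linarith),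
    (hlc d).continuousAt.eventually_ne hlx] with x' h1 h2 y hy
  by_cases hy1 : ‖y‖ ≤ 1
  · exact hy1.trans (le_max_left _ _)
  push Not at hy1
  refine le_trans ?_ ((le_of_lt h1).trans (le_max_right _ _))
  have hl0 : 0 < ‖l x'‖ := norm_pos_iff.mpr h2
  rw [hg, le_div_iff₀ hl0]
  have hev : (P - C x' * Q).eval y = 0 := by simp [hy]
  rw [eval_eq_sum_range' (n := d + 1) (by have := natDegree_sub_le_max P Q x'; omega),
    Finset.sum_range_succ] at hev
  have hb : ‖l x' * y ^ d‖ ≤ (∑ k ∈ Finset.range d, ‖(P - C x' * Q).coeff k‖) * ‖y‖ ^ (d - 1) := by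
    have : l x' * y ^ d = - ∑ k ∈ Finset.range d, (P - C x' * Q).coeff k * y ^ k := by
      linear_combination hev
    rw [this, norm_neg, Finset.sum_mul]
    refine (norm_sum_le _ _).trans (Finset.sum_le_sum fun k hk => ?_)
    rw [norm_mul, norm_pow]
    gcongr
    · exact hy1.le
    · have := Finset.mem_range.mp hk; omega
  rw [norm_mul, norm_pow] at hb
  have hyp : 0 < ‖y‖ ^ (d - 1) := by positivity
  have e : ‖y‖ ^ d = ‖y‖ * ‖y‖ ^ (d - 1) := by
    rw [← pow_succ']; congr 1; omega
  rw [e] at hb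
  have : (‖y‖ * ‖l x'‖) * ‖y‖ ^ (d - 1) ≤
    (∑ k ∈ Finset.range d, ‖(P - C x' * Q).coeff k‖) * ‖y‖ ^ (d - 1) := by linarith
  exact le_of_mul_le_mul_right this hyp

/-- Regular part of the domain of `P/Q`. -/
abbrev EReg (P Q : ℂ[X]) (S : Set ℂ) : Type :=
  {y : ℂ // Q.eval y ≠ 0 ∧ P.eval y / Q.eval y ∉ S}

def piReg (P Q : ℂ[X]) (S : Set ℂ) : EReg P Q S → {b : ℂ // b ∉ S} :=
  fun y => ⟨P.eval y.1 / Q.eval y.1, y.2.2⟩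

lemma deriv_rat_ne {P Q : ℂ[X]} (hd : 1 ≤ max P.natDegree Q.natDegree) {y : ℂ} (hQ : Q.eval y ≠ 0)
    (hg : GoodVal P Q (P.eval y / Q.eval y)) :
    ∃ f' : ℂ, f' ≠ 0 ∧ HasStrictDerivAt (fun z => P.eval z / Q.eval z) f' y := by
  refine ⟨_, ?_, (P.hasStrictDerivAt y).fun_div (Q.hasStrictDerivAt y) hQ⟩
  set b := P.eval y / Q.eval y with hb
  have hP : P.eval y = b * Q.eval y := by rw [hb]; field_simp
  set f := P - C b * Q with hf
  have hfne : f ≠ 0 := by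
    intro h
    have := hg.1
    rw [← hf, h] at this; simp at this; omega
  have hroot : f.IsRoot y := by simp [f, IsRoot, hP]
  have hcount : f.roots.count y = 1 :=
    Multiset.count_eq_one_of_mem hg.2 ((mem_roots hfne).mpr hroot)
  rw [count_roots] at hcount
  intro h0
  rw [div_eq_zero_iff] at h0
  rcases h0 with h0 | h0
  swap
  · exact hQ (by simpa using h0)
  have hder : (derivative f).eval y = 0 := by
    simp only [f, derivative_sub, derivative_mul, derivative_C, zero_mul, zero_add, eval_sub,
      eval_mul, eval_C]
    rw [hP] at h0
    have : Q.eval y * ((derivative P).eval y - b * (derivative Q).eval y) = 0 := by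
      linear_combination h0
    exact (mul_eq_zero.mp this).resolve_left hQ
  have := (one_lt_rootMultiplicity_iff_isRoot hfne).mpr ⟨hroot, hder⟩
  omega

lemma isOpen_EReg {P Q : ℂ[X]} {S : Set ℂ} (hS : IsClosed S) :
    IsOpen {y : ℂ | Q.eval y ≠ 0 ∧ P.eval y / Q.eval y ∉ S} := by
  rw [isOpen_iff_mem_nhds]
  rintro y ⟨h1, h2⟩
  have hc : ContinuousAt (fun z => P.eval z / Q.eval z) y :=
    P.continuous.continuousAt.div Q.continuous.continuousAt h1
  filter_upwards [Q.continuous.continuousAt.eventually_ne h1,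
    hc.eventually (hS.isOpen_compl.mem_nhds h2)] with z h3 h4
  exact ⟨h3, h4⟩

lemma continuous_piReg (P Q : ℂ[X]) (S : Set ℂ) : Continuous (piReg P Q S) := by
  apply Continuous.subtype_mk
  exact (P.continuous.comp continuous_subtype_val).div (Q.continuous.comp continuous_subtype_val)
    (fun y => y.2.1)

lemma isCoveringMap_piReg {P Q : ℂ[X]} (hcop : IsCoprime P Q)
    (hd : 1 ≤ max P.natDegree Q.natDegree) {S : Set ℂ} (hSc : IsClosed S)
    (hS : ∀ b ∉ S, GoodVal P Q b) : IsCoveringMap (piReg P Q S) := by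
  rw [isCoveringMap_iff_isCoveringMapOn_univ]
  have hcl : IsClosedMap (piReg P Q S) := by
    intro C hC
    apply IsSeqClosed.isClosed
    intro u x hu hux
    choose y hyC hy using hu
    have hux' : Tendsto (fun n => (u n : ℂ)) atTop (𝓝 (x : ℂ)) :=
      (continuous_subtype_val.tendsto x).comp hux
    have hyeq : ∀ n, P.eval (y n).1 = (u n : ℂ) * Q.eval (y n).1 := by
      intro n
      rw [← hy n]; simp only [piReg]
      field_simp [(y n).2.1]
    obtain ⟨M, hM⟩ := root_bounded hd (hS x x.2)
    have hbd : ∃ᶠ n in atTop, (y n).1 ∈ Metric.closedBall (0 : ℂ) M := by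
      apply Eventually.frequently
      filter_upwards [hux'.eventually hM] with n hn
      simpa using hn _ (hyeq n)
    obtain ⟨a, -, φ, hφ, hlim⟩ := tendsto_subseq_of_frequently_bounded Metric.isBounded_closedBall hbd
    have hPa : P.eval a = x * Q.eval a := by
      have h1 := (P.continuous.tendsto a).comp hlim
      have h2 := (hux'.comp hφ.tendsto_atTop).mul ((Q.continuous.tendsto a).comp hlim)
      refine tendsto_nhds_unique h1 (h2.congr fun n => ?_)
      simp [hyeq]
    have hQa : Q.eval a ≠ 0 := fun h => coprime_ne hcop h (by rw [hPa, h, mul_zero])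
    have hx : P.eval a / Q.eval a = x := by rw [hPa]; field_simp
    refine ⟨⟨a, hQa, by rw [hx]; exact x.2⟩, ?_, Subtype.ext hx⟩
    refine hC.mem_of_tendsto (f := fun n => y (φ n)) (b := atTop) ?_ (Eventually.of_forall fun n => hyC _)
    rw [tendsto_subtype_rng]; exact hlim
  refine hcl.isCoveringMapOn_of_isLocalHomeomorphOn ?_ ?_
  · intro x _
    have hne : P - Polynomial.C (x : ℂ) * Q ≠ 0 := by
      intro h
      have := (hS x x.2).1
      rw [h] at this; simp at this; omega
    apply Set.Finite.of_finite_image (f := Subtype.val) _ Subtype.val_injective.injOn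
    apply ((P - Polynomial.C (x : ℂ) * Q).roots.toFinset.finite_toSet).subset
    rintro _ ⟨y, hy, rfl⟩
    have : P.eval y.1 / Q.eval y.1 = x := congrArg Subtype.val hy
    rw [div_eq_iff y.2.1] at this
    simp [hne, this]
  · rw [Set.preimage_univ, ← isLocalHomeomorph_iff_isLocalHomeomorphOn_univ]
    have hSo : IsOpen {b : ℂ | b ∉ S} := hSc.isOpen_compl
    refine IsLocalHomeomorph.of_comp (g := Subtype.val) ?_
      hSo.isOpenEmbedding_subtypeVal.isLocalHomeomorph (continuous_piReg P Q S)
    have hE := (isOpen_EReg (P := P) (Q := Q) hSc).isOpenEmbedding_subtypeVal.isLocalHomeomorph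
    have hL : IsLocalHomeomorphOn (fun z => P.eval z / Q.eval z)
        {y : ℂ | Q.eval y ≠ 0 ∧ P.eval y / Q.eval y ∉ S} := by
      rintro y ⟨h1, h2⟩
      obtain ⟨f', hf', hs⟩ := deriv_rat_ne hd h1 (hS _ h2)
      exact ⟨_, (hs.hasStrictFDerivAt_equiv hf').mem_toOpenPartialHomeomorph_source, by simp⟩
    have := hL.comp (hE.isLocalHomeomorphOn (s := Set.univ)) (fun y _ => y.2)
    rw [isLocalHomeomorph_iff_isLocalHomeomorphOn_univ]
    exact this

lemma lifting {P Q : ℂ[X]} (hcop : IsCoprime P Q)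
    (hd : 1 ≤ max P.natDegree Q.natDegree) {S : Set ℂ} (hSc : IsClosed S)
    (hS : ∀ b ∉ S, GoodVal P Q b) {A : Set ℂ} {c : ℂ} (hAo : IsOpen A) (hA : StarConvex ℝ c A)
    (hcA : c ∈ A) {s : ℂ → ℂ} (hs : DifferentiableOn ℂ s A) (hsS : ∀ z ∈ A, s z ∉ S) :
    ∃ L : Finset (ℂ → ℂ), L.card = max P.natDegree Q.natDegree ∧
      (∀ t ∈ L, DifferentiableOn ℂ t A ∧
        ∀ z ∈ A, Q.eval (t z) ≠ 0 ∧ P.eval (t z) = s z * Q.eval (t z)) ∧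
      (∀ t ∈ L, ∀ t' ∈ L, t ≠ t' → ∀ z ∈ A, t z ≠ t' z) := by
  have cov := isCoveringMap_piReg hcop hd hSc hS
  have := hA.contractibleSpace ⟨c, hcA⟩
  have := hAo.locallyPathConnectedSpace
  let f : C(A, {b : ℂ // b ∉ S}) := ⟨fun z => ⟨s z, hsS z z.2⟩, by
    apply Continuous.subtype_mk
    exact continuousOn_iff_continuous_domRestrict.mp hs.continuousOn⟩
  have hlift : ∀ (a : A) (y : ℂ), P.eval y = s a * Q.eval y →
      ∃! F : C(A, EReg P Q S), (F a).1 = y ∧ piReg P Q S ∘ F = f := by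
    intro a y hy
    have hQ : Q.eval y ≠ 0 := fun h => coprime_ne hcop h (by rw [hy, h, mul_zero])
    have hx : P.eval y / Q.eval y = s a := by rw [hy]; field_simp
    have := cov.existsUnique_continuousMap_lifts f a ⟨y, hQ, by rw [hx]; exact hsS a a.2⟩
      (Subtype.ext hx)
    obtain ⟨F, ⟨h1, h2⟩, h3⟩ := this
    exact ⟨F, ⟨by rw [h1], h2⟩, fun G hG => h3 G ⟨Subtype.ext hG.1, hG.2⟩⟩
  set g := P - C (s c) * Q with hg
  have hgood := hS _ (hsS c hcA)
  have hgne : g ≠ 0 := by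
    intro h
    have := hgood.1
    rw [← hg, h] at this; simp at this; omega
  have hroot : ∀ y ∈ g.roots.toFinset, P.eval y = s (⟨c, hcA⟩ : A) * Q.eval y := by
    intro y hy
    have : g.eval y = 0 := by simpa [hgne] using hy
    simp only [g, eval_sub, eval_mul, eval_C] at this
    linear_combination this
  have : Nonempty C(A, EReg P Q S) := by
    obtain ⟨y, hy⟩ := IsAlgClosed.exists_root g (by
      rw [degree_eq_natDegree hgne, hgood.1]; norm_cast; omega)
    exact ⟨(hlift ⟨c, hcA⟩ y (hroot y (by simpa [hgne] using hy))).choose⟩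
  have hch : ∀ y ∈ g.roots.toFinset, ∃ F : C(A, EReg P Q S),
    (F ⟨c, hcA⟩).1 = y ∧ piReg P Q S ∘ F = f := fun y hy => (hlift ⟨c, hcA⟩ y (hroot y hy)).exists
  choose! F hF using hch
  let T : ℂ → ℂ → ℂ := fun y z => if h : z ∈ A then (F y ⟨z, h⟩).1 else 0
  have hT : ∀ y z (h : z ∈ A), T y z = (F y ⟨z, h⟩).1 := fun y z h => by simp [T, h]
  have hTc : ∀ y ∈ g.roots.toFinset, T y c = y := fun y hy => by
    rw [hT y c hcA]; exact (hF y hy).1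
  have hTeq : ∀ y ∈ g.roots.toFinset, ∀ z ∈ A, Q.eval (T y z) ≠ 0 ∧
      P.eval (T y z) / Q.eval (T y z) = s z := by
    intro y hy z hz
    rw [hT y z hz]
    exact ⟨(F y ⟨z, hz⟩).2.1, congrArg Subtype.val (congrFun (hF y hy).2 ⟨z, hz⟩)⟩
  have hTcont : ∀ y, ContinuousOn (T y) A := by
    intro y
    rw [continuousOn_iff_continuous_domRestrict]
    have : Continuous fun z : A => (F y z).1 := continuous_subtype_val.comp (F y).continuous
    convert this using 1
    ext z; exact hT y z z.2
  refine ⟨g.roots.toFinset.image T, ?_, ?_, ?_⟩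
  · rw [Finset.card_image_of_injOn, Multiset.toFinset_card_of_nodup hgood.2,
      ← hgood.1, ← hg, (IsAlgClosed.card_roots_eq_natDegree)]
    intro y hy y' hy' h
    rw [← hTc y hy, ← hTc y' hy', h]
  · intro t ht
    obtain ⟨y, hy, rfl⟩ := Finset.mem_image.mp ht
    refine ⟨fun z hz => ?_, fun z hz => ⟨(hTeq y hy z hz).1, ?_⟩⟩
    · apply DifferentiableAt.differentiableWithinAt
      obtain ⟨hq, he⟩ := hTeq y hy z hz
      obtain ⟨f', hf', hsd⟩ := deriv_rat_ne hd hq (by rw [he]; exact hS _ (hsS z hz))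
      have hAz : A ∈ 𝓝 z := hAo.mem_nhds hz
      have hinv := hsd.to_localInverse hf'
      have h1 := hsd.eventually_left_inverse hf'
      have h2 : ContinuousAt (T y) z := (hTcont y).continuousAt hAz
      have h3 := h2.eventually h1
      simp only [he] at hinv
      have h4 : DifferentiableAt ℂ (fun z => (hsd.localInverse _ _ _ hf') (s z)) z :=
        hinv.hasDerivAt.differentiableAt.comp z (hs.differentiableAt hAz)
      apply h4.congr_of_eventuallyEq
      filter_upwards [h3, hAz] with x hx hxA
      rw [(hTeq y hy x hxA).2] at hx
      exact hx.symm
    · obtain ⟨hq, he⟩ := hTeq y hy z hz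
      rwa [div_eq_iff hq] at he
  · intro t ht t' ht' hne z hz heq
    obtain ⟨y, hy, rfl⟩ := Finset.mem_image.mp ht
    obtain ⟨y', hy', rfl⟩ := Finset.mem_image.mp ht'
    obtain ⟨hq, he⟩ := hTeq y hy z hz
    rw [div_eq_iff hq] at he
    have hu := (hlift ⟨z, hz⟩ (T y z) he).unique ⟨(hT y z hz).symm, (hF y hy).2⟩
      ⟨by rw [heq]; exact (hT y' z hz).symm, (hF y' hy').2⟩
    apply hne
    ext x; simp only [T, hu]

/-! ### Preimages -/

lemma coe_multiset (s : Multiset ℂ) :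
    (do let a ← s; pure (a : Sphere)) = Multiset.map (fun z : ℂ => (z : Sphere)) s := by
  show s.bind (fun a => {(a : Sphere)}) = _
  exact Multiset.bind_singleton _ _

lemma fiber_infty (P Q : ℂ[X]) : fiber P Q OnePoint.infty =
    Multiset.map (fun z : ℂ => (z : Sphere)) Q.roots +
      Multiset.replicate (max P.natDegree Q.natDegree - Q.natDegree) (OnePoint.infty : Sphere) := by
  simp only [fiber, OnePoint.elim_infty, coe_multiset, Multiset.map_id']

lemma fiber_coe (P Q : ℂ[X]) (b : ℂ) : fiber P Q (b : Sphere) =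
    Multiset.map (fun z : ℂ => (z : Sphere)) (P - C b * Q).roots +
      Multiset.replicate (max P.natDegree Q.natDegree - (P - C b * Q).natDegree)
        (OnePoint.infty : Sphere) := by
  simp only [fiber, OnePoint.elim_some, coe_multiset, Multiset.map_id']

lemma fixMul_eq (a : ℂ[X] × ℂ[X]) : fixMul a =
    Multiset.map (fun z : ℂ => (z : Sphere)) (a.1 - X * a.2).roots +
    Multiset.replicate (max a.1.natDegree a.2.natDegree + 1 - (a.1 - X * a.2).natDegree)
      (OnePoint.infty : Sphere) := by
  simp only [fixMul, coe_multiset, Multiset.map_id']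

lemma card_fiber (P Q : ℂ[X]) (a : Sphere) :
    (fiber P Q a).card = max P.natDegree Q.natDegree := by
  induction a using OnePoint.rec with
  | infty =>
    simp only [fiber_infty, Multiset.card_add, Multiset.card_map,
      Multiset.card_replicate, IsAlgClosed.card_roots_eq_natDegree]
    omega
  | coe b =>
    simp only [fiber_coe, Multiset.card_add, Multiset.card_map,
      Multiset.card_replicate, IsAlgClosed.card_roots_eq_natDegree]
    have := natDegree_sub_le_max P Q b
    omega

lemma card_preimT (x : SymX N) : (preimT p q x).card = Dtot p q := by
  simp [preimT, Dtot, card_fiber, degR]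

lemma card_preimTn (n : ℕ) (x : SymX N) : (preimTn p q n x).card = Dtot p q ^ n := by
  induction n generalizing x with
  | zero => simp [preimTn]
  | succ n ih =>
    simp only [preimTn, Multiset.card_bind, Function.comp_def, ih]
    simp [card_preimT, pow_succ, mul_comm]

lemma preimTn_add (m n : ℕ) (x : SymX N) :
    preimTn p q (m + n) x = (preimTn p q m x).bind (preimTn p q n) := by
  induction m generalizing x with
  | zero => simp [preimTn]
  | succ m ih =>
    rw [Nat.add_right_comm]
    simp only [preimTn, Multiset.bind_assoc, ih]

lemma preimTn_one (x : SymX N) : preimTn p q 1 x = preimT p q x := by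
  simp only [preimTn]
  rw [Multiset.bind_singleton (f := fun y => y), Multiset.map_id']

lemma preimTn_succ' (n : ℕ) (x : SymX N) :
    preimTn p q (n + 1) x = (preimTn p q n x).bind (preimT p q) := by
  rw [preimTn_add]; congr 1; ext y; rw [preimTn_one]

variable {p q} in
lemma Good.lt (hg : Good p q) : N + 1 ≤ Dtot p q := by
  obtain ⟨-, -, h1, i, hi⟩ := hg
  have : ∑ _j : Fin N, 1 < ∑ j, degR p q j :=
    Finset.sum_lt_sum (fun j _ => h1 j) ⟨i, Finset.mem_univ _, hi⟩
  simpa [Dtot] using this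

lemma compPair_eval (a b : ℂ[X] × ℂ[X]) {y x : ℂ} (h : b.1.eval y = x * b.2.eval y) :
    (compPair a b).1.eval y = b.2.eval y ^ (max a.1.natDegree a.2.natDegree) * a.1.eval x ∧
    (compPair a b).2.eval y = b.2.eval y ^ (max a.1.natDegree a.2.natDegree) * a.2.eval x := by
  have key : ∀ k ∈ Finset.range (max a.1.natDegree a.2.natDegree + 1), ∀ c : ℂ,
      c * b.1.eval y ^ k * b.2.eval y ^ (max a.1.natDegree a.2.natDegree - k) =
        b.2.eval y ^ (max a.1.natDegree a.2.natDegree) * (c * x ^ k) := by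
    intro k hk c
    have : k ≤ max a.1.natDegree a.2.natDegree := by have := Finset.mem_range.mp hk; omega
    rw [h, mul_pow, ← Nat.sub_add_cancel this, pow_add, Nat.add_sub_cancel]; ring
  constructor
  · rw [eval_eq_sum_range' (n := max a.1.natDegree a.2.natDegree + 1) (p := a.1) (by omega),
      Finset.mul_sum]
    simp only [compPair, eval_finsetSum, eval_mul, eval_C, eval_pow]
    exact Finset.sum_congr rfl fun k hk => key k hk _
  · rw [eval_eq_sum_range' (n := max a.1.natDegree a.2.natDegree + 1) (p := a.2) (by omega),
      Finset.mul_sum]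
    simp only [compPair, eval_finsetSum, eval_mul, eval_C, eval_pow]
    exact Finset.sum_congr rfl fun k hk => key k hk _

/-- Prepend a finite word. -/
def catW {n : ℕ} (v : Fin n → Fin N) (w : ℕ → Fin N) : ℕ → Fin N :=
  fun k => if h : k < n then v ⟨k, h⟩ else w (k - n)

lemma consW_catW {n : ℕ} (i : Fin N) (v : Fin n → Fin N) (w : ℕ → Fin N) :
    consW i (catW v w) = catW (Fin.cons i v : Fin (n + 1) → Fin N) w := by
  ext k
  rcases k with _ | k
  · simp [consW, catW]
  · simp only [consW, catW, Nat.add_eq_zero_iff, one_ne_zero, and_false, if_false,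
      Nat.add_sub_cancel, Nat.add_lt_add_iff_right, Nat.add_sub_add_right]
    split_ifs with h
    · congr 1
    · rfl

lemma catW_injective {n : ℕ} (w : ℕ → Fin N) :
    Function.Injective (fun v : Fin n → Fin N => catW v w) := by
  intro v v' h
  ext ⟨k, hk⟩
  have := congrFun h k
  simp only [catW, hk, dif_pos] at this
  rw [this]

lemma itComp_succ' (w : ℕ → Fin N) (n : ℕ) (y : Sphere) :
    itComp p q w (n + 1) y = itComp p q (shiftW w) n (ratEval (p (w 0)) (q (w 0)) y) := by
  induction n with
  | zero => rfl
  | succ n ih =>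
    rw [itComp, Function.comp_apply, ih]; rfl

lemma shiftW_consW (i : Fin N) (w : ℕ → Fin N) : shiftW (consW i w) = w := by
  ext k; simp [shiftW, consW]

/-- Families of inverse branches. -/
structure SecFam (S : Finset ℂ) (A : Set ℂ) (n : ℕ)
    (F : Finset ((Fin n → Fin N) × (ℂ → ℂ))) : Prop where
  diff : ∀ x ∈ F, DifferentiableOn ℂ x.2 A
  avoid : ∀ x ∈ F, ∀ z ∈ A, x.2 z ∉ S
  eqn : ∀ x ∈ F, ∀ z ∈ A, (wordPair p q (List.ofFn x.1)).2.eval (x.2 z) ≠ 0 ∧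
    (wordPair p q (List.ofFn x.1)).1.eval (x.2 z) =
      z * (wordPair p q (List.ofFn x.1)).2.eval (x.2 z)
  dist : ∀ x ∈ F, ∀ y ∈ F, x.1 = y.1 → x.2 ≠ y.2 → ∀ z ∈ A, x.2 z ≠ y.2 z
  pre : ∀ x ∈ F, ∀ w, ∀ z ∈ A, (catW x.1 w, (x.2 z : Sphere)) ∈ preimTn p q n (w, (z : Sphere))
  it : ∀ x ∈ F, ∀ w, ∀ z ∈ A, itComp p q (catW x.1 w) n (x.2 z : Sphere) = (z : Sphere)

variable {p q} in
lemma SecFam.eq_of {S : Finset ℂ} {A : Set ℂ} {n : ℕ} {F : Finset ((Fin n → Fin N) × (ℂ → ℂ))}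
    (h : SecFam p q S A n F) {x y} (hx : x ∈ F) (hy : y ∈ F) (hxy : x.1 = y.1) {z z' : ℂ}
    (hz : z ∈ A) (hz' : z' ∈ A) (he : x.2 z = y.2 z') : z = z' ∧ x = y := by
  obtain ⟨a1, a2⟩ := h.eqn x hx z hz
  obtain ⟨b1, b2⟩ := h.eqn y hy z' hz'
  rw [← hxy, ← he] at b2
  have hzz : z = z' := mul_right_cancel₀ a1 (a2.symm.trans b2)
  refine ⟨hzz, ?_⟩
  by_contra hne
  exact h.dist x hx y hy hxy (fun h2 => hne (Prod.ext hxy h2)) z hz (hzz ▸ he)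

variable {p q} in
lemma SecFam.le {S : Finset ℂ} {A : Set ℂ} {n : ℕ} {F : Finset ((Fin n → Fin N) × (ℂ → ℂ))}
    (h : SecFam p q S A n F) (w : ℕ → Fin N) {z : ℂ} (hz : z ∈ A) :
    F.val.map (fun x => (catW x.1 w, (x.2 z : Sphere))) ≤ preimTn p q n (w, (z : Sphere)) := by
  rw [Multiset.le_iff_subset]
  · intro a ha
    obtain ⟨x, hx, rfl⟩ := Multiset.mem_map.mp ha
    exact h.pre x hx w z hz
  · refine Multiset.Nodup.map_on ?_ F.nodup
    intro x hx y hy he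
    have h1 : x.1 = y.1 := catW_injective w (congrArg Prod.fst he)
    have h2 : x.2 z = y.2 z := OnePoint.coe_injective (congrArg Prod.snd he)
    exact (h.eq_of hx hy h1 hz hz h2).2

lemma SecFam.zero {S : Finset ℂ} {A : Set ℂ} (hAS : ∀ z ∈ A, z ∉ S) :
    SecFam p q S A 0 {(Fin.elim0, id)} := by
  have hc : ∀ w : ℕ → Fin N, catW (Fin.elim0 : Fin 0 → Fin N) w = w := by
    intro w; ext k; simp [catW]
  constructor
  · intro x hx; rw [Finset.mem_singleton.mp hx]; exact differentiableOn_id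
  · intro x hx; rw [Finset.mem_singleton.mp hx]; exact hAS
  · intro x hx z hz; rw [Finset.mem_singleton.mp hx]; simp [wordPair]
  · intro x hx y hy _ hne
    rw [Finset.mem_singleton.mp hx, Finset.mem_singleton.mp hy] at hne
    exact absurd rfl hne
  · intro x hx w z hz; rw [Finset.mem_singleton.mp hx, hc]; simp [preimTn]
  · intro x hx w z hz; rw [Finset.mem_singleton.mp hx, hc]; simp [itComp]

/-! ### The section machine -/

variable {p q} in
lemma SecFam.step (hg : Good p q) {S : Finset ℂ} (hS : ∀ i, ∀ b, b ∉ S → GoodVal (p i) (q i) b)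
    {A : Set ℂ} {c : ℂ} (hAo : IsOpen A) (hA : StarConvex ℝ c A) (hcA : c ∈ A) {n : ℕ}
    {F : Finset ((Fin n → Fin N) × (ℂ → ℂ))} (h : SecFam p q S A n F) :
    ∃ F' : Finset ((Fin (n + 1) → Fin N) × (ℂ → ℂ)), SecFam p q ∅ A (n + 1) F' ∧
      F'.card = Dtot p q * F.card := by
  have hL : ∀ x ∈ F, ∀ i : Fin N, _ := fun x hx i =>
    lifting (hg.2.1 i) (hg.2.2.1 i) S.finite_toSet.isClosed (fun b hb => hS i b hb) hAo hA hcA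
      (h.diff x hx) (fun z hz => h.avoid x hx z hz)
  choose! L hLc hLs hLd using hL
  have hne : ∀ x ∈ F, ∀ i z, z ∈ A → p i - C (x.2 z) * q i ≠ 0 := by
    intro x hx i z hz h0
    have h1 := (hS i _ (h.avoid x hx z hz)).1
    rw [h0, natDegree_zero] at h1
    have h2 := hg.2.2.1 i
    unfold degR at h2
    omega
  have hdet : ∀ x ∈ F, ∀ y ∈ F, ∀ i t t', t ∈ L x i → t' ∈ L y i → x.1 = y.1 → ∀ z ∈ A,
      t z = t' z → x = y := by
    intro x hx y hy i t t' ht ht' hxy z hz he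
    obtain ⟨a1, a2⟩ := (hLs x hx i t ht).2 z hz
    obtain ⟨b1, b2⟩ := (hLs y hy i t' ht').2 z hz
    rw [← he] at b2
    have : x.2 z = y.2 z := mul_right_cancel₀ a1 (a2.symm.trans b2)
    exact (h.eq_of hx hy hxy hz hz this).2
  set F' : Finset ((Fin (n + 1) → Fin N) × (ℂ → ℂ)) :=
    (F ×ˢ (Finset.univ : Finset (Fin N))).biUnion fun a =>
      (L a.1 a.2).image fun t => ((Fin.cons a.2 a.1.1 : Fin (n + 1) → Fin N), t) with hF'
  have hmem : ∀ y ∈ F', ∃ x ∈ F, ∃ i, ∃ t ∈ L x i, y = ((Fin.cons i x.1 : Fin (n + 1) → Fin N), t) := by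
    intro y hy
    simp only [hF', Finset.mem_biUnion, Finset.mem_product, Finset.mem_univ, and_true,
      Finset.mem_image, Prod.exists] at hy
    obtain ⟨u, s, i, hx, t, ht, rfl⟩ := hy
    exact ⟨(u, s), hx, i, t, ht, rfl⟩
  refine ⟨F', ⟨?_, ?_, ?_, ?_, ?_, ?_⟩, ?_⟩
  · intro y hy
    obtain ⟨x, hx, i, t, ht, rfl⟩ := hmem y hy
    exact (hLs x hx i t ht).1
  · intro y hy z hz
    simp
  · intro y hy z hz
    obtain ⟨x, hx, i, t, ht, rfl⟩ := hmem y hy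
    obtain ⟨a1, a2⟩ := (hLs x hx i t ht).2 z hz
    obtain ⟨b1, b2⟩ := h.eqn x hx z hz
    obtain ⟨c1, c2⟩ := compPair_eval (wordPair p q (List.ofFn x.1)) (p i, q i) a2
    simp only [List.ofFn_succ, Fin.cons_zero, Fin.cons_succ, wordPair]
    rw [c1, c2, b2]
    refine ⟨mul_ne_zero (pow_ne_zero _ a1) b1, by ring⟩
  · intro y hy y' hy' he hne' z hz hzz
    obtain ⟨x, hx, i, t, ht, rfl⟩ := hmem y hy
    obtain ⟨x', hx', i', t', ht', rfl⟩ := hmem y' hy'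
    simp only at he hne' hzz
    obtain ⟨rfl, h1⟩ := Fin.cons_injective2 he
    obtain rfl := hdet x hx x' hx' i t t' ht ht' h1 z hz hzz
    exact hLd x hx i t ht t' ht' hne' z hz hzz
  · intro y hy w z hz
    obtain ⟨x, hx, i, t, ht, rfl⟩ := hmem y hy
    rw [preimTn_succ', Multiset.mem_bind]
    refine ⟨_, h.pre x hx w z hz, ?_⟩
    rw [← consW_catW]
    simp only [preimT, Multiset.mem_sum, Finset.mem_univ, true_and, Multiset.mem_map]
    refine ⟨i, (t z : Sphere), ?_, rfl⟩
    rw [fiber_coe, Multiset.mem_add]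
    refine Or.inl (Multiset.mem_map_of_mem _ ?_)
    rw [mem_roots (hne x hx i z hz)]
    simp [((hLs x hx i t ht).2 z hz).2]
  · intro y hy w z hz
    obtain ⟨x, hx, i, t, ht, rfl⟩ := hmem y hy
    obtain ⟨a1, a2⟩ := (hLs x hx i t ht).2 z hz
    have : ratEval (p i) (q i) (t z : Sphere) = (x.2 z : Sphere) := by
      simp only [ratEval, OnePoint.elim_some, if_neg a1]
      rw [a2, mul_div_cancel_right₀ _ a1]
    rw [← consW_catW, itComp_succ', shiftW_consW]
    have h0 : consW i (catW x.1 w) 0 = i := by simp [consW]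
    rw [h0]
    simp only
    rw [this]
    exact h.it x hx w z hz
  · rw [hF', Finset.card_biUnion, Finset.sum_product]
    · have : ∀ x ∈ F, ∑ i : Fin N, ((L x i).image fun t => ((Fin.cons i x.1 : Fin (n + 1) → Fin N), t)).card
          = Dtot p q := by
        intro x hx
        refine Finset.sum_congr rfl fun i _ => ?_
        rw [Finset.card_image_of_injective _ (fun t t' htt => (Prod.ext_iff.mp htt).2), hLc x hx i]
        rfl
      rw [Finset.sum_congr rfl this, Finset.sum_const, smul_eq_mul, mul_comm]
    · rintro ⟨x, i⟩ hx ⟨x', i'⟩ hx' hne'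
      rw [Function.onFun, Finset.disjoint_left]
      intro y hy hy'
      simp only [Finset.mem_image, Finset.mem_coe, Finset.mem_product] at hy hy' hx hx'
      obtain ⟨t, ht, rfl⟩ := hy
      obtain ⟨t', ht', he⟩ := hy'
      obtain ⟨h1, rfl⟩ := Prod.mk.inj he
      obtain ⟨rfl, h2⟩ := Fin.cons_injective2 h1
      exact hne' (by rw [hdet x hx.1 x' hx'.1 _ _ _ ht ht' h2.symm c hcA rfl])

/-- forward orbit of the bad set up to time k -/
def FkSet (S : Finset ℂ) (k : ℕ) : Set ℂ :=
  ⋃ j ∈ Finset.range (k + 1), ⋃ v : Fin j → Fin N, (fun b => (wordPair p q (List.ofFn v)).1.eval b /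
    (wordPair p q (List.ofFn v)).2.eval b) '' (S : Set ℂ)

lemma FkSet_finite (S : Finset ℂ) (k : ℕ) : (FkSet p q S k).Finite := by
  refine Set.Finite.biUnion (Finset.finite_toSet _) fun j _ => Set.finite_iUnion fun v => ?_
  exact S.finite_toSet.image _

variable {p q} in
lemma SecFam.filt {S : Finset ℂ} {A : Set ℂ} {n : ℕ}
    {F : Finset ((Fin n → Fin N) × (ℂ → ℂ))} (h : SecFam p q ∅ A n F) :
    ∃ F' : Finset ((Fin n → Fin N) × (ℂ → ℂ)), SecFam p q S A n F' ∧
      F.card ≤ F'.card + S.card * N ^ n ∧ ∀ k, n ≤ k → Disjoint A (FkSet p q S k) → F' = F := by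
  set F' := F.filter fun x => ∀ z ∈ A, x.2 z ∉ S with hF'
  have hsub : F' ⊆ F := Finset.filter_subset _ _
  refine ⟨F', ⟨fun x hx => h.diff x (hsub hx), fun x hx => (Finset.mem_filter.mp hx).2,
    fun x hx => h.eqn x (hsub hx), fun x hx y hy => h.dist x (hsub hx) y (hsub hy),
    fun x hx => h.pre x (hsub hx), fun x hx => h.it x (hsub hx)⟩, ?_, ?_⟩
  · rw [← Finset.card_filter_add_card_filter_not (s := F) (p := fun x => ∀ z ∈ A, x.2 z ∉ S)]
    refine Nat.add_le_add_left ?_ _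
    have hz : ∀ x ∈ F.filter (fun x => ¬ ∀ z ∈ A, x.2 z ∉ S), ∃ z, z ∈ A ∧ x.2 z ∈ S := by
      intro x hx
      have := (Finset.mem_filter.mp hx).2
      push Not at this
      exact this
    choose! ζ hζ using hz
    have : S.card * N ^ n = (S ×ˢ (Finset.univ : Finset (Fin n → Fin N))).card := by
      simp [Finset.card_product]
    rw [this]
    refine Finset.card_le_card_of_injOn (fun x => (x.2 (ζ x), x.1)) ?_ ?_
    · intro x hx
      simpa using (hζ x hx).2
    · intro x hx y hy he
      obtain ⟨h1, h2⟩ := Prod.ext_iff.mp he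
      exact (h.eq_of (Finset.mem_filter.mp hx).1 (Finset.mem_filter.mp hy).1 h2 (hζ x hx).1
        (hζ y hy).1 h1).2
  · intro k hnk hd
    rw [hF', Finset.filter_eq_self]
    intro x hx z hz hzS
    refine Set.disjoint_left.mp hd hz ?_
    simp only [FkSet, Set.mem_iUnion]
    refine ⟨n, by simp; omega, x.1, x.2 z, hzS, ?_⟩
    obtain ⟨a1, a2⟩ := h.eqn x hx z hz
    simp only
    rw [a2, mul_div_cancel_right₀ _ a1]

variable {p q} in
lemma exists_bad (hg : Good p q) :
    ∃ S : Finset ℂ, 0 ∈ S ∧ ∀ i, ∀ b, b ∉ S → GoodVal (p i) (q i) b := by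
  have hf : (⋃ i, {b | ¬ GoodVal (p i) (q i) b}).Finite :=
    Set.finite_iUnion fun i => finite_not_goodVal (hg.2.1 i) (hg.2.2.1 i)
  refine ⟨insert 0 hf.toFinset, by simp, fun i b hb => ?_⟩
  by_contra hc
  apply hb
  simp only [Finset.mem_insert, Set.Finite.mem_toFinset, Set.mem_iUnion]
  exact Or.inr ⟨i, hc⟩

variable {p q} in
lemma SecFam.exists_k (hg : Good p q) {S : Finset ℂ}
    (hS : ∀ i, ∀ b, b ∉ S → GoodVal (p i) (q i) b) (k : ℕ)
    {A : Set ℂ} {c : ℂ} (hAo : IsOpen A) (hA : StarConvex ℝ c A) (hcA : c ∈ A)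
    (hd : Disjoint A (FkSet p q S k)) (n : ℕ) :
    ∃ F, SecFam p q S A n F ∧ (n ≤ k → Dtot p q ^ n ≤ F.card) ∧
      (k ≤ n → Dtot p q ^ n + S.card * N ^ (n + 1) ≤
        F.card + Dtot p q ^ (n - k) * (S.card * N ^ (k + 1))) := by
  induction n with
  | zero =>
    refine ⟨_, SecFam.zero p q (S := S) (A := A) ?_, by simp, ?_⟩
    · intro z hz hzS
      refine Set.disjoint_left.mp hd hz ?_
      simp only [FkSet, Set.mem_iUnion]
      exact ⟨0, by simp, Fin.elim0, z, hzS, by simp [wordPair]⟩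
    · intro hk
      obtain rfl : k = 0 := by omega
      simp
  | succ n ih =>
    obtain ⟨F, hF, h1, h2⟩ := ih
    obtain ⟨F', hF', hc⟩ := hF.step hg hS hAo hA hcA
    obtain ⟨G, hG, h3, h4⟩ := hF'.filt (S := S)
    refine ⟨G, hG, ?_, ?_⟩
    · intro hn
      rw [h4 k hn hd, hc, pow_succ']
      exact Nat.mul_le_mul_left _ (h1 (by omega))
    · intro hk
      rcases Nat.lt_or_ge n k with hlt | hge
      · obtain rfl : k = n + 1 := by omega
        rw [h4 _ le_rfl hd, hc, pow_succ']
        simpa using Nat.mul_le_mul_left _ (h1 (by omega))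
      · have h5 := h2 hge
        have h6 : n + 1 - k = (n - k) + 1 := by omega
        have h7 := hg.lt
        rw [h6, pow_succ' (Dtot p q) n, pow_succ' (Dtot p q) (n - k)]
        have h8 : S.card * N ^ (n + 1 + 1) + S.card * N ^ (n + 1) ≤
            Dtot p q * (S.card * N ^ (n + 1)) := by
          calc _ = (N + 1) * (S.card * N ^ (n + 1)) := by ring
            _ ≤ _ := Nat.mul_le_mul_right _ h7
        have h9 := Nat.mul_le_mul_left (Dtot p q) h5
        rw [Nat.mul_add, Nat.mul_add] at h9
        rw [hc] at h3
        nlinarith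

variable {p q} in
lemma sections (hg : Good p q) {η : ℝ} (hη : 0 < η) :
    ∃ S : Finset ℂ, 0 ∈ S ∧ ∃ E : Set ℂ, E.Finite ∧ ∀ (A : Set ℂ) (c : ℂ), IsOpen A →
      StarConvex ℝ c A → c ∈ A → Disjoint A E → ∀ n : ℕ, ∃ F, SecFam p q S A n F ∧
        (1 - η) * (Dtot p q : ℝ) ^ n ≤ F.card := by
  obtain ⟨S, h0, hS⟩ := exists_bad hg
  have hlt := hg.lt
  have hD : (0 : ℝ) < Dtot p q := by exact_mod_cast (by omega : 0 < Dtot p q)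
  have hr : (N : ℝ) / Dtot p q < 1 := by
    rw [div_lt_one hD]; exact_mod_cast (by omega : N < Dtot p q)
  have hlim : Tendsto (fun k : ℕ => (S.card * N : ℝ) * ((N : ℝ) / Dtot p q) ^ k) atTop (𝓝 0) := by
    simpa using (tendsto_pow_atTop_nhds_zero_of_lt_one (by positivity) hr).const_mul (S.card * N : ℝ)
  obtain ⟨k, hk⟩ := (hlim.eventually (gt_mem_nhds hη)).exists
  refine ⟨S, h0, FkSet p q S k, FkSet_finite p q S k, fun A c hAo hA hcA hd n => ?_⟩
  obtain ⟨F, hF, h1, h2⟩ := SecFam.exists_k hg hS k hAo hA hcA hd n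
  refine ⟨F, hF, ?_⟩
  have hDn : (0 : ℝ) < (Dtot p q : ℝ) ^ n := by positivity
  rcases le_total n k with hn | hn
  · have := h1 hn
    have : (Dtot p q : ℝ) ^ n ≤ F.card := by exact_mod_cast this
    nlinarith
  · have h3 := h2 hn
    have h3 : (Dtot p q : ℝ) ^ n + S.card * N ^ (n + 1) ≤
        F.card + Dtot p q ^ (n - k) * (S.card * N ^ (k + 1)) := by exact_mod_cast h3
    have h4 : (Dtot p q : ℝ) ^ (n - k) * (S.card * N ^ (k + 1)) =
        Dtot p q ^ n * ((S.card * N : ℝ) * ((N : ℝ) / Dtot p q) ^ k) := by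
      rw [div_pow, ← Nat.sub_add_cancel hn, pow_add, Nat.add_sub_cancel]
      field_simp
      ring
    have h5 := mul_le_mul_of_nonneg_left hk.le hDn.le
    have h6 : (0 : ℝ) ≤ S.card * N ^ (n + 1) := by positivity
    linarith

/-! ### The chordal metric -/

/-- stereographic embedding -/
def stE : Sphere → WithLp 2 (ℂ × ℝ) := fun z =>
  OnePoint.elim z (WithLp.toLp 2 ((0 : ℂ), (1 : ℝ))) fun a =>
    WithLp.toLp 2 ((2 / (1 + ‖a‖ ^ 2) : ℝ) • a, (‖a‖ ^ 2 - 1) / (1 + ‖a‖ ^ 2))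

/-- the norm of the standard lift -/
def nm : Sphere → ℝ := fun z => OnePoint.elim z 1 fun a => Real.sqrt (1 + ‖a‖ ^ 2)

lemma nm_infty : nm OnePoint.infty = 1 := rfl
lemma nm_coe (a : ℂ) : nm (a : Sphere) = Real.sqrt (1 + ‖a‖ ^ 2) := rfl

lemma one_le_nm (z : Sphere) : 1 ≤ nm z := by
  induction z using OnePoint.rec with
  | infty => exact le_rfl
  | coe a => rw [nm_coe]; exact Real.one_le_sqrt.mpr (by nlinarith [norm_nonneg a])

lemma nm_pos (z : Sphere) : 0 < nm z := lt_of_lt_of_le one_pos (one_le_nm z)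

lemma sphDist_coe (a b : ℂ) :
    sphDist (a : Sphere) (b : Sphere) = 2 * dist a b / (nm (a : Sphere) * nm (b : Sphere)) := rfl
lemma sphDist_coe_infty (a : ℂ) : sphDist (a : Sphere) OnePoint.infty = 2 / nm (a : Sphere) := rfl
lemma sphDist_infty_coe (a : ℂ) : sphDist OnePoint.infty (a : Sphere) = 2 / nm (a : Sphere) := rfl
lemma sphDist_infty_infty : sphDist OnePoint.infty OnePoint.infty = 0 := rfl

lemma sphDist_nonneg (z w : Sphere) : 0 ≤ sphDist z w := by
  have := nm_pos z; have := nm_pos w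
  induction z using OnePoint.rec with
  | infty =>
    induction w using OnePoint.rec with
    | infty => exact le_rfl
    | coe b => rw [sphDist_infty_coe]; positivity
  | coe a =>
    induction w using OnePoint.rec with
    | infty => rw [sphDist_coe_infty]; positivity
    | coe b => rw [sphDist_coe]; positivity

lemma sphDist_eq (z w : Sphere) : sphDist z w = dist (stE z) (stE w) := by
  rw [WithLp.prod_dist_eq_of_L2, eq_comm,
    Real.sqrt_eq_iff_mul_self_eq (by positivity) (sphDist_nonneg z w)]
  have key : ∀ a b : ℂ, dist ((2 / (1 + ‖a‖ ^ 2) : ℝ) • a) ((2 / (1 + ‖b‖ ^ 2) : ℝ) • b) ^ 2 +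
      dist ((‖a‖ ^ 2 - 1) / (1 + ‖a‖ ^ 2)) ((‖b‖ ^ 2 - 1) / (1 + ‖b‖ ^ 2)) ^ 2 =
      4 * dist a b ^ 2 / ((1 + ‖a‖ ^ 2) * (1 + ‖b‖ ^ 2)) := by
    intro a b
    rw [Complex.dist_eq, Complex.dist_eq, Real.dist_eq, sq_abs, ← Complex.normSq_eq_norm_sq,
      ← Complex.normSq_eq_norm_sq, ← Complex.normSq_eq_norm_sq, ← Complex.normSq_eq_norm_sq]
    have h1 : (1 + Complex.normSq a) ≠ 0 := by have := Complex.normSq_nonneg a; positivity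
    have h2 : (1 + Complex.normSq b) ≠ 0 := by have := Complex.normSq_nonneg b; positivity
    simp only [Complex.normSq_apply, Complex.sub_re, Complex.sub_im, Complex.real_smul,
      Complex.re_ofReal_mul, Complex.im_ofReal_mul] at *
    field_simp
    ring
  have key2 : ∀ a : ℂ, dist ((2 / (1 + ‖a‖ ^ 2) : ℝ) • a) 0 ^ 2 +
      dist ((‖a‖ ^ 2 - 1) / (1 + ‖a‖ ^ 2)) 1 ^ 2 = 4 / (1 + ‖a‖ ^ 2) := by
    intro a
    have h1 : (1 + ‖a‖ ^ 2) ≠ 0 := by positivity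
    rw [dist_zero_right, norm_smul, mul_pow, Real.norm_eq_abs, sq_abs, Real.dist_eq, sq_abs]
    field_simp
    ring
  induction z using OnePoint.rec with
  | infty =>
    induction w using OnePoint.rec with
    | infty => simp [sphDist, stE]
    | coe b =>
      have := key2 b
      rw [dist_comm _ (0 : ℂ), dist_comm _ (1 : ℝ)] at this
      simp only [stE, OnePoint.elim_infty, OnePoint.elim_some]
      refine this.trans ?_
      rw [sphDist_infty_coe, nm_coe, div_mul_div_comm, Real.mul_self_sqrt (by positivity)]
      norm_num
  | coe a =>
    induction w using OnePoint.rec with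
    | infty =>
      simp only [stE, OnePoint.elim_infty, OnePoint.elim_some]
      refine (key2 a).trans ?_
      rw [sphDist_coe_infty, nm_coe, div_mul_div_comm, Real.mul_self_sqrt (by positivity)]
      norm_num
    | coe b =>
      simp only [stE, OnePoint.elim_some]
      refine (key a b).trans ?_
      rw [sphDist_coe, div_mul_div_comm, nm_coe, nm_coe, mul_mul_mul_comm,
        mul_mul_mul_comm (Real.sqrt _),
        Real.mul_self_sqrt (by positivity), Real.mul_self_sqrt (by positivity)]
      ring

lemma sphDist_comm (z w : Sphere) : sphDist z w = sphDist w z := by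
  rw [sphDist_eq, sphDist_eq, dist_comm]

lemma sphDist_self (z : Sphere) : sphDist z z = 0 := by rw [sphDist_eq, dist_self]

lemma sphDist_triangle (x y z : Sphere) : sphDist x z ≤ sphDist x y + sphDist y z := by
  simp only [sphDist_eq]; exact dist_triangle _ _ _

lemma sphDist_pos {z w : Sphere} (h : z ≠ w) : 0 < sphDist z w := by
  induction z using OnePoint.rec with
  | infty =>
    induction w using OnePoint.rec with
    | infty => exact absurd rfl h
    | coe b => rw [sphDist_infty_coe]; have := nm_pos (b : Sphere); positivity
  | coe a =>
    induction w using OnePoint.rec with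
    | infty => rw [sphDist_coe_infty]; have := nm_pos (a : Sphere); positivity
    | coe b =>
      rw [sphDist_coe]
      have h1 := nm_pos (a : Sphere); have h2 := nm_pos (b : Sphere)
      have : a ≠ b := fun hab => h (by rw [hab])
      have := dist_pos.mpr this
      positivity

lemma sphDist_coe_le (a b : ℂ) : sphDist (a : Sphere) (b : Sphere) ≤ 2 * dist a b := by
  rw [sphDist_coe]
  refine div_le_self (by positivity) ?_
  exact one_le_mul_of_one_le_of_one_le (one_le_nm _) (one_le_nm _)

lemma continuous_stE : Continuous stE := by
  rw [continuous_iff_continuousAt]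
  intro z
  rw [ContinuousAt, tendsto_iff_dist_tendsto_zero]
  simp only [← sphDist_eq]
  induction z using OnePoint.rec with
  | infty =>
    rw [OnePoint.tendsto_nhds_infty']
    refine ⟨?_, ?_⟩
    · rw [tendsto_pure_left]
      intro s hs
      rw [sphDist_self]; exact mem_of_mem_nhds hs
    · rw [coclosedCompact_eq_cocompact]
      have h1 : Tendsto (fun a : ℂ => 2 / ‖a‖) (cocompact ℂ) (𝓝 0) :=
        tendsto_const_nhds.div_atTop (tendsto_norm_cocompact_atTop)
      refine squeeze_zero' (Eventually.of_forall fun a => sphDist_nonneg _ _) ?_ h1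
      have h2 : ∀ᶠ a : ℂ in cocompact ℂ, 0 < ‖a‖ :=
        tendsto_norm_cocompact_atTop.eventually (eventually_gt_atTop 0)
      filter_upwards [h2] with a ha
      simp only [Function.comp_apply, sphDist_coe_infty, nm_coe]
      refine div_le_div_of_nonneg_left (by norm_num) ha ?_
      exact Real.le_sqrt_of_sq_le (by linarith)
  | coe a =>
    rw [OnePoint.nhds_coe_eq, tendsto_map'_iff]
    refine squeeze_zero (fun b => sphDist_nonneg _ _) (fun b => sphDist_coe_le b a) ?_
    have := (tendsto_iff_dist_tendsto_zero (x := 𝓝 a) (f := fun b : ℂ => b) (a := a)).mp tendsto_id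
    simpa using this.const_mul 2

lemma continuous_sphDist : Continuous fun x : Sphere × Sphere => sphDist x.1 x.2 := by
  simp only [sphDist_eq]
  exact (continuous_stE.comp continuous_fst).dist (continuous_stE.comp continuous_snd)

lemma continuous_sphDist_left (w : Sphere) : Continuous fun x : Sphere => sphDist x w := by
  simp only [sphDist_eq]
  exact continuous_stE.dist continuous_const

lemma sphDist_le_two (z w : Sphere) : sphDist z w ≤ 2 := by
  induction z using OnePoint.rec with
  | infty =>
    induction w using OnePoint.rec with
    | infty => simp [sphDist_infty_infty]
    | coe b => rw [sphDist_infty_coe]; exact div_le_self (by norm_num) (one_le_nm _)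
  | coe a =>
    induction w using OnePoint.rec with
    | infty => rw [sphDist_coe_infty]; exact div_le_self (by norm_num) (one_le_nm _)
    | coe b =>
      rw [sphDist_coe, div_le_iff₀ (mul_pos (nm_pos _) (nm_pos _))]
      have : dist a b ≤ nm (a : Sphere) * nm (b : Sphere) := by
        rw [nm_coe, nm_coe, ← Real.sqrt_mul (by positivity)]
        refine Real.le_sqrt_of_sq_le ?_
        have h1 : dist a b ≤ ‖a‖ + ‖b‖ := by rw [dist_eq_norm]; exact norm_sub_le _ _
        have h2 := norm_nonneg a
        have h3 := norm_nonneg b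
        calc dist a b ^ 2 ≤ (‖a‖ + ‖b‖) ^ 2 := by gcongr
          _ ≤ _ := by nlinarith [sq_nonneg (‖a‖ * ‖b‖ - 1)]
      linarith

lemma isEmbedding_stE : IsEmbedding stE := by
  refine (continuous_stE.isClosedEmbedding ?_).isEmbedding
  intro z w h
  by_contra hne
  have := sphDist_pos hne
  rw [sphDist_eq, h, dist_self] at this
  exact lt_irrefl _ this

lemma tendsto_iff_sphDist {ι : Type*} {l : Filter ι} {f : ι → Sphere} {z : Sphere} :
    Tendsto f l (𝓝 z) ↔ Tendsto (fun n => sphDist (f n) z) l (𝓝 0) := by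
  rw [isEmbedding_stE.tendsto_nhds_iff, tendsto_iff_dist_tendsto_zero]
  simp only [sphDist_eq, Function.comp_apply]

lemma unif_cont (g : C(SymX N, ℝ)) {ε : ℝ} (hε : 0 < ε) :
    ∃ n : ℕ, ∀ w w' : ℕ → Fin N, ∀ z z' : Sphere, (∀ k < n, w k = w' k) →
      sphDist z z' ≤ 1 / (n + 1 : ℝ) → |g (w, z) - g (w', z')| < ε := by
  by_contra! hcon
  let K : ℕ → Set (SymX N × SymX N) := fun n =>
    {x | (∀ k < n, x.1.1 k = x.2.1 k) ∧ sphDist x.1.2 x.2.2 ≤ 1 / (n + 1 : ℝ) ∧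
      ε ≤ |g x.1 - g x.2|}
  have hcl : ∀ n, IsClosed (K n) := by
    intro n
    have h1 : IsClosed {x : SymX N × SymX N | ∀ k < n, x.1.1 k = x.2.1 k} := by
      have : {x : SymX N × SymX N | ∀ k < n, x.1.1 k = x.2.1 k} =
          ⋂ k, ⋂ (_ : k < n), {x | x.1.1 k = x.2.1 k} := by ext; simp
      rw [this]
      exact isClosed_iInter fun k => isClosed_iInter fun _ =>
        isClosed_eq (by fun_prop) (by fun_prop)
    have h2 : IsClosed {x : SymX N × SymX N | sphDist x.1.2 x.2.2 ≤ 1 / (n + 1 : ℝ)} := by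
      refine isClosed_le ?_ continuous_const
      exact continuous_sphDist.comp
        ((continuous_snd.comp continuous_fst).prodMk (continuous_snd.comp continuous_snd))
    have h3 : IsClosed {x : SymX N × SymX N | ε ≤ |g x.1 - g x.2|} :=
      isClosed_le continuous_const (by fun_prop)
    exact h1.inter (h2.inter h3)
  obtain ⟨x, hx⟩ := IsCompact.nonempty_iInter_of_sequence_nonempty_isCompact_isClosed K
    (fun n x hx => ⟨fun k hk => hx.1 k (by omega), hx.2.1.trans (by
      refine one_div_le_one_div_of_le (by positivity) ?_; push_cast; linarith), hx.2.2⟩)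
    (fun n => by
      obtain ⟨w, w', z, z', h1, h2, h3⟩ := hcon n
      exact ⟨((w, z), (w', z')), h1, h2, h3⟩)
    (hcl 0).isCompact hcl
  simp only [Set.mem_iInter] at hx
  have h1 : x.1.1 = x.2.1 := by ext k; rw [(hx (k + 1)).1 k (by omega)]
  have h2 : x.1.2 = x.2.2 := by
    by_contra hne
    have := sphDist_pos hne
    obtain ⟨n, hn⟩ := exists_nat_one_div_lt this
    exact absurd (hx n).2.1 (not_le.mpr hn)
  have h3 : x.1 = x.2 := Prod.ext h1 h2
  have := (hx 0).2.2
  rw [h3, sub_self, abs_zero] at this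
  linarith

/-! ### The product formula -/

/-- polynomial whose zeros are the fibre over x -/
def fx (P Q : ℂ[X]) (x : Sphere) : ℂ[X] := OnePoint.elim x Q fun b => P - C b * Q

/-- homogeneous evaluation -/
def evd (f : ℂ[X]) (d : ℕ) (z : Sphere) : ℂ := OnePoint.elim z (f.coeff d) fun a => f.eval a

/-- roots including infinity -/
def fib (f : ℂ[X]) (d : ℕ) : Multiset Sphere :=
  Multiset.map (fun z : ℂ => (z : Sphere)) f.roots +
    Multiset.replicate (d - f.natDegree) (OnePoint.infty : Sphere)

lemma fiber_eq_fib (P Q : ℂ[X]) (x : Sphere) :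
    fiber P Q x = fib (fx P Q x) (max P.natDegree Q.natDegree) := by
  induction x using OnePoint.rec with
  | infty => exact fiber_infty P Q
  | coe b => exact fiber_coe P Q b

lemma natDegree_fx (P Q : ℂ[X]) (x : Sphere) :
    (fx P Q x).natDegree ≤ max P.natDegree Q.natDegree := by
  induction x using OnePoint.rec with
  | infty => exact le_max_right _ _
  | coe b => exact natDegree_sub_le_max P Q b

lemma fx_ne {P Q : ℂ[X]} (hcop : IsCoprime P Q) (hd : 1 ≤ max P.natDegree Q.natDegree)
    (x : Sphere) : fx P Q x ≠ 0 := by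
  induction x using OnePoint.rec with
  | infty =>
    intro h0
    change Q = 0 at h0
    rw [h0, isCoprime_zero_right] at hcop
    rw [h0, natDegree_zero, natDegree_eq_zero_of_isUnit hcop] at hd
    simp at hd
  | coe b =>
    intro h0
    change P - C b * Q = 0 at h0
    have h1 : P = C b * Q := sub_eq_zero.mp h0
    have h2 : IsUnit Q := by
      rw [h1] at hcop
      exact isCoprime_self.mp (IsCoprime.of_mul_left_right hcop)
    have h3 := natDegree_eq_zero_of_isUnit h2
    have h4 : P.natDegree ≤ 0 := by
      rw [h1]; exact (natDegree_C_mul_le _ _).trans h3.le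
    omega

lemma prod_fib (f : ℂ[X]) (hf : f ≠ 0) (d : ℕ) (hd : f.natDegree ≤ d) (a : Sphere) :
    ((fib f d).map fun y => sphDist y a / 2 * nm y * nm a).prod = ‖evd f d a‖ / ‖f.leadingCoeff‖ := by
  have hlc : ‖f.leadingCoeff‖ ≠ 0 := norm_ne_zero_iff.mpr (leadingCoeff_ne_zero.mpr hf)
  have h1 : ∀ z : ℂ, 2 / nm (z : Sphere) / 2 * nm (z : Sphere) = 1 := by
    intro z
    have := nm_pos (z : Sphere)
    field_simp
  rw [fib, Multiset.map_add, Multiset.prod_add, Multiset.map_map, Multiset.map_replicate,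
    Multiset.prod_replicate]
  induction a using OnePoint.rec with
  | infty =>
    simp only [Function.comp_def, sphDist_coe_infty, nm_infty, mul_one, sphDist_infty_infty,
      zero_div, h1, Multiset.map_const', Multiset.prod_replicate, one_pow, one_mul, evd,
      OnePoint.elim_infty]
    rcases hd.lt_or_eq with h | h
    · rw [coeff_eq_zero_of_natDegree_lt h, zero_pow (by omega)]; simp
    · rw [← h, Nat.sub_self, pow_zero]
      exact (div_self hlc).symm
  | coe a =>
    have h2 : ∀ z : ℂ, sphDist (z : Sphere) (a : Sphere) / 2 * nm (z : Sphere) * nm (a : Sphere)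
        = ‖a - z‖ := by
      intro z
      rw [sphDist_coe, dist_eq_norm, norm_sub_rev]
      have := nm_pos (z : Sphere)
      have := nm_pos (a : Sphere)
      field_simp
    simp only [Function.comp_def, h2, nm_infty, sphDist_infty_coe, mul_one, h1, one_pow, evd,
      OnePoint.elim_some]
    rw [(IsAlgClosed.splits f).eval_eq_prod_roots, norm_mul, mul_div_cancel_left₀ _ hlc]
    have := map_multiset_prod (normHom : ℂ →*₀ ℝ) (f.roots.map fun x => a - x)
    rw [Multiset.map_map] at this
    exact this.symm

lemma prod_nm (f : ℂ[X]) (hf : f ≠ 0) (d : ℕ) (hd : f.natDegree ≤ d) :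
    ((fib f d).map nm).prod ≤ 2 ^ d * (f.sum fun _ a => ‖a‖) / ‖f.leadingCoeff‖ := by
  have hlc : 0 < ‖f.leadingCoeff‖ := norm_pos_iff.mpr (leadingCoeff_ne_zero.mpr hf)
  rw [fib, Multiset.map_add, Multiset.prod_add, Multiset.map_map, Multiset.map_replicate,
    Multiset.prod_replicate, nm_infty, one_pow, mul_one, le_div_iff₀ hlc]
  have h1 : (f.roots.map (nm ∘ fun z : ℂ => (z : Sphere))).prod ≤
      (f.roots.map fun z => 2 * max 1 ‖z‖).prod := by
    refine Multiset.prod_map_le_prod_map₀ _ _ (fun z _ => (nm_pos _).le) fun z _ => ?_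
    simp only [Function.comp_apply, nm_coe]
    refine Real.sqrt_le_iff.mpr ⟨by positivity, ?_⟩
    have h1 := le_max_left 1 ‖z‖
    have h2 := le_max_right 1 ‖z‖
    have h3 := norm_nonneg z
    nlinarith
  rw [Multiset.prod_map_mul, Multiset.map_const', Multiset.prod_replicate,
    IsAlgClosed.card_roots_eq_natDegree] at h1
  have h2 := mahlerMeasure_le_sum_norm_coeff f
  rw [mahlerMeasure_eq_leadingCoeff_mul_prod_roots] at h2
  have h0 : (0 : ℝ) ≤ (f.roots.map fun a => max 1 ‖a‖).prod :=
    Multiset.prod_nonneg fun a ha => by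
      obtain ⟨z, -, rfl⟩ := Multiset.mem_map.mp ha
      positivity
  calc _ ≤ 2 ^ f.natDegree * (f.roots.map fun a => max 1 ‖a‖).prod * ‖f.leadingCoeff‖ := by gcongr
    _ = 2 ^ f.natDegree * (‖f.leadingCoeff‖ * (f.roots.map fun a => max 1 ‖a‖).prod) := by ring
    _ ≤ 2 ^ d * (f.sum fun _ a => ‖a‖) := by
      gcongr
      norm_num

lemma evd_ratEval {P Q : ℂ[X]} (hcop : IsCoprime P Q) (hd : 1 ≤ max P.natDegree Q.natDegree)
    (a : Sphere) : ∃ l : ℂ, l ≠ 0 ∧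
      ((ratEval P Q a = OnePoint.infty ∧ evd P (max P.natDegree Q.natDegree) a = l ∧
        evd Q (max P.natDegree Q.natDegree) a = 0) ∨
      (∃ r : ℂ, ratEval P Q a = (r : Sphere) ∧ evd P (max P.natDegree Q.natDegree) a = l * r ∧
        evd Q (max P.natDegree Q.natDegree) a = l)) := by
  induction a using OnePoint.rec with
  | infty =>
    simp only [evd, ratEval, OnePoint.elim_infty]
    rcases lt_trichotomy Q.natDegree P.natDegree with h | h | h
    · refine ⟨P.leadingCoeff, ?_, Or.inl ⟨if_pos h, ?_, ?_⟩⟩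
      · exact leadingCoeff_ne_zero.mpr (by rintro rfl; simp at h)
      · rw [max_eq_left h.le]; rfl
      · exact coeff_eq_zero_of_natDegree_lt (by rw [max_eq_left h.le]; exact h)
    · have hQ : Q.leadingCoeff ≠ 0 := leadingCoeff_ne_zero.mpr (by
        rintro rfl; simp [← h] at hd)
      refine ⟨Q.leadingCoeff, hQ, Or.inr ⟨P.leadingCoeff / Q.leadingCoeff, ?_, ?_, ?_⟩⟩
      · rw [if_neg (by omega), if_neg (by omega)]
      · rw [mul_div_cancel₀ _ hQ, h, max_self]; rfl
      · rw [h, max_self, ← h]; rfl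
    · refine ⟨Q.leadingCoeff, leadingCoeff_ne_zero.mpr (by rintro rfl; simp at h),
        Or.inr ⟨0, ?_, ?_, ?_⟩⟩
      · rw [if_neg (by omega), if_pos h]
      · rw [mul_zero]; exact coeff_eq_zero_of_natDegree_lt (by rw [max_eq_right h.le]; exact h)
      · rw [max_eq_right h.le]; rfl
  | coe a =>
    simp only [evd, ratEval, OnePoint.elim_some]
    by_cases hQ : Q.eval a = 0
    · exact ⟨P.eval a, coprime_ne hcop hQ, Or.inl ⟨if_pos hQ, rfl, hQ⟩⟩
    · exact ⟨Q.eval a, hQ, Or.inr ⟨P.eval a / Q.eval a, if_neg hQ, by field_simp, rfl⟩⟩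

lemma evd_fx {P Q : ℂ[X]} (hcop : IsCoprime P Q) (hd : 1 ≤ max P.natDegree Q.natDegree)
    (a : Sphere) : ∃ k : ℝ, 0 < k ∧ ∀ x, ‖evd (fx P Q x) (max P.natDegree Q.natDegree) a‖ =
      k * (sphDist (ratEval P Q a) x / 2 * nm (ratEval P Q a) * nm x) := by
  obtain ⟨l, hl, h⟩ := evd_ratEval hcop hd a
  have hlin : ∀ b : ℂ, evd (fx P Q (b : Sphere)) (max P.natDegree Q.natDegree) a =
      evd P (max P.natDegree Q.natDegree) a - b * evd Q (max P.natDegree Q.natDegree) a := by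
    intro b
    simp only [fx, OnePoint.elim_some]
    induction a using OnePoint.rec with
    | infty => simp [evd]
    | coe a => simp [evd]
  have hlin' : evd (fx P Q OnePoint.infty) (max P.natDegree Q.natDegree) a =
      evd Q (max P.natDegree Q.natDegree) a := rfl
  refine ⟨‖l‖, norm_pos_iff.mpr hl, fun x => ?_⟩
  have h1 : ∀ z : ℂ, 2 / nm (z : Sphere) / 2 * nm (z : Sphere) = 1 := by
    intro z
    have := nm_pos (z : Sphere)
    field_simp
  rcases h with ⟨hR, hP, hQ⟩ | ⟨r, hR, hP, hQ⟩ <;> rw [hR]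
  · induction x using OnePoint.rec with
    | infty => rw [hlin', hQ, sphDist_self]; simp
    | coe b => rw [hlin, hP, hQ, sphDist_infty_coe, nm_infty, mul_one, h1]; simp
  · induction x using OnePoint.rec with
    | infty => rw [hlin', hQ, sphDist_coe_infty, nm_infty, h1]; simp
    | coe b =>
      rw [hlin, hP, hQ, sphDist_coe, dist_eq_norm, mul_comm b l, ← mul_sub, norm_mul]
      have := nm_pos (r : Sphere)
      have := nm_pos (b : Sphere)
      field_simp

lemma sum_coeff_fx (P Q : ℂ[X]) : ∃ K : ℝ, 0 < K ∧ ∀ x,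
    ((fx P Q x).sum fun _ a => ‖a‖) ≤ K * nm x := by
  set d := max P.natDegree Q.natDegree
  have h0 : (0 : ℝ) ≤ ∑ i ∈ Finset.range (d + 1), (‖P.coeff i‖ + ‖Q.coeff i‖) :=
    Finset.sum_nonneg fun i _ => by positivity
  refine ⟨1 + ∑ i ∈ Finset.range (d + 1), (‖P.coeff i‖ + ‖Q.coeff i‖), by linarith, fun x => ?_⟩
  rw [sum_over_range' _ (by simp) (d + 1) (Nat.lt_succ_of_le (natDegree_fx P Q x)), add_mul,
    Finset.sum_mul]
  have : ∀ i, ‖(fx P Q x).coeff i‖ ≤ (‖P.coeff i‖ + ‖Q.coeff i‖) * nm x := by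
    intro i
    induction x using OnePoint.rec with
    | infty => simp [fx, nm_infty]
    | coe b =>
      simp only [fx, OnePoint.elim_some, coeff_sub, coeff_C_mul]
      have h1 := one_le_nm (b : Sphere)
      have h2 : ‖b‖ ≤ nm (b : Sphere) := by
        rw [nm_coe]; exact Real.le_sqrt_of_sq_le (by linarith)
      have h3 := norm_nonneg (P.coeff i)
      have h4 := norm_nonneg (Q.coeff i)
      have h5 := norm_sub_le (P.coeff i) (b * Q.coeff i)
      rw [norm_mul] at h5
      nlinarith
  have h2 := Finset.sum_le_sum fun i (_ : i ∈ Finset.range (d + 1)) => this i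
  have := nm_pos x
  linarith

lemma VP {P Q : ℂ[X]} (hcop : IsCoprime P Q) (hd : 1 ≤ max P.natDegree Q.natDegree)
    (a : Sphere) : ∃ c : ℝ, 0 < c ∧ c ≤ 1 ∧ ∀ x,
      c * (sphDist (ratEval P Q a) x / 2) ≤ ((fiber P Q x).map fun y => sphDist y a / 2).prod := by
  obtain ⟨k, hk, h1⟩ := evd_fx hcop hd a
  obtain ⟨K, hK, h2⟩ := sum_coeff_fx P Q
  set d := max P.natDegree Q.natDegree
  have hna := nm_pos a
  have hnR := nm_pos (ratEval P Q a)
  set c0 := k * nm (ratEval P Q a) / (2 ^ d * K * nm a ^ d) with hc0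
  have hc0p : 0 < c0 := by positivity
  refine ⟨min c0 1, lt_min hc0p one_pos, min_le_right _ _, fun x => ?_⟩
  refine (mul_le_mul_of_nonneg_right (min_le_left c0 1)
    (by have := sphDist_nonneg (ratEval P Q a) x; positivity)).trans ?_
  have hf := fx_ne hcop hd x
  have hdeg := natDegree_fx P Q x
  have h3 := prod_fib (fx P Q x) hf d hdeg a
  rw [Multiset.prod_map_mul, Multiset.prod_map_mul, Multiset.map_const', Multiset.prod_replicate,
    ← fiber_eq_fib, card_fiber, h1] at h3
  have h4 := prod_nm (fx P Q x) hf d hdeg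
  rw [← fiber_eq_fib] at h4
  have hlc : 0 < ‖(fx P Q x).leadingCoeff‖ := norm_pos_iff.mpr (leadingCoeff_ne_zero.mpr hf)
  set pr1 := ((fiber P Q x).map fun y => sphDist y a / 2).prod
  set pr2 := ((fiber P Q x).map nm).prod
  have hpr1 : 0 ≤ pr1 := Multiset.prod_nonneg fun b hb => by
    obtain ⟨z, -, rfl⟩ := Multiset.mem_map.mp hb
    have := sphDist_nonneg z a
    positivity
  have hnx := nm_pos x
  have h5 : pr2 * ‖(fx P Q x).leadingCoeff‖ ≤ 2 ^ d * (K * nm x) := by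
    rw [le_div_iff₀ hlc] at h4
    exact h4.trans (by gcongr; exact h2 x)
  have h6 : k * (sphDist (ratEval P Q a) x / 2 * nm (ratEval P Q a) * nm x) ≤
      pr1 * (2 ^ d * (K * nm x)) * nm a ^ d := by
    rw [eq_div_iff hlc.ne'] at h3
    rw [← h3]
    calc _ = pr1 * (pr2 * ‖(fx P Q x).leadingCoeff‖) * nm a ^ d := by ring
      _ ≤ _ := by gcongr
  rw [hc0, div_mul_eq_mul_div, div_le_iff₀ (by positivity)]
  refine le_of_mul_le_mul_right (a := nm x) ?_ hnx
  linarith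

lemma mem_fiber {P Q : ℂ[X]} (hcop : IsCoprime P Q) (hd : 1 ≤ max P.natDegree Q.natDegree)
    (a : Sphere) : a ∈ fiber P Q (ratEval P Q a) := by
  obtain ⟨k, hk, h1⟩ := evd_fx hcop hd a
  have h2 := h1 (ratEval P Q a)
  rw [sphDist_self] at h2
  simp only [zero_div, zero_mul, mul_zero, norm_eq_zero] at h2
  have hf := fx_ne hcop hd (ratEval P Q a)
  rw [fiber_eq_fib, fib, Multiset.mem_add]
  have hdeg := natDegree_fx P Q (ratEval P Q a)
  generalize fx P Q (ratEval P Q a) = f at *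
  induction a using OnePoint.rec with
  | infty =>
    right
    rw [Multiset.mem_replicate]
    refine ⟨?_, rfl⟩
    intro h0
    have h3 : f.coeff (max P.natDegree Q.natDegree) = 0 := h2
    rcases (Nat.sub_eq_zero_iff_le.mp h0).lt_or_eq with h | h
    · exact absurd hdeg (not_le.mpr h)
    · rw [h] at h3; exact hf (leadingCoeff_eq_zero.mp h3)
  | coe a =>
    left
    exact Multiset.mem_map_of_mem _ ((mem_roots hf).mpr h2)

/-! ### Consequences: continuity and potentials -/

lemma prod_le_of_mem (s : Multiset Sphere) (f : Sphere → ℝ) (h0 : ∀ y, 0 ≤ f y)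
    (h1 : ∀ y, f y ≤ 1) {y : Sphere} (hy : y ∈ s) : (s.map f).prod ≤ f y := by
  obtain ⟨t, rfl⟩ := Multiset.exists_cons_of_mem hy
  rw [Multiset.map_cons, Multiset.prod_cons]
  refine mul_le_of_le_one_right (h0 y) ?_
  have := Multiset.prod_map_le_prod_map₀ (s := t) f (fun _ => 1) (fun z _ => h0 z) (fun z _ => h1 z)
  simpa using this

lemma fiber_dist {P Q : ℂ[X]} (hcop : IsCoprime P Q) (hd : 1 ≤ max P.natDegree Q.natDegree)
    (a : Sphere) : ∃ c : ℝ, 0 < c ∧ ∀ x, ∀ y ∈ fiber P Q x,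
      c * sphDist (ratEval P Q a) x ≤ sphDist y a := by
  obtain ⟨c, hc, -, h⟩ := VP hcop hd a
  refine ⟨c, hc, fun x y hy => ?_⟩
  have h1 := prod_le_of_mem (fiber P Q x) (fun y => sphDist y a / 2)
    (fun y => by have := sphDist_nonneg y a; positivity)
    (fun y => by have := sphDist_le_two y a; linarith) hy
  have h2 := (h x).trans h1
  linarith

lemma continuous_ratEval {P Q : ℂ[X]} (hcop : IsCoprime P Q)
    (hd : 1 ≤ max P.natDegree Q.natDegree) : Continuous (ratEval P Q) := by
  rw [continuous_iff_continuousAt]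
  intro a
  obtain ⟨c, hc, h⟩ := fiber_dist hcop hd a
  rw [ContinuousAt, tendsto_iff_sphDist]
  have h1 : Tendsto (fun y : Sphere => sphDist y a / c) (𝓝 a) (𝓝 0) := by
    have := ((continuous_sphDist_left a).tendsto a).div_const c
    simpa [sphDist_self] using this
  refine squeeze_zero (fun y => sphDist_nonneg _ _) (fun y => ?_) h1
  rw [le_div_iff₀ hc, mul_comm, sphDist_comm (ratEval P Q y)]
  exact h _ _ (mem_fiber hcop hd y)

variable {p q} in
lemma continuous_itComp (hg : Good p q) (w : ℕ → Fin N) (n : ℕ) : Continuous (itComp p q w n) := by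
  induction n with
  | zero => exact continuous_id
  | succ n ih => exact (continuous_ratEval (hg.2.1 _) (hg.2.2.1 _)).comp ih

/-- truncated potential -/
def Vt (T : ℝ) (a z : Sphere) : ℝ := -Real.log (max (sphDist z a / 2) (Real.exp (-T)))

lemma continuous_Vt (T : ℝ) (a : Sphere) : Continuous (Vt T a) := by
  refine (Continuous.log ?_ fun z => ?_).neg
  · exact ((continuous_sphDist_left a).div_const 2).max continuous_const
  · exact (lt_of_lt_of_le (Real.exp_pos _) (le_max_right _ _)).ne'

lemma Vt_self (T : ℝ) (a : Sphere) : Vt T a a = T := by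
  simp [Vt, sphDist_self, max_eq_right (Real.exp_pos _).le]

lemma Vt_nonneg {T : ℝ} (hT : 0 ≤ T) (a z : Sphere) : 0 ≤ Vt T a z := by
  have : max (sphDist z a / 2) (Real.exp (-T)) ≤ 1 :=
    max_le (by linarith [sphDist_le_two z a]) (Real.exp_le_one_iff.mpr (by linarith))
  have h0 : 0 ≤ max (sphDist z a / 2) (Real.exp (-T)) := (Real.exp_pos _).le.trans (le_max_right _ _)
  have := Real.log_nonpos h0 this
  simp only [Vt]
  linarith

lemma sum_Vt (T : ℝ) (a : Sphere) (s : Multiset Sphere) :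
    (s.map (Vt T a)).sum =
      -Real.log (s.map fun z => max (sphDist z a / 2) (Real.exp (-T))).prod := by
  have hp : ∀ z, 0 < max (sphDist z a / 2) (Real.exp (-T)) := fun z =>
    lt_of_lt_of_le (Real.exp_pos _) (le_max_right _ _)
  induction s using Multiset.induction with
  | empty => simp
  | cons z s ih =>
    rw [Multiset.map_cons, Multiset.map_cons, Multiset.sum_cons, Multiset.prod_cons,
      Real.log_mul (hp z).ne', ih, Vt]
    · ring
    · refine (Multiset.prod_pos fun b hb => ?_).ne'
      obtain ⟨y, -, rfl⟩ := Multiset.mem_map.mp hb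
      exact hp y

lemma Vt_fiber {P Q : ℂ[X]} (hcop : IsCoprime P Q) (hd : 1 ≤ max P.natDegree Q.natDegree)
    (a : Sphere) : ∃ K : ℝ, 0 ≤ K ∧ ∀ T x, ((fiber P Q x).map (Vt T a)).sum ≤
      Vt (max P.natDegree Q.natDegree * T) (ratEval P Q a) x + K := by
  obtain ⟨c, hc, hc1, h⟩ := VP hcop hd a
  refine ⟨-Real.log c, by have := Real.log_nonpos hc.le hc1; linarith, fun T x => ?_⟩
  rw [sum_Vt, Vt, ← neg_add, neg_le_neg_iff, add_comm, ← Real.log_mul hc.ne'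
    (lt_of_lt_of_le (Real.exp_pos _) (le_max_right _ _)).ne']
  refine Real.log_le_log (mul_pos hc (lt_of_lt_of_le (Real.exp_pos _) (le_max_right _ _))) ?_
  have hs : ∀ z, 0 ≤ sphDist z a / 2 := fun z => by have := sphDist_nonneg z a; positivity
  rw [mul_max_of_nonneg _ _ hc.le]
  refine max_le ?_ ?_
  · rw [sphDist_comm]
    refine (h x).trans ?_
    exact Multiset.prod_map_le_prod_map₀ _ _ (fun z _ => hs z) fun z _ => le_max_left _ _
  · have h2 := Multiset.prod_map_le_prod_map₀ (s := fiber P Q x) (fun _ => Real.exp (-T))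
      (fun z => max (sphDist z a / 2) (Real.exp (-T))) (fun z _ => (Real.exp_pos _).le)
      (fun z _ => le_max_right _ _)
    rw [Multiset.map_const', Multiset.prod_replicate, card_fiber, ← Real.exp_nat_mul] at h2
    refine le_trans ?_ h2
    rw [mul_neg]
    exact mul_le_of_le_one_left (Real.exp_pos _).le hc1

lemma sum_map_finset_sum {ι α : Type*} (s : Finset ι) (t : ι → Multiset α) (f : α → ℝ) :
    ((∑ i ∈ s, t i).map f).sum = ∑ i ∈ s, ((t i).map f).sum := by
  induction s using Finset.induction with
  | empty => simp
  | insert i s hi ih => rw [Finset.sum_insert hi, Finset.sum_insert hi, Multiset.map_add,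
      Multiset.sum_add, ih]

lemma sum_map_comm {ι α : Type*} (s : Finset ι) (t : Multiset α) (f : ι → α → ℝ) :
    (t.map fun y => ∑ i ∈ s, f i y).sum = ∑ i ∈ s, (t.map (f i)).sum := by
  induction t using Multiset.induction with
  | empty => simp
  | cons a t ih => simp [ih, Finset.sum_add_distrib]

lemma sum_preimT (f : SymX N → ℝ) (x : SymX N) : ((preimT p q x).map f).sum =
    ∑ i, ((fiber (p i) (q i) x.2).map fun z => f (consW i x.1, z)).sum := by
  rw [preimT, sum_map_finset_sum]
  simp only [Multiset.map_map, Function.comp_def]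

lemma sum_preimTn_add (m n : ℕ) (f : SymX N → ℝ) (x : SymX N) :
    ((preimTn p q (m + n) x).map f).sum =
      ((preimTn p q m x).map fun y => ((preimTn p q n y).map f).sum).sum := by
  rw [preimTn_add, Multiset.map_bind, Multiset.sum_bind]

lemma sum_preimTn_succ (n : ℕ) (f : SymX N → ℝ) (x : SymX N) :
    ((preimTn p q (n + 1) x).map f).sum =
      ((preimTn p q n x).map fun y => ((preimT p q y).map f).sum).sum := by
  rw [preimTn_succ', Multiset.map_bind, Multiset.sum_bind]

variable {p q} in
lemma potential (hg : Good p q) (E : Finset Sphere)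
    (hE : ∀ i, ∀ a ∈ E, ratEval (p i) (q i) a ∈ E) {z1 : Sphere} (hz1 : z1 ∉ E) :
    ∃ K : ℝ, 0 ≤ K ∧ ∀ a ∈ E, ∀ T w n,
      ((preimTn p q n (w, z1)).map fun y => Vt T a y.2).sum ≤ K * (Dtot p q : ℝ) ^ n := by
  have hK : ∀ i a, _ := fun i a => Vt_fiber (hg.2.1 i) (hg.2.2.1 i) a
  choose K hK0 hK using hK
  obtain ⟨B, hB0, hB⟩ : ∃ B : ℝ, 0 ≤ B ∧ ∀ a ∈ E, ∀ T, Vt T a z1 ≤ B := by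
    refine ⟨∑ a ∈ E, |Real.log (sphDist z1 a / 2)|, Finset.sum_nonneg fun _ _ => abs_nonneg _, ?_⟩
    intro a ha T
    refine le_trans ?_ (Finset.single_le_sum (f := fun a => |Real.log (sphDist z1 a / 2)|)
      (fun _ _ => abs_nonneg _) ha)
    refine le_trans (neg_le_neg ?_) (neg_le_abs _)
    have : 0 < sphDist z1 a := sphDist_pos (by rintro rfl; exact hz1 ha)
    exact Real.log_le_log (by positivity) (le_max_left _ _)
  set C : ℝ := ∑ i, ∑ a ∈ E, K i a with hC
  have hC0 : 0 ≤ C := Finset.sum_nonneg fun i _ => Finset.sum_nonneg fun a _ => hK0 i a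
  have hKC : ∀ i, ∀ a ∈ E, K i a ≤ C := by
    intro i a ha
    refine (Finset.single_le_sum (f := fun a => K i a) (fun a _ => hK0 i a) ha).trans ?_
    exact Finset.single_le_sum (f := fun i => ∑ a ∈ E, K i a)
      (fun i _ => Finset.sum_nonneg fun a _ => hK0 i a) (Finset.mem_univ i)
  refine ⟨B + N * C, by positivity, fun a ha T w n => ?_⟩
  induction n generalizing a T with
  | zero =>
    simp only [preimTn, Multiset.map_singleton, Multiset.sum_singleton, pow_zero, mul_one]
    have := hB a ha T
    have : 0 ≤ N * C := by positivity
    linarith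
  | succ n ih =>
    rw [sum_preimTn_succ]
    have h1 : ((preimTn p q n (w, z1)).map fun y => ((preimT p q y).map fun y => Vt T a y.2).sum).sum
        ≤ ((preimTn p q n (w, z1)).map fun y => ∑ i,
          (Vt (degR p q i * T) (ratEval (p i) (q i) a) y.2 + C)).sum := by
      refine Multiset.sum_map_le_sum_map _ _ fun y _ => ?_
      rw [sum_preimT]
      refine Finset.sum_le_sum fun i _ => ?_
      refine (hK i a T y.2).trans ?_
      rw [degR]
      linarith [hKC i a ha]
    refine h1.trans ?_
    rw [sum_map_comm]
    have h2 : ∀ i, ((preimTn p q n (w, z1)).map fun y =>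
        (Vt (degR p q i * T) (ratEval (p i) (q i) a) y.2 + C)).sum ≤
        (B + N * C) * (Dtot p q : ℝ) ^ n + C * (Dtot p q : ℝ) ^ n := by
      intro i
      rw [Multiset.sum_map_add, Multiset.map_const', Multiset.sum_replicate, card_preimTn,
        nsmul_eq_mul]
      have := ih _ (hE i a ha) (degR p q i * T)
      push_cast
      linarith
    refine (Finset.sum_le_sum fun i _ => h2 i).trans ?_
    rw [Finset.sum_const, Finset.card_univ, Fintype.card_fin, nsmul_eq_mul, pow_succ]
    have hlt : (N : ℝ) + 1 ≤ Dtot p q := by exact_mod_cast hg.lt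
    have hDn : (0 : ℝ) ≤ (Dtot p q : ℝ) ^ n := by positivity
    have h3 : N * (B + N * C) + N * C ≤ (B + N * C) * Dtot p q := by
      have : 0 ≤ B + N * C := by positivity
      nlinarith
    nlinarith

/-! ### Most sections contract -/

variable {p q} in
lemma SecFam.nice {S : Finset ℂ} (h0 : 0 ∈ S) {A : Set ℂ} {n : ℕ}
    {F : Finset ((Fin n → Fin N) × (ℂ → ℂ))} (h : SecFam p q S A n F) {x} (hx : x ∈ F) :
    NiceSec A x.2 :=
  ⟨h.diff x hx, fun _ hz _ hz' he => (h.eq_of hx hx rfl hz hz' he).1,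
    fun z hz he => h.avoid x hx z hz (he ▸ h0)⟩

lemma few_bad {S : Finset ℂ} (h0 : 0 ∈ S) {A K : Set ℂ} {c : ℂ} (hAo : IsOpen A)
    (hA : StarConvex ℝ c A) (hcA : c ∈ A) (hK : IsCompact K) (hKA : K ⊆ A) (M δ : ℝ) (hδ : 0 < δ) :
    ∃ B : ℕ, ∀ n F, SecFam p q S A n F →
      (F.filter fun x => (∃ z ∈ K, ‖x.2 z‖ ≤ M) ∧ ∃ z ∈ K, δ ≤ ‖deriv x.2 z‖).card ≤ B * N ^ n := by
  obtain ⟨B, hB⟩ := packing hAo hA hcA hK hKA M δ hδ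
  refine ⟨B, fun n F hF => ?_⟩
  have : N ^ n = (Finset.univ : Finset (Fin n → Fin N)).card := by simp
  rw [this]
  refine Finset.card_le_mul_card_image_of_maps_to (f := Prod.fst) (fun _ _ => Finset.mem_univ _) B ?_
  intro v _
  set G := (F.filter fun x => (∃ z ∈ K, ‖x.2 z‖ ≤ M) ∧ ∃ z ∈ K, δ ≤ ‖deriv x.2 z‖).filter
    (fun x => x.1 = v) with hG
  have hmem : ∀ x ∈ G, x ∈ F ∧ ((∃ z ∈ K, ‖x.2 z‖ ≤ M) ∧ ∃ z ∈ K, δ ≤ ‖deriv x.2 z‖) ∧ x.1 = v := by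
    intro x hx
    simp only [hG, Finset.mem_filter] at hx
    exact ⟨hx.1.1, hx.1.2, hx.2⟩
  rw [← Finset.card_image_of_injOn (f := Prod.snd) (s := G)]
  · refine hB _ ?_ ?_ ?_ ?_
    · intro s hs
      obtain ⟨x, hx, rfl⟩ := Finset.mem_image.mp hs
      exact hF.nice h0 (hmem x hx).1
    · intro s hs t ht hst z hz z' hz' he
      obtain ⟨x, hx, rfl⟩ := Finset.mem_image.mp hs
      obtain ⟨y, hy, rfl⟩ := Finset.mem_image.mp ht
      refine hst ?_
      rw [(hF.eq_of (hmem x hx).1 (hmem y hy).1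
        ((hmem x hx).2.2.trans (hmem y hy).2.2.symm) hz hz' he).2]
    · intro s hs
      obtain ⟨x, hx, rfl⟩ := Finset.mem_image.mp hs
      exact (hmem x hx).2.1.1
    · intro s hs
      obtain ⟨x, hx, rfl⟩ := Finset.mem_image.mp hs
      exact (hmem x hx).2.1.2
  · intro x hx y hy he
    exact Prod.ext ((hmem x hx).2.2.trans (hmem y hy).2.2.symm) he

lemma small_sec {A K : Set ℂ} {c : ℂ} (hAo : IsOpen A) (hKA : K ⊆ A) (hKs : StarConvex ℝ c K)
    {s : ℂ → ℂ} (hs : DifferentiableOn ℂ s A) {δ : ℝ} (hd : ∀ z ∈ K, ‖deriv s z‖ < δ) {z : ℂ}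
    (hz : z ∈ K) : ‖s z - s c‖ ≤ δ * ‖z - c‖ := by
  have hseg : segment ℝ c z ⊆ K := hKs.segment_subset hz
  refine (convex_segment c z).norm_image_sub_le_of_norm_deriv_le (𝕜 := ℂ) (f := s) ?_ ?_
    (left_mem_segment _ _ _) (right_mem_segment _ _ _)
  · intro y hy
    exact hs.differentiableAt (hAo.mem_nhds (hKA (hseg hy)))
  · intro y hy
    exact (hd y (hseg hy)).le

lemma sph_large {M : ℝ} (hM : 0 < M) {a b : ℂ} (ha : M < ‖a‖) (hb : M < ‖b‖) :
    sphDist (a : Sphere) (b : Sphere) ≤ 4 / M := by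
  have key : ∀ a : ℂ, M < ‖a‖ → 2 / nm (a : Sphere) ≤ 2 / M := by
    intro a ha
    refine div_le_div_of_nonneg_left (by norm_num) hM (ha.le.trans ?_)
    rw [nm_coe]; exact Real.le_sqrt_of_sq_le (by linarith)
  have h := sphDist_triangle (a : Sphere) OnePoint.infty (b : Sphere)
  rw [sphDist_coe_infty, sphDist_infty_coe] at h
  have h1 := key a ha
  have h2 := key b hb
  have : 4 / M = 2 / M + 2 / M := by ring
  linarith

instance : FirstCountableTopology Sphere :=
  isEmbedding_stE.isInducing.firstCountableTopology

lemma sum_sub_le {α ι : Type*} (F : Finset ι) (f : ι → α) (s : Multiset α) (h : F.val.map f ≤ s)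
    (g : α → ℝ) (hg : ∀ a, 0 ≤ g a) : ∑ x ∈ F, g (f x) ≤ (s.map g).sum := by
  obtain ⟨t, rfl⟩ := Multiset.le_iff_exists_add.mp h
  rw [Multiset.map_add, Multiset.sum_add, Multiset.map_map]
  have : 0 ≤ (t.map g).sum := Multiset.sum_nonneg fun b hb => by
    obtain ⟨a, -, rfl⟩ := Multiset.mem_map.mp hb
    exact hg a
  have h2 : ∑ x ∈ F, g (f x) = (F.val.map (g ∘ f)).sum := rfl
  linarith

lemma julia_aux (p q : Fin 1 → ℂ[X]) (hg : Good p q) (E : Finset Sphere)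
    (hE : ∀ i, ∀ a ∈ E, ratEval (p i) (q i) a ∈ E) : ∃ a z' : ℂ, a ≠ z' ∧ ∃ τ : ℝ, 0 < τ ∧
      ∀ k : ℕ, ∃ n, 1 ≤ n ∧ ∃ y y' : Sphere, itComp p q (fun _ => 0) n y = (a : Sphere) ∧
        itComp p q (fun _ => 0) n y' = (z' : Sphere) ∧ sphDist y y' ≤ 1 / (k + 1 : ℝ) ∧
        ∀ e ∈ E, τ ≤ sphDist y e := by
  obtain ⟨S, h0, F0, hF0, hsec⟩ := sections hg (η := 1 / 4) (by norm_num)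
  have hfin : (F0 ∪ (fun z : ℂ => (z : Sphere)) ⁻¹' (E : Set Sphere)).Finite :=
    hF0.union (E.finite_toSet.preimage OnePoint.coe_injective.injOn)
  obtain ⟨a, ha⟩ := hfin.infinite_compl.nonempty
  have hopen : IsOpen (F0 ∪ (fun z : ℂ => (z : Sphere)) ⁻¹' (E : Set Sphere))ᶜ :=
    hfin.isClosed.isOpen_compl
  obtain ⟨r, hr, hball⟩ := Metric.isOpen_iff.mp hopen a ha
  have haE : (a : Sphere) ∉ E := fun h => ha (Or.inr h)
  obtain ⟨K0, hK0, hpot⟩ := potential hg E hE haE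
  set A := Metric.ball a r with hA
  have hAstar : StarConvex ℝ a A := (convex_ball a r).starConvex (Metric.mem_ball_self hr)
  have haA : a ∈ A := Metric.mem_ball_self hr
  have hdisj : Disjoint A F0 := Set.disjoint_left.mpr fun z hz hz0 => hball hz (Or.inl hz0)
  have hsec' := hsec A a Metric.isOpen_ball hAstar haA hdisj
  set z' : ℂ := a + (r / 2 : ℝ) with hz'
  have hnz : ‖z' - a‖ = r / 2 := by
    rw [hz', add_sub_cancel_left, Complex.norm_real, Real.norm_of_nonneg (by positivity)]
  set K := Metric.closedBall a (r / 2) with hK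
  have hKA : K ⊆ A := Metric.closedBall_subset_ball (by linarith)
  have hKs : StarConvex ℝ a K := (convex_closedBall a _).starConvex
    (Metric.mem_closedBall_self (by positivity))
  have haK : a ∈ K := Metric.mem_closedBall_self (by positivity)
  have hzK : z' ∈ K := by rw [hK, mem_closedBall_iff_norm, hnz]
  set T : ℝ := 4 * (E.card + 1) * (K0 + 1) with hT
  have hTp : 0 < T := by positivity
  refine ⟨a, z', ?_, 2 * Real.exp (-T), by positivity, fun k => ?_⟩
  · intro h
    rw [← h, sub_self, norm_zero] at hnz
    linarith
  set M : ℝ := 4 * (k + 1) with hM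
  have hMp : 0 < M := by positivity
  set δ : ℝ := 1 / (k + 1) / r with hδ
  have hδp : 0 < δ := by positivity
  obtain ⟨B, hB⟩ := few_bad p q h0 Metric.isOpen_ball hAstar haA (isCompact_closedBall _ _) hKA M δ hδp
  have hD : 2 ≤ Dtot p q := hg.lt
  obtain ⟨n0, hn0⟩ := exists_nat_gt (2 * B : ℝ)
  set n := n0 + 1 with hn
  have hDn : (2 * B : ℝ) < (Dtot p q : ℝ) ^ n := by
    have h1 : n < Dtot p q ^ n := n.lt_pow_self (by omega)
    have h2 : ((n : ℕ) : ℝ) < (Dtot p q : ℝ) ^ n := by exact_mod_cast h1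
    have h3 : ((n : ℕ) : ℝ) = n0 + 1 := by rw [hn]; push_cast; rfl
    linarith
  obtain ⟨F, hF, hFc⟩ := hsec' n
  have hw : ∀ x : (Fin n → Fin 1) × (ℂ → ℂ), catW x.1 (fun _ => 0) = fun _ => 0 := fun x =>
    Subsingleton.elim _ _
  have hVT : ∀ e z, sphDist z e < 2 * Real.exp (-T) → Vt T e z = T := by
    intro e z h
    rw [Vt, max_eq_right (by linarith), Real.log_exp, neg_neg]
  -- the sections landing near E
  have hnear : ∀ e ∈ E, ((F.filter fun x => sphDist (x.2 a : Sphere) e < 2 * Real.exp (-T)).card : ℝ) * T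
      ≤ K0 * (Dtot p q : ℝ) ^ n := by
    intro e he
    refine le_trans ?_ (hpot e he T (fun _ => 0) n)
    refine le_trans ?_ (sum_sub_le F _ _ (hF.le (fun _ => 0) haA) (fun y => Vt T e y.2)
      fun y => Vt_nonneg hTp.le _ _)
    refine le_trans ?_ (Finset.sum_le_sum_of_subset_of_nonneg (Finset.filter_subset
      (fun x => sphDist (x.2 a : Sphere) e < 2 * Real.exp (-T)) F) fun x _ _ => Vt_nonneg hTp.le _ _)
    rw [← nsmul_eq_mul, ← Finset.sum_const]
    refine Finset.sum_le_sum fun x hx => ?_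
    rw [hVT e _ (Finset.mem_filter.mp hx).2]
  set Bad1 := E.biUnion fun e => F.filter fun x => sphDist (x.2 a : Sphere) e < 2 * Real.exp (-T)
  set Bad2 := F.filter fun x => (∃ z ∈ K, ‖x.2 z‖ ≤ M) ∧ ∃ z ∈ K, δ ≤ ‖deriv x.2 z‖
  have hb1 : (Bad1.card : ℝ) * T ≤ E.card * (K0 * (Dtot p q : ℝ) ^ n) := by
    have h1 : (Bad1.card : ℝ) ≤ ∑ e ∈ E,
        ((F.filter fun x => sphDist (x.2 a : Sphere) e < 2 * Real.exp (-T)).card : ℝ) := by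
      exact_mod_cast Finset.card_biUnion_le
    calc _ ≤ (∑ e ∈ E, ((F.filter fun x => sphDist (x.2 a : Sphere) e <
          2 * Real.exp (-T)).card : ℝ)) * T := by gcongr
      _ ≤ ∑ e ∈ E, K0 * (Dtot p q : ℝ) ^ n := by
        rw [Finset.sum_mul]; exact Finset.sum_le_sum hnear
      _ = _ := by rw [Finset.sum_const, nsmul_eq_mul]
  have hDp : (0 : ℝ) < (Dtot p q : ℝ) ^ n := by
    have : (0 : ℝ) < Dtot p q := by exact_mod_cast (by omega : 0 < Dtot p q)
    positivity
  have hb1' : (Bad1.card : ℝ) ≤ (Dtot p q : ℝ) ^ n / 4 := by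
    have h1 : (E.card : ℝ) * (K0 * (Dtot p q : ℝ) ^ n) ≤ (Dtot p q : ℝ) ^ n / 4 * T := by
      have h2 : (E.card : ℝ) * K0 ≤ (E.card + 1) * (K0 + 1) := by
        have : (0 : ℝ) ≤ E.card := by positivity
        nlinarith
      calc _ = (E.card : ℝ) * K0 * (Dtot p q : ℝ) ^ n := by ring
        _ ≤ (E.card + 1) * (K0 + 1) * (Dtot p q : ℝ) ^ n := by gcongr
        _ = _ := by rw [hT]; ring
    exact le_of_mul_le_mul_right (hb1.trans h1) hTp
  have hb2 : (Bad2.card : ℝ) ≤ B := by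
    have := hB n F hF
    rw [one_pow, mul_one] at this
    exact_mod_cast this
  obtain ⟨x, hxF, hx1, hx2⟩ : ∃ x ∈ F, x ∉ Bad1 ∧ x ∉ Bad2 := by
    by_contra! hcon
    have hsub : F ⊆ Bad1 ∪ Bad2 := fun x hx => by
      by_cases h : x ∈ Bad1
      · exact Finset.mem_union_left _ h
      · exact Finset.mem_union_right _ (hcon x hx h)
    have h1 : (F.card : ℝ) ≤ Bad1.card + Bad2.card := by
      exact_mod_cast (Finset.card_le_card hsub).trans (Finset.card_union_le _ _)
    linarith
  refine ⟨n, by omega, (x.2 a : Sphere), (x.2 z' : Sphere), ?_, ?_, ?_, ?_⟩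
  · have := hF.it x hxF (fun _ => 0) a haA
    rwa [hw] at this
  · have := hF.it x hxF (fun _ => 0) z' (hKA hzK)
    rwa [hw] at this
  · by_cases hc : ∃ z ∈ K, ‖x.2 z‖ ≤ M
    · have hd : ∀ z ∈ K, ‖deriv x.2 z‖ < δ := by
        intro z hz
        by_contra hcon
        exact hx2 (Finset.mem_filter.mpr ⟨hxF, hc, z, hz, not_lt.mp hcon⟩)
      have h1 := small_sec Metric.isOpen_ball hKA hKs (hF.diff x hxF) hd hzK
      refine (sphDist_coe_le _ _).trans ?_
      rw [dist_comm, dist_eq_norm]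
      rw [hnz] at h1
      have h2 : δ * (r / 2) = 1 / (k + 1 : ℝ) / 2 := by rw [hδ]; field_simp
      linarith
    · push Not at hc
      refine (sph_large hMp (hc a haK) (hc z' hzK)).trans (le_of_eq ?_)
      rw [hM]; field_simp
  · intro e he
    by_contra hcon
    exact hx1 (Finset.mem_biUnion.mpr ⟨e, he, Finset.mem_filter.mpr ⟨hxF, not_le.mp hcon⟩⟩)

/-! ### Julia points outside a finite forward invariant set -/

lemma julia_one (p q : Fin 1 → ℂ[X]) (hg : Good p q) (E : Finset Sphere)
    (hE : ∀ i, ∀ a ∈ E, ratEval (p i) (q i) a ∈ E) :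
    ∃ z1, z1 ∉ E ∧ z1 ∈ juliaW p q (fun _ => 0) := by
  obtain ⟨a, z', haz, τ, hτ, hk⟩ := julia_aux p q hg E hE
  by_contra! hcon
  choose n hn y y' hy hy' hyy hyE using hk
  obtain ⟨x, -, φ, hφ, hlim⟩ := isCompact_univ.tendsto_subseq (x := y) (fun _ => Set.mem_univ _)
  have hxE : x ∉ E := by
    intro hx
    have h1 : Tendsto (fun k => sphDist (y (φ k)) x) atTop (𝓝 0) := tendsto_iff_sphDist.mp hlim
    have := ge_of_tendsto' h1 (fun k => hyE (φ k) x hx)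
    linarith
  have hxF : x ∈ fatouW p q (fun _ => 0) := by
    have := hcon x hxE
    simpa [juliaW] using this
  obtain ⟨U, hU, hxU, hN⟩ := hxF
  obtain ⟨ψ, hψ, g, hconv⟩ := hN (fun k => itComp p q (fun _ => 0) (n (φ k)))
    (fun k => ⟨_, hn _, rfl⟩)
  obtain ⟨K, hKc, hKx, hKU⟩ : ∃ K, IsCompact K ∧ K ∈ 𝓝 x ∧ K ⊆ U := by
    obtain ⟨K, h1, h2, h3⟩ := local_compact_nhds (hU.mem_nhds hxU)
    exact ⟨K, h3, h1, h2⟩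
  have hlim' : Tendsto (fun k => y' (φ k)) atTop (𝓝 x) := by
    rw [tendsto_iff_sphDist]
    have h1 : Tendsto (fun k => sphDist (y (φ k)) x) atTop (𝓝 0) := tendsto_iff_sphDist.mp hlim
    have h2 : Tendsto (fun k => 1 / ((φ k : ℕ) + 1 : ℝ)) atTop (𝓝 0) :=
      tendsto_one_div_add_atTop_nhds_zero_nat.comp hφ.tendsto_atTop
    refine squeeze_zero (fun k => sphDist_nonneg _ _) (fun k => ?_) (by simpa using h2.add h1)
    refine (sphDist_triangle _ (y (φ k)) _).trans ?_
    rw [sphDist_comm (y' _)]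
    gcongr
    simpa using hyy (φ k)
  have hκ : 0 < sphDist (a : Sphere) (z' : Sphere) :=
    sphDist_pos (fun h => haz (OnePoint.coe_injective h))
  set κ := sphDist (a : Sphere) (z' : Sphere)
  have hev := hconv K hKU hKc (κ / 6) (by positivity)
  obtain ⟨k0, hk0⟩ := hev.exists
  have hc := continuous_itComp hg (fun _ => 0) (n (φ (ψ k0)))
  have e1 : Tendsto (fun k => y (φ (ψ k))) atTop (𝓝 x) := hlim.comp hψ.tendsto_atTop
  have e2 : Tendsto (fun k => y' (φ (ψ k))) atTop (𝓝 x) := hlim'.comp hψ.tendsto_atTop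
  have e3 := (hc.tendsto x).comp e1
  have e4 := (hc.tendsto x).comp e2
  have e5 := (tendsto_iff_sphDist.mp e3).eventually (gt_mem_nhds (show 0 < κ / 12 by positivity))
  have e6 := (tendsto_iff_sphDist.mp e4).eventually (gt_mem_nhds (show 0 < κ / 12 by positivity))
  obtain ⟨k, h1, h2, h3, h4, h5⟩ := (hev.and ((e1.eventually hKx).and
    ((e2.eventually hKx).and (e5.and e6)))).exists
  simp only [Function.comp_apply] at h4 h5
  have a1 := h1 _ h2
  have a2 := h1 _ h3
  have a3 := hk0 _ h2
  have a4 := hk0 _ h3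
  rw [hy] at a1
  rw [hy'] at a2
  set u := g (y (φ (ψ k)))
  set u' := g (y' (φ (ψ k)))
  set f := itComp p q (fun _ => 0) (n (φ (ψ k0)))
  have t1 := sphDist_triangle (a : Sphere) u (z' : Sphere)
  have t2 := sphDist_triangle u u' (z' : Sphere)
  have t3 := sphDist_triangle u (f (y (φ (ψ k)))) u'
  have t4 := sphDist_triangle (f (y (φ (ψ k)))) (f (y' (φ (ψ k)))) u'
  have t5 := sphDist_triangle (f (y (φ (ψ k)))) (f x) (f (y' (φ (ψ k))))
  rw [sphDist_comm u' ] at t2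
  rw [sphDist_comm u (f _)] at t3
  rw [sphDist_comm (f x) (f (y' _))] at t5
  linarith

variable {p q} in
lemma julia_pt (hg : Good p q) (E : Finset Sphere)
    (hE : ∀ i, ∀ a ∈ E, ratEval (p i) (q i) a ∈ E) :
    ∃ x ∈ juliaSet p q, x.2 ∉ E := by
  obtain ⟨h1, h2, h3, i, hi⟩ := hg
  have hg' : Good (fun _ : Fin 1 => p i) (fun _ : Fin 1 => q i) :=
    ⟨le_rfl, fun _ => h2 i, fun _ => h3 i, 0, hi⟩
  obtain ⟨z1, hz, hJ⟩ := julia_one _ _ hg' E (fun _ => hE i)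
  refine ⟨(fun _ => i, z1), subset_closure (Set.mem_iUnion.mpr ⟨fun _ => i, ?_⟩), hz⟩
  refine ⟨rfl, ?_⟩
  have : itComp (fun _ : Fin 1 => p i) (fun _ : Fin 1 => q i) (fun _ => 0) =
      itComp p q (fun _ => i) := by
    funext n
    induction n with
    | zero => rfl
    | succ n ih => simp only [itComp, ih]
  simpa only [juliaW, fatouW, this] using hJ

/-! ### The limit measure has no atoms in the fibre direction -/

/-- the hypothesis on the limit measure -/
def ConvTo (μ : Measure (SymX N)) : Prop :=
  ∀ x ∈ juliaSet p q, ∀ g : C(SymX N, ℝ),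
    Tendsto (fun n : ℕ => ((Dtot p q : ℝ) ^ n)⁻¹ * ((preimTn p q n x).map fun y => g y).sum)
      atTop (𝓝 (∫ y, g y ∂μ))

lemma integrable_cont (μ : Measure (SymX N)) [IsProbabilityMeasure μ] (g : SymX N → ℝ)
    (hc : Continuous g) : Integrable g μ :=
  hc.integrable_of_hasCompactSupport (HasCompactSupport.of_compactSpace g)

variable {p q} in
lemma Good.Dpos (hg : Good p q) : (0 : ℝ) < Dtot p q := by
  have := hg.lt
  exact_mod_cast (by omega : 0 < Dtot p q)

variable {p q} in
lemma push_le (hg : Good p q) {μ : Measure (SymX N)} (hμ : ConvTo p q μ) (g h : C(SymX N, ℝ))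
    (hgh : ∀ y, ((preimT p q y).map fun z => g z).sum ≤ h y) :
    (Dtot p q : ℝ) * ∫ y, g y ∂μ ≤ ∫ y, h y ∂μ := by
  obtain ⟨x, hx, -⟩ := julia_pt hg ∅ (by simp)
  have h1 := ((hμ x hx g).comp (tendsto_add_atTop_nat 1)).const_mul (Dtot p q : ℝ)
  refine le_of_tendsto_of_tendsto' h1 (hμ x hx h) (fun n => ?_)
  have hD := hg.Dpos
  simp only [Function.comp_apply]
  have e : (Dtot p q : ℝ) * (((Dtot p q : ℝ) ^ (n + 1))⁻¹ *
      ((preimTn p q (n + 1) x).map fun y => g y).sum) =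
      ((Dtot p q : ℝ) ^ n)⁻¹ * ((preimTn p q (n + 1) x).map fun y => g y).sum := by
    field_simp
    ring
  rw [e, sum_preimTn_succ]
  refine mul_le_mul_of_nonneg_left ?_ (by positivity)
  exact Multiset.sum_map_le_sum_map _ _ fun y _ => hgh y

/-- a tent function -/
def bmp (k : ℝ) (a z : Sphere) : ℝ := max 0 (1 - k * sphDist z a)

lemma continuous_bmp (k : ℝ) (a : Sphere) : Continuous (bmp k a) :=
  continuous_const.max (continuous_const.sub (continuous_const.mul (continuous_sphDist_left a)))

lemma bmp_lim (μ : Measure (SymX N)) [IsProbabilityMeasure μ] (a : Sphere) {k : ℕ → ℝ}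
    (hk : Tendsto k atTop atTop) (hk0 : ∀ n, 0 ≤ k n) :
    Tendsto (fun n => ∫ y, bmp (k n) a y.2 ∂μ) atTop (𝓝 (μ.real (Prod.snd ⁻¹' {a}))) := by
  have hm : MeasurableSet (Prod.snd ⁻¹' {a} : Set (SymX N)) :=
    (isClosed_singleton.preimage continuous_snd).measurableSet
  rw [← integral_indicator_one hm]
  refine tendsto_integral_of_dominated_convergence (fun _ => (1 : ℝ)) ?_ (integrable_const _) ?_ ?_
  · exact fun n => (integrable_cont μ _ ((continuous_bmp _ _).comp continuous_snd)).1
  · refine fun n => Eventually.of_forall fun y => ?_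
    have h0 : 0 ≤ bmp (k n) a y.2 := le_max_left _ _
    rw [Real.norm_of_nonneg h0]
    refine max_le zero_le_one ?_
    have := mul_nonneg (hk0 n) (sphDist_nonneg y.2 a)
    linarith
  · refine Eventually.of_forall fun y => ?_
    by_cases hy : y.2 = a
    · have : y ∈ (Prod.snd ⁻¹' {a} : Set (SymX N)) := hy
      simp [bmp, hy, sphDist_self]
    · have : y ∉ (Prod.snd ⁻¹' {a} : Set (SymX N)) := hy
      rw [Set.indicator_of_notMem this]
      refine tendsto_const_nhds.congr' ?_
      have hp := sphDist_pos hy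
      filter_upwards [(hk.atTop_mul_const hp).eventually (eventually_ge_atTop 1)] with n hn
      rw [bmp, max_eq_left]
      linarith

variable {p q} in
lemma atom_le (hg : Good p q) {μ : Measure (SymX N)} [IsProbabilityMeasure μ]
    (hμ : ConvTo p q μ) (a : Sphere) :
    (Dtot p q : ℝ) * μ.real (Prod.snd ⁻¹' {a}) ≤
      ∑ i, (degR p q i : ℝ) * μ.real (Prod.snd ⁻¹' {ratEval (p i) (q i) a}) := by
  have hc : ∀ i, _ := fun i => fiber_dist (hg.2.1 i) (hg.2.2.1 i) a
  choose c hc0 hc using hc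
  have h1 := (bmp_lim μ a tendsto_natCast_atTop_atTop
    (fun n => Nat.cast_nonneg n)).const_mul (Dtot p q : ℝ)
  have h2 := tendsto_finsetSum (Finset.univ : Finset (Fin N)) fun i _ =>
    (bmp_lim μ (ratEval (p i) (q i) a) (k := fun n : ℕ => (n : ℝ) * c i)
    (tendsto_natCast_atTop_atTop.atTop_mul_const (hc0 i))
    (fun n => mul_nonneg (Nat.cast_nonneg n) (hc0 i).le)).const_mul (degR p q i : ℝ)
  refine le_of_tendsto_of_tendsto' h1 h2 fun n => ?_
  have := push_le hg hμ ⟨fun y => bmp n a y.2, (continuous_bmp _ _).comp continuous_snd⟩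
    ⟨fun y => ∑ i, (degR p q i : ℝ) * bmp ((n : ℝ) * c i) (ratEval (p i) (q i) a) y.2,
      continuous_finsetSum _ fun i _ =>
        continuous_const.mul ((continuous_bmp _ _).comp continuous_snd)⟩ (fun y => by
      simp only [ContinuousMap.coe_mk]
      rw [sum_preimT]
      refine Finset.sum_le_sum fun i _ => ?_
      have := Multiset.sum_le_card_nsmul ((fiber (p i) (q i) y.2).map fun z => bmp n a z)
        (bmp ((n : ℝ) * c i) (ratEval (p i) (q i) a) y.2) (by
          intro t ht
          obtain ⟨z, hz, rfl⟩ := Multiset.mem_map.mp ht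
          refine max_le_max le_rfl ?_
          have h3 := mul_le_mul_of_nonneg_left (hc i y.2 z hz) (Nat.cast_nonneg (α := ℝ) n)
          rw [sphDist_comm y.2]
          linarith)
      simpa [card_fiber, degR] using this)
  simp only [ContinuousMap.coe_mk] at this
  have hint : ∀ i ∈ (Finset.univ : Finset (Fin N)), Integrable (fun y : SymX N =>
      (degR p q i : ℝ) * bmp ((n : ℝ) * c i) (ratEval (p i) (q i) a) y.2) μ := fun i _ =>
    integrable_cont μ _ (continuous_const.mul ((continuous_bmp _ _).comp continuous_snd))
  rw [integral_finsetSum _ hint] at this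
  simpa only [integral_const_mul] using this

variable {p q} in
lemma no_atom (hg : Good p q) {μ : Measure (SymX N)} [IsProbabilityMeasure μ]
    (hμ : ConvTo p q μ) (a : Sphere) : μ (Prod.snd ⁻¹' {a}) = 0 := by
  by_contra hne
  set m : Sphere → ℝ := fun a => μ.real (Prod.snd ⁻¹' {a}) with hm
  have hpos : 0 < m a := ENNReal.toReal_pos hne (measure_ne_top _ _)
  have hfin : {b | m a ≤ m b}.Finite := by
    have := Measure.finite_const_le_meas_of_disjoint_iUnion μ
      (pos_iff_ne_zero.mpr hne) (As := fun b : Sphere => (Prod.snd ⁻¹' {b} : Set (SymX N)))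
      (fun b => (isClosed_singleton.preimage continuous_snd).measurableSet)
      (fun b b' hb => Disjoint.preimage _ (by simpa using hb)) (measure_ne_top _ _)
    refine this.subset fun b hb => ?_
    exact (ENNReal.toReal_le_toReal (measure_ne_top _ _) (measure_ne_top _ _)).mp hb
  obtain ⟨b, hb, hmax⟩ := hfin.exists_maximalFor m _ ⟨a, le_refl (m a)⟩
  have hmax' : ∀ z, m z ≤ m b := by
    intro z
    by_contra! hz
    exact absurd (hmax (show m a ≤ m z from le_trans hb hz.le) hz.le) (not_le.mpr hz)
  have hbpos : 0 < m b := lt_of_lt_of_le hpos hb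
  have hEfin : {z | m z = m b}.Finite := hfin.subset fun z hz => by
    have : m z = m b := hz
    show m a ≤ m z
    rw [this]; exact hb
  set E := hEfin.toFinset
  have hmem : ∀ z, z ∈ E ↔ m z = m b := fun z => by simp [E]
  have hE : ∀ i, ∀ z ∈ E, ratEval (p i) (q i) z ∈ E := by
    intro i z hz
    rw [hmem] at hz ⊢
    by_contra hcon
    have h1 := atom_le hg hμ z
    have h2 : ∑ i, (degR p q i : ℝ) * m (ratEval (p i) (q i) z) < ∑ i, (degR p q i : ℝ) * m b := by
      refine Finset.sum_lt_sum (fun j _ => ?_) ⟨i, Finset.mem_univ _, ?_⟩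
      · gcongr; exact hmax' _
      · have : (0 : ℝ) < degR p q i := by exact_mod_cast hg.2.2.1 i
        exact mul_lt_mul_of_pos_left (lt_of_le_of_ne (hmax' _) hcon) this
    rw [← Finset.sum_mul] at h2
    have h3 : (Dtot p q : ℝ) = ∑ i, (degR p q i : ℝ) := by simp [Dtot]
    rw [← h3, ← hz] at h2
    exact absurd h1 (not_le.mpr h2)
  obtain ⟨⟨w, z1⟩, hx, hx1⟩ := julia_pt hg E hE
  obtain ⟨K, hK0, hK⟩ := potential hg E hE hx1
  have hD := hg.Dpos
  have hT : ∀ T : ℝ, 0 ≤ T → T * m b ≤ K := by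
    intro T hT
    have h1 : T * m b ≤ ∫ y, Vt T b y.2 ∂μ := by
      have hms : MeasurableSet (Prod.snd ⁻¹' {b} : Set (SymX N)) :=
        (isClosed_singleton.preimage continuous_snd).measurableSet
      have : ∫ y, (Prod.snd ⁻¹' {b} : Set (SymX N)).indicator (fun _ => T) y ∂μ = T * m b := by
        rw [integral_indicator_const _ hms, smul_eq_mul, mul_comm]
      rw [← this]
      refine integral_mono ((integrable_const T).indicator hms)
        (integrable_cont μ _ ((continuous_Vt T b).comp continuous_snd)) fun y => ?_
      by_cases hy : y ∈ (Prod.snd ⁻¹' {b} : Set (SymX N))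
      · rw [Set.indicator_of_mem hy]
        have : y.2 = b := hy
        simp only [this, Vt_self, le_refl]
      · rw [Set.indicator_of_notMem hy]
        exact Vt_nonneg hT _ _
    refine h1.trans ?_
    refine le_of_tendsto' (hμ _ hx ⟨fun y => Vt T b y.2, (continuous_Vt T b).comp continuous_snd⟩)
      fun n => ?_
    have := hK b ((hmem b).mpr rfl) T w n
    simp only [ContinuousMap.coe_mk]
    rw [inv_mul_le_iff₀ (by positivity), mul_comm]
    exact this
  have := hT ((K + 1) / m b) (by positivity)
  rw [div_mul_cancel₀ _ hbpos.ne'] at this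
  linarith

/-! ### Slit domains of full measure -/

/-- the ray issued from `b` in the direction opposite to `c` -/
def ray (b c : ℂ) : Set ℂ := {z | ∃ t : ℝ, 0 ≤ t ∧ z = b + t * (b - c)}

lemma ray_closed {b c : ℂ} (h : b.re < c.re) : IsClosed (ray b c) := by
  have he : ray b c = {z : ℂ | 0 ≤ (z.re - b.re) / (b.re - c.re)} ∩
      {z : ℂ | z = b + (((z.re - b.re) / (b.re - c.re) : ℝ) : ℂ) * (b - c)} := by
    ext z
    have hne : b.re - c.re ≠ 0 := by linarith
    constructor
    · rintro ⟨t, ht, rfl⟩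
      have : ((b + t * (b - c)).re - b.re) / (b.re - c.re) = t := by
        simp
        field_simp
      refine ⟨?_, ?_⟩
      · simp only [Set.mem_ofPred_eq, this]; exact ht
      · simp only [Set.mem_ofPred_eq, this]
    · rintro ⟨h1, h2⟩
      exact ⟨_, h1, h2⟩
  rw [he]
  refine IsClosed.inter (isClosed_le (by fun_prop) (by fun_prop)) (isClosed_eq (by fun_prop) ?_)
  fun_prop

lemma ray_star {b c z : ℂ} {s : ℝ} (hs0 : 0 < s) (hs1 : s ≤ 1)
    (h : c + s * (z - c) ∈ ray b c) : z ∈ ray b c := by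
  obtain ⟨t, ht, he⟩ := h
  refine ⟨(1 + t) / s - 1, ?_, ?_⟩
  · rw [sub_nonneg, le_div_iff₀ hs0]; linarith
  · have hne : (s : ℂ) ≠ 0 := by exact_mod_cast hs0.ne'
    push_cast
    have h2 : (s : ℂ) * (z - c) = (1 + t) * (b - c) := by linear_combination he
    field_simp
    linear_combination h2

lemma slit (μ : Measure (SymX N)) [IsProbabilityMeasure μ]
    (hna : ∀ a : Sphere, μ (Prod.snd ⁻¹' {a}) = 0) {E : Set ℂ} (hE : E.Finite) :
    ∃ A : Set ℂ, ∃ c, IsOpen A ∧ StarConvex ℝ c A ∧ c ∈ A ∧ Disjoint A E ∧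
      μ (Prod.snd ⁻¹' ((fun z : ℂ => (z : Sphere)) '' A))ᶜ = 0 := by
  obtain ⟨X, hX⟩ : ∃ X : ℝ, ∀ b ∈ E, b.re < X := by
    obtain ⟨X, hX⟩ := (hE.image Complex.re).bddAbove
    exact ⟨X + 1, fun b hb => by have := hX ⟨b, hb, rfl⟩; linarith⟩
  let cc : ℝ → ℂ := fun τ => ⟨X, τ⟩
  let As : ℂ → ℝ → Set (SymX N) := fun b τ =>
    Prod.snd ⁻¹' ((fun z : ℂ => (z : Sphere)) '' (ray b (cc τ) \ {b}))
  have hoe : IsOpenEmbedding (fun z : ℂ => (z : Sphere)) := OnePoint.isOpenEmbedding_coe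
  have hmeas : ∀ b ∈ E, ∀ τ, MeasurableSet (As b τ) := by
    intro b hb τ
    have h1 : (fun z : ℂ => (z : Sphere)) '' (ray b (cc τ) \ {b}) =
        (fun z : ℂ => (z : Sphere)) '' {b}ᶜ \ (fun z : ℂ => (z : Sphere)) '' (ray b (cc τ))ᶜ := by
      rw [← Set.image_sdiff OnePoint.coe_injective]
      congr 1
      ext z; simp; tauto
    show MeasurableSet (Prod.snd ⁻¹' ((fun z : ℂ => (z : Sphere)) '' (ray b (cc τ) \ {b})))
    rw [h1, Set.preimage_sdiff]
    refine MeasurableSet.diff ?_ ?_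
    · exact ((hoe.isOpenMap _ isOpen_compl_singleton).preimage continuous_snd).measurableSet
    · exact ((hoe.isOpenMap _ (ray_closed (hX b hb)).isOpen_compl).preimage
        continuous_snd).measurableSet
  have hdisj : ∀ b ∈ E, Pairwise (Function.onFun Disjoint (As b)) := by
    intro b hb τ τ' hne
    refine Disjoint.preimage _ ?_
    rw [Set.disjoint_image_iff OnePoint.coe_injective, Set.disjoint_left]
    rintro z ⟨⟨t, ht, h1⟩, hzb⟩ ⟨⟨t', ht', h2⟩, -⟩
    rw [h1] at h2
    have hre := congrArg Complex.re h2
    have him := congrArg Complex.im h2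
    simp [cc] at hre him
    have hb' := hX b hb
    have htt : t = t' := by
      rcases hre with h | h
      · exact h
      · linarith
    subst htt
    have ht0 : t ≠ 0 := by
      rintro rfl
      apply hzb
      simp [h1]
    have := mul_left_cancel₀ ht0 him
    exact hne (by linarith)
  have hcount : ∀ b ∈ E, {τ | 0 < μ (As b τ)}.Countable := fun b hb =>
    Measure.countable_meas_pos_of_disjoint_iUnion (hmeas b hb) (hdisj b hb)
  have hC : (⋃ b ∈ E, {τ | 0 < μ (As b τ)}).Countable := hE.countable.biUnion hcount
  obtain ⟨τ, hτ⟩ : (⋃ b ∈ E, {τ | 0 < μ (As b τ)})ᶜ.Nonempty := by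
    by_contra hcon
    rw [Set.not_nonempty_iff_eq_empty, Set.compl_empty_iff] at hcon
    rw [hcon] at hC
    exact Cardinal.not_countable_real hC
  have hτ0 : ∀ b ∈ E, μ (As b τ) = 0 := by
    intro b hb
    by_contra hne
    exact hτ (Set.mem_biUnion hb (pos_iff_ne_zero.mpr hne))
  have hcl : IsClosed (⋃ b ∈ E, ray b (cc τ)) :=
    hE.isClosed_biUnion fun b hb => ray_closed (hX b hb)
  have hself : ∀ b, b ∈ ray b (cc τ) := fun b => ⟨0, le_rfl, by simp⟩
  refine ⟨(⋃ b ∈ E, ray b (cc τ))ᶜ, cc τ, hcl.isOpen_compl, ?_, ?_, ?_, ?_⟩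
  · rw [starConvex_iff_forall_pos]
    · intro z hz a s ha hs hab hcon
      apply hz
      simp only [Set.mem_iUnion] at hcon ⊢
      obtain ⟨b, hb, h⟩ := hcon
      refine ⟨b, hb, ray_star hs (by linarith) ?_⟩
      convert h using 1
      have : (a : ℂ) = 1 - s := by rw [eq_sub_iff_add_eq]; exact_mod_cast hab
      simp only [Complex.real_smul, this]
      ring
    · intro h
      simp only [Set.mem_iUnion] at h
      obtain ⟨b, hb, t, ht, h⟩ := h
      have hre := congrArg Complex.re h
      simp [cc] at hre
      have hb' := hX b hb
      nlinarith
  · intro h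
    simp only [Set.mem_iUnion] at h
    obtain ⟨b, hb, t, ht, h⟩ := h
    have hre := congrArg Complex.re h
    simp [cc] at hre
    have hb' := hX b hb
    nlinarith
  · rw [Set.disjoint_left]
    intro z hz hzE
    exact hz (Set.mem_biUnion hzE (hself z))
  · have hsub : (Prod.snd ⁻¹' ((fun z : ℂ => (z : Sphere)) '' (⋃ b ∈ E, ray b (cc τ))ᶜ) :
        Set (SymX N))ᶜ ⊆ (Prod.snd ⁻¹' {OnePoint.infty}) ∪
          ⋃ b ∈ E, (Prod.snd ⁻¹' {(b : Sphere)} ∪ As b τ) := by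
      rintro ⟨w, z⟩ hz
      induction z using OnePoint.rec with
      | infty => left; simp
      | coe z =>
        right
        have h1 : z ∈ ⋃ b ∈ E, ray b (cc τ) := by
          by_contra hcon
          exact hz ⟨z, hcon, rfl⟩
        simp only [Set.mem_iUnion] at h1 ⊢
        obtain ⟨b, hb, h1⟩ := h1
        refine ⟨b, hb, ?_⟩
        by_cases hzb : z = b
        · left; simp [hzb]
        · right; exact ⟨z, ⟨h1, hzb⟩, rfl⟩
    refine measure_mono_null hsub ?_
    rw [measure_union_null_iff]
    refine ⟨hna _, (measure_biUnion_null_iff hE.countable).mpr fun b hb => ?_⟩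
    rw [measure_union_null_iff]
    exact ⟨hna _, hτ0 b hb⟩

/-! ### Contracting sections produce fixed points -/

lemma fixpt {A K : Set ℂ} {c : ℂ} (hAo : IsOpen A) (hKA : K ⊆ A) (hKs : StarConvex ℝ c K)
    {s : ℂ → ℂ} (hs : DifferentiableOn ℂ s A) {δ R r : ℝ} (hδ0 : 0 < δ) (hδ : δ ≤ 1 / 2)
    (hd : ∀ z ∈ K, ‖deriv s z‖ < δ) (hR : ∀ z ∈ K, ‖z - c‖ ≤ R) (hr : 2 * δ * R ≤ r) {z : ℂ}
    (hz : z ∈ K) (hball : Metric.closedBall (s z) r ⊆ K) :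
    ∃ ζ ∈ K, s ζ = ζ ∧ ‖ζ - s z‖ ≤ 2 * δ * R := by
  have hdist : ∀ u ∈ K, ‖s u - s z‖ ≤ 2 * δ * R := by
    intro u hu
    have h1 := small_sec hAo hKA hKs hs hd hu
    have h2 := small_sec hAo hKA hKs hs hd hz
    have h3 := mul_le_mul_of_nonneg_left (hR u hu) hδ0.le
    have h4 := mul_le_mul_of_nonneg_left (hR z hz) hδ0.le
    have h5 := norm_sub_le_norm_sub_add_norm_sub (s u) (s c) (s z)
    rw [norm_sub_rev (s c)] at h5
    linarith
  have hR0 : 0 ≤ R := (norm_nonneg _).trans (hR z hz)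
  have hr0 : 0 ≤ r := le_trans (by positivity) hr
  have hmaps : Set.MapsTo s (Metric.closedBall (s z) r) (Metric.closedBall (s z) r) := by
    intro u hu
    rw [Metric.mem_closedBall, dist_eq_norm]
    exact (hdist u (hball hu)).trans hr
  have hcon : ContractingWith (1 / 2 : NNReal) (hmaps.restrict s _ _) := by
    refine ⟨by rw [← NNReal.coe_lt_coe]; norm_num, ?_⟩
    refine LipschitzWith.of_dist_le_mul fun u v => ?_
    have := (convex_closedBall (s z) r).norm_image_sub_le_of_norm_deriv_le (𝕜 := ℂ) (f := s)
      (C := 1 / 2) (fun y hy => hs.differentiableAt (hAo.mem_nhds (hKA (hball hy))))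
      (fun y hy => (hd y (hball hy)).le.trans hδ) v.2 u.2
    rw [Subtype.dist_eq, Subtype.dist_eq, dist_eq_norm, dist_eq_norm]
    simpa using this
  obtain ⟨ζ, hζ, hfix, -⟩ := hcon.exists_fixedPoint' Metric.isClosed_closedBall.isComplete hmaps
    (Metric.mem_closedBall_self hr0) (edist_ne_top _ _)
  refine ⟨ζ, hball hζ, hfix, ?_⟩
  have := hdist ζ (hball hζ)
  rwa [hfix.eq] at this

variable {p q} in
lemma SecFam.mem_fix {S : Finset ℂ} {A : Set ℂ} {n : ℕ} {F : Finset ((Fin n → Fin N) × (ℂ → ℂ))}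
    (h : SecFam p q S A n F) (hAo : IsOpen A) {x} (hx : x ∈ F) {ζ : ℂ} (hζ : ζ ∈ A)
    (hfix : x.2 ζ = ζ) (hd : ‖deriv x.2 ζ‖ < 1) :
    (ζ : Sphere) ∈ fixMul (wordPair p q (List.ofFn x.1)) := by
  rw [fixMul_eq, Multiset.mem_add]
  left
  refine Multiset.mem_map.mpr ⟨ζ, ?_, rfl⟩
  rw [mem_roots']
  constructor
  · intro h0
    have hid : ∀ z ∈ A, x.2 z = z := by
      intro z hz
      obtain ⟨h1, h2⟩ := h.eqn x hx z hz
      have h3 := congrArg (eval (x.2 z)) h0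
      simp only [eval_sub, eval_mul, eval_X, eval_zero, h2] at h3
      have h4 : (z - x.2 z) * (wordPair p q (List.ofFn x.1)).2.eval (x.2 z) = 0 := by
        linear_combination h3
      rcases mul_eq_zero.mp h4 with h5 | h5
      · exact (sub_eq_zero.mp h5).symm
      · exact absurd h5 h1
    have he : x.2 =ᶠ[𝓝 ζ] id := by
      filter_upwards [hAo.mem_nhds hζ] with z hz using hid z hz
    rw [he.deriv_eq] at hd
    simp at hd
  · obtain ⟨h1, h2⟩ := h.eqn x hx ζ hζ
    rw [hfix] at h2
    simp [IsRoot, h2]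

lemma perW_injective {m : ℕ} (hm : 0 < m) : Function.Injective (perW (N := N) hm) := by
  intro v v' h
  funext k
  have := congrFun h k
  simpa [perW, Nat.mod_eq_of_lt k.2] using this

variable {p q} in
lemma core (hg : Good p q) {S : Finset ℂ} (h0 : 0 ∈ S) {A K : Set ℂ} {c : ℂ} {η : ℝ}
    (hAo : IsOpen A) (hA : StarConvex ℝ c A) (hcA : c ∈ A)
    (hsec : ∀ n, ∃ F, SecFam p q S A n F ∧ (1 - η) * (Dtot p q : ℝ) ^ n ≤ F.card)
    (hK : IsCompact K) (hKA : K ⊆ A) (g : C(SymX N, ℝ)) {M : ℝ} (hg0 : ∀ y, 0 ≤ g y)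
    (hgM : ∀ y, g y ≤ M) {ε : ℝ} (hε : 0 < ε) :
    ∃ B : ℕ, ∃ n0 : ℕ, ∀ n ≥ n0, ∀ w, ∀ z ∈ K, ∀ h : SymX N → ℝ, (∀ y, 0 ≤ h y) →
      (∀ y, h y ≤ g y) → (∀ w' : ℕ → Fin N, ∀ z' : ℂ, z' ∉ K → h (w', (z' : Sphere)) = 0) →
      ((preimTn p q n (w, (z : Sphere))).map h).sum ≤ ((fixMultiset p q n).map fun y => g y).sum +
        ε * (Dtot p q : ℝ) ^ n + η * M * (Dtot p q : ℝ) ^ n + M * (B * (N : ℝ) ^ n) := by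
  have hM : 0 ≤ M := (hg0 (fun _ => ⟨0, hg.1⟩, OnePoint.infty)).trans (hgM _)
  obtain ⟨n1, hn1⟩ := unif_cont g hε
  obtain ⟨ρ, hρ, hth⟩ := hK.exists_cthickening_subset_open hAo hKA
  obtain ⟨K2, hK2, hKK2, hK2A, hst, hcK2⟩ := exists_star_compact hA hcA (hK.cthickening (r := ρ)) hth
  obtain ⟨R, hR0, hR⟩ : ∃ R, 0 < R ∧ ∀ z ∈ K2, ‖z - c‖ ≤ R := by
    obtain ⟨R, hR⟩ := hK2.isBounded.subset_closedBall c
    refine ⟨max R 1, by positivity, fun z hz => le_max_of_le_left ?_⟩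
    simpa [dist_eq_norm] using hR hz
  obtain ⟨M0, hM0⟩ := hK.isBounded.exists_norm_le
  obtain ⟨δ, hδ0, hδ1, hδ2, hδ3⟩ : ∃ δ : ℝ, 0 < δ ∧ δ ≤ 1 / 2 ∧ 2 * δ * R ≤ ρ ∧
      2 * (2 * δ * R) ≤ 1 / (n1 + 1 : ℝ) := by
    refine ⟨min (1 / 2) (min (ρ / (2 * R)) (1 / (n1 + 1) / (4 * R))), by positivity,
      min_le_left _ _, ?_, ?_⟩
    · have : min (1 / 2) (min (ρ / (2 * R)) (1 / (n1 + 1) / (4 * R))) ≤ ρ / (2 * R) :=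
        (min_le_right _ _).trans (min_le_left _ _)
      rw [le_div_iff₀ (by positivity)] at this
      linarith
    · have : min (1 / 2) (min (ρ / (2 * R)) (1 / (n1 + 1) / (4 * R))) ≤
          1 / (n1 + 1 : ℝ) / (4 * R) := (min_le_right _ _).trans (min_le_right _ _)
      rw [le_div_iff₀ (by positivity)] at this
      linarith
  obtain ⟨B, hB⟩ := few_bad p q h0 hAo hA hcA hK2 hK2A M0 δ hδ0
  refine ⟨B, n1 + 1, fun n hn w z hz h hh0 hhg hhK => ?_⟩
  obtain ⟨F, hF, hcard⟩ := hsec n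
  have hKK : K ⊆ K2 := (Metric.self_subset_cthickening K).trans hKK2
  have hzA : z ∈ A := hKA hz
  have hD := hg.Dpos
  -- first reduction: to the family of sections
  have hle := hF.le w hzA
  have hFcard : (F.card : ℝ) ≤ (Dtot p q : ℝ) ^ n := by
    have := Multiset.card_le_card hle
    rw [card_preimTn, Multiset.card_map] at this
    exact_mod_cast this
  have step1 : ((preimTn p q n (w, (z : Sphere))).map h).sum ≤
      ∑ x ∈ F, h (catW x.1 w, (x.2 z : Sphere)) + η * M * (Dtot p q : ℝ) ^ n := by
    have hc := card_preimTn p q n (w, (z : Sphere))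
    obtain ⟨t, ht⟩ := Multiset.le_iff_exists_add.mp hle
    rw [ht] at hc ⊢
    rw [Multiset.map_add, Multiset.sum_add, Multiset.map_map]
    refine add_le_add (le_of_eq rfl) ?_
    have h1 := Multiset.sum_le_card_nsmul (t.map h) M (by
      intro b hb
      obtain ⟨a, -, rfl⟩ := Multiset.mem_map.mp hb
      exact (hhg a).trans (hgM a))
    refine h1.trans ?_
    rw [Multiset.card_map, nsmul_eq_mul]
    rw [Multiset.card_add, Multiset.card_map] at hc
    have hc' : (F.card : ℝ) + t.card = (Dtot p q : ℝ) ^ n := by exact_mod_cast hc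
    have : (t.card : ℝ) ≤ η * (Dtot p q : ℝ) ^ n := by linarith
    nlinarith
  -- bad and good sections
  set bad := F.filter fun x => (∃ z ∈ K2, ‖x.2 z‖ ≤ M0) ∧ ∃ z ∈ K2, δ ≤ ‖deriv x.2 z‖ with hbad
  set good := F.filter fun x => x.2 z ∈ K ∧ ∀ z ∈ K2, ‖deriv x.2 z‖ < δ with hgood
  have step2 : ∑ x ∈ F, h (catW x.1 w, (x.2 z : Sphere)) ≤
      ∑ x ∈ good, h (catW x.1 w, (x.2 z : Sphere)) +
        ∑ x ∈ bad, h (catW x.1 w, (x.2 z : Sphere)) := by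
    rw [hgood, hbad, Finset.sum_filter, Finset.sum_filter, ← Finset.sum_add_distrib]
    refine Finset.sum_le_sum fun x hx => ?_
    have hx0 := hh0 (catW x.1 w, (x.2 z : Sphere))
    by_cases hxK : x.2 z ∈ K
    · by_cases hxd : ∀ z ∈ K2, ‖deriv x.2 z‖ < δ
      · rw [if_pos ⟨hxK, hxd⟩]
        split_ifs <;> linarith
      · have hxd' : ∃ z ∈ K2, δ ≤ ‖deriv x.2 z‖ := by
          push Not at hxd
          exact hxd
        rw [if_pos (show (∃ z ∈ K2, ‖x.2 z‖ ≤ M0) ∧ ∃ z ∈ K2, δ ≤ ‖deriv x.2 z‖ from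
          ⟨⟨z, hKK hz, hM0 _ hxK⟩, hxd'⟩)]
        split_ifs <;> linarith
    · rw [hhK _ _ hxK]
      simp
  have step3 : ∑ x ∈ bad, h (catW x.1 w, (x.2 z : Sphere)) ≤ M * (B * (N : ℝ) ^ n) := by
    have h1 := Finset.sum_le_card_nsmul bad (fun x => h (catW x.1 w, (x.2 z : Sphere))) M
      (fun x _ => (hhg _).trans (hgM _))
    refine h1.trans ?_
    rw [nsmul_eq_mul, mul_comm]
    gcongr
    exact_mod_cast hB n F hF
  have hm : 0 < n := by omega
  have hfx : ∀ x ∈ good, ∃ ζ ∈ K2, x.2 ζ = ζ ∧ ‖ζ - x.2 z‖ ≤ 2 * δ * R := by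
    intro x hx
    obtain ⟨hxF, hxK, hxd⟩ := Finset.mem_filter.mp hx
    exact fixpt hAo hK2A hst (hF.diff x hxF) hδ0 hδ1 hxd hR hδ2 (hKK hz)
      ((Metric.closedBall_subset_cthickening hxK ρ).trans hKK2)
  choose! Z hZK hZfix hZn using hfx
  have step4 : ∑ x ∈ good, h (catW x.1 w, (x.2 z : Sphere)) ≤
      ∑ x ∈ good, g (perW hm x.1, (Z x : Sphere)) + ε * (Dtot p q : ℝ) ^ n := by
    have h1 : ∑ x ∈ good, h (catW x.1 w, (x.2 z : Sphere)) ≤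
        ∑ x ∈ good, (g (perW hm x.1, (Z x : Sphere)) + ε) := by
      refine Finset.sum_le_sum fun x hx => (hhg _).trans ?_
      have := hn1 (catW x.1 w) (perW hm x.1) (x.2 z : Sphere) (Z x : Sphere) (by
        intro k hk
        have hkn : k < n := by omega
        simp [catW, perW, hkn, Nat.mod_eq_of_lt hkn]) (by
        refine (sphDist_coe_le _ _).trans (le_trans ?_ hδ3)
        rw [dist_comm, dist_eq_norm]
        linarith [hZn x hx])
      rw [abs_lt] at this
      linarith [this.2]
    refine h1.trans ?_
    rw [Finset.sum_add_distrib, Finset.sum_const, nsmul_eq_mul, mul_comm]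
    have : (good.card : ℝ) ≤ (Dtot p q : ℝ) ^ n :=
      le_trans (by exact_mod_cast Finset.card_filter_le _ _) hFcard
    gcongr
  have step5 : ∑ x ∈ good, g (perW hm x.1, (Z x : Sphere)) ≤
      ((fixMultiset p q n).map fun y => g y).sum := by
    refine sum_sub_le good (fun x => (perW hm x.1, (Z x : Sphere))) _ ?_ (fun y => g y) hg0
    rw [Multiset.le_iff_subset]
    · intro y hy
      obtain ⟨x, hx, rfl⟩ := Multiset.mem_map.mp hy
      have hx : x ∈ good := hx
      have hxF := (Finset.mem_filter.mp hx).1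
      rw [fixMultiset, dif_pos hm, Multiset.mem_sum]
      refine ⟨x.1, Finset.mem_univ _, Multiset.mem_map.mpr ⟨(Z x : Sphere), ?_, rfl⟩⟩
      refine hF.mem_fix hAo hxF (hK2A (hZK x hx)) (hZfix x hx) ?_
      have := (Finset.mem_filter.mp hx).2.2 _ (hZK x hx)
      linarith
    · refine (Multiset.nodup_map_iff_inj_on good.nodup).mpr fun x hx y hy he => ?_
      have hx : x ∈ good := hx
      have hy : y ∈ good := hy
      have e1 := perW_injective hm (congrArg Prod.fst he)
      have e2 : Z x = Z y := OnePoint.coe_injective (congrArg Prod.snd he)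
      refine (hF.eq_of (Finset.mem_filter.mp hx).1 (Finset.mem_filter.mp hy).1 e1
        (hK2A (hZK x hx)) (hK2A (hZK y hy)) ?_).2
      rw [hZfix x hx, hZfix y hy, e2]
  linarith

/-! ### The lower bound -/

lemma cutoff (μ : Measure (SymX N)) [IsProbabilityMeasure μ] {A : Set ℂ} (hA : IsOpen A)
    (hμA : μ (Prod.snd ⁻¹' ((fun z : ℂ => (z : Sphere)) '' A))ᶜ = 0) {η : ℝ} (hη : 0 < η) :
    ∃ φ : Sphere → ℝ, Continuous φ ∧ (∀ z, 0 ≤ φ z) ∧ (∀ z, φ z ≤ 1) ∧ φ OnePoint.infty = 0 ∧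
      (∃ K : Set ℂ, IsCompact K ∧ K ⊆ A ∧ ∀ z : ℂ, z ∉ K → φ z = 0) ∧
      1 - η ≤ ∫ y, φ y.2 ∂μ := by
  have hoe : IsOpenEmbedding (fun z : ℂ => (z : Sphere)) := OnePoint.isOpenEmbedding_coe
  set C : Set Sphere := ((fun z : ℂ => (z : Sphere)) '' A)ᶜ with hC
  have hCcl : IsClosed C := (hoe.isOpenMap _ hA).isClosed_compl
  have hinf : OnePoint.infty ∈ C := by simp [hC]
  have hne : (stE '' C).Nonempty := ⟨_, _, hinf, rfl⟩
  have hScl : IsClosed (stE '' C) := (hCcl.isCompact.image continuous_stE).isClosed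
  let d : Sphere → ℝ := fun z => Metric.infDist (stE z) (stE '' C)
  have hd : Continuous d := (Metric.continuous_infDist_pt _).comp continuous_stE
  have hdC : ∀ z ∈ C, d z = 0 := fun z hz => Metric.infDist_zero_of_mem ⟨z, hz, rfl⟩
  have hdpos : ∀ z, z ∉ C → 0 < d z := by
    intro z hz
    refine (hScl.notMem_iff_infDist_pos hne).mp ?_
    rintro ⟨z', hz', he⟩
    exact hz (isEmbedding_stE.injective he ▸ hz')
  let φ : ℕ → Sphere → ℝ := fun k z => min 1 (max 0 ((k : ℝ) * d z - 1))
  have hφc : ∀ k, Continuous (φ k) := fun k =>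
    continuous_const.min (continuous_const.max ((continuous_const.mul hd).sub continuous_const))
  have hφ0 : ∀ k z, 0 ≤ φ k z := fun k z => le_min zero_le_one (le_max_left _ _)
  have hφ1 : ∀ k z, φ k z ≤ 1 := fun k z => min_le_left _ _
  have hlim : Tendsto (fun k => ∫ y, φ k y.2 ∂μ) atTop (𝓝 (∫ _y, (1 : ℝ) ∂μ)) := by
    refine tendsto_integral_of_dominated_convergence (fun _ => (1 : ℝ)) ?_ (integrable_const _) ?_ ?_
    · exact fun n => (integrable_cont μ _ ((hφc n).comp continuous_snd)).1
    · refine fun n => Eventually.of_forall fun y => ?_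
      rw [Real.norm_of_nonneg (hφ0 _ _)]
      exact hφ1 _ _
    · have hae : ∀ᵐ y ∂μ, y ∈ Prod.snd ⁻¹' ((fun z : ℂ => (z : Sphere)) '' A) := hμA
      filter_upwards [hae] with y hy
      refine tendsto_const_nhds.congr' ?_
      have hp := hdpos y.2 (fun h => h hy)
      filter_upwards [(tendsto_natCast_atTop_atTop.atTop_mul_const hp).eventually
        (eventually_ge_atTop (2 : ℝ))] with n hn
      simp only [φ]
      rw [max_eq_right (by linarith), min_eq_left (by linarith)]
  simp only [integral_const, probReal_univ, smul_eq_mul, mul_one] at hlim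
  obtain ⟨k, hk⟩ := (hlim.eventually (lt_mem_nhds (show 1 - η < 1 by linarith))).exists
  refine ⟨φ k, hφc k, hφ0 k, hφ1 k, by simp [φ, hdC _ hinf],
    ⟨(fun z : ℂ => (z : Sphere)) ⁻¹' {z | 1 ≤ (k : ℝ) * d z}, ?_, ?_, ?_⟩, hk.le⟩
  · rw [hoe.isInducing.isCompact_preimage_iff]
    · exact (isClosed_le continuous_const (continuous_const.mul hd)).isCompact
    · intro z hz
      by_contra hcon
      have : z ∈ C := fun ⟨a, _, ha⟩ => hcon ⟨a, ha⟩
      have h1 : (1 : ℝ) ≤ k * d z := hz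
      rw [hdC z this] at h1
      norm_num at h1
  · intro z hz
    by_contra hcon
    have : (z : Sphere) ∈ C := fun ⟨a, ha, he⟩ => hcon (OnePoint.coe_injective he ▸ ha)
    have h1 : (1 : ℝ) ≤ k * d z := hz
    rw [hdC _ this] at h1
    norm_num at h1
  · intro z hz
    have h1 : (k : ℝ) * d z < 1 := not_le.mp hz
    simp only [φ]
    rw [max_eq_left (by linarith)]
    simp

variable {p q} in
lemma lower (hg : Good p q) {μ : Measure (SymX N)} [IsProbabilityMeasure μ]
    (hμ : ConvTo p q μ) (g : C(SymX N, ℝ)) {M : ℝ} (hg0 : ∀ y, 0 ≤ g y) (hgM : ∀ y, g y ≤ M)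
    {ε : ℝ} (hε : 0 < ε) :
    ∀ᶠ n in atTop, ∫ y, g y ∂μ - ε ≤
      ((Dtot p q : ℝ) ^ n)⁻¹ * ((fixMultiset p q n).map fun y => g y).sum := by
  have hM : 0 ≤ M := (hg0 (fun _ => ⟨0, hg.1⟩, OnePoint.infty)).trans (hgM _)
  obtain ⟨η, hη, hηM⟩ : ∃ η : ℝ, 0 < η ∧ η * M ≤ ε / 8 := by
    refine ⟨ε / (8 * (M + 1)), by positivity, ?_⟩
    rw [div_mul_eq_mul_div, div_le_iff₀ (by positivity)]
    nlinarith
  obtain ⟨S, h0, E, hE, hsec⟩ := sections hg hη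
  obtain ⟨A, c, hAo, hA, hcA, hdis, hμA⟩ := slit μ (no_atom hg hμ) hE
  obtain ⟨φ, hφc, hφ0, hφ1, hφi, ⟨K, hK, hKA, hφK⟩, hφμ⟩ := cutoff μ hAo hμA hη
  obtain ⟨B, n0, hcore⟩ := core hg h0 hAo hA hcA (hsec A c hAo hA hcA hdis) hK hKA g hg0 hgM
    (show 0 < ε / 8 by positivity)
  have hD := hg.Dpos
  obtain ⟨x, hx, -⟩ := julia_pt hg ∅ (by simp)
  let h : C(SymX N, ℝ) := ⟨fun y => g y * φ y.2, g.continuous.mul (hφc.comp continuous_snd)⟩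
  let f : C(SymX N, ℝ) := ⟨fun y => 1 - φ y.2, continuous_const.sub (hφc.comp continuous_snd)⟩
  have hφint : Integrable (fun y : SymX N => φ y.2) μ :=
    integrable_cont μ _ (hφc.comp continuous_snd)
  have hfint : ∫ y, f y ∂μ ≤ η := by
    have : ∫ y, f y ∂μ = 1 - ∫ y, φ y.2 ∂μ := by
      show ∫ y, (1 - φ y.2) ∂μ = _
      rw [integral_sub (integrable_const _) hφint]
      simp
    linarith
  have hhint : ∫ y, g y ∂μ - ε / 8 ≤ ∫ y, h y ∂μ := by
    have h1 : ∫ y, g y ∂μ ≤ ∫ y, (h y + M * f y) ∂μ := by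
      refine integral_mono (integrable_cont μ _ g.continuous)
        (integrable_cont μ _ (h.continuous.add (continuous_const.mul f.continuous))) fun y => ?_
      show g y ≤ g y * φ y.2 + M * (1 - φ y.2)
      nlinarith [hgM y, hφ1 y.2]
    rw [integral_add (integrable_cont μ _ h.continuous)
      ((integrable_cont μ _ f.continuous).const_mul M), integral_const_mul] at h1
    nlinarith
  obtain ⟨m, hm⟩ := ((hμ x hx f).eventually (gt_mem_nhds (show ∫ y, f y ∂μ < 2 * η by linarith))).exists
  have hm' : ((preimTn p q m x).map fun y => f y).sum ≤ 2 * η * (Dtot p q : ℝ) ^ m := by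
    rw [inv_mul_lt_iff₀ (by positivity)] at hm
    linarith
  have ev1 := ((hμ x hx h).comp (tendsto_add_atTop_nat m)).eventually
    (lt_mem_nhds (show ∫ y, h y ∂μ - ε / 8 < ∫ y, h y ∂μ by linarith))
  have hr : Tendsto (fun n : ℕ => M * B * ((N : ℝ) / Dtot p q) ^ n) atTop (𝓝 0) := by
    have : (N : ℝ) / Dtot p q < 1 := by
      rw [div_lt_one hD]
      exact_mod_cast hg.lt
    simpa using (tendsto_pow_atTop_nhds_zero_of_lt_one (by positivity) this).const_mul (M * (B : ℝ))
  have ev2 := hr.eventually (gt_mem_nhds (show 0 < ε / 8 by positivity))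
  filter_upwards [ev1, ev2, eventually_ge_atTop n0] with n h1 h2 hn
  simp only [Function.comp_apply] at h1
  set Φ := ((fixMultiset p q n).map fun y => g y).sum with hΦ
  have hΦ0 : 0 ≤ Φ := Multiset.sum_nonneg fun b hb => by
    obtain ⟨a, -, rfl⟩ := Multiset.mem_map.mp hb
    exact hg0 a
  set G := Φ + ε / 8 * (Dtot p q : ℝ) ^ n + η * M * (Dtot p q : ℝ) ^ n + M * (B * (N : ℝ) ^ n)
    with hG
  have hG0 : 0 ≤ G := by positivity
  have hh0 : ∀ y, 0 ≤ h y := fun y => mul_nonneg (hg0 y) (hφ0 _)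
  have hhg : ∀ y, h y ≤ g y := fun y => mul_le_of_le_one_right (hg0 y) (hφ1 _)
  have hbd : ∀ y : SymX N, ((preimTn p q n y).map fun y => h y).sum ≤
      G + M * (Dtot p q : ℝ) ^ n * f y := by
    have hout : ∀ y : SymX N, φ y.2 = 0 → ((preimTn p q n y).map fun y => h y).sum ≤
        G + M * (Dtot p q : ℝ) ^ n * f y := by
      intro y hy
      have h3 := Multiset.sum_le_card_nsmul ((preimTn p q n y).map fun y => h y) M (by
        intro b hb
        obtain ⟨a, -, rfl⟩ := Multiset.mem_map.mp hb
        exact (hhg a).trans (hgM a))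
      rw [Multiset.card_map, card_preimTn, nsmul_eq_mul] at h3
      have h4 : f y = 1 := by show 1 - φ y.2 = 1; rw [hy, sub_zero]
      rw [h4]
      push_cast at h3
      linarith
    rintro ⟨w, z⟩
    induction z using OnePoint.rec with
    | infty => exact hout _ hφi
    | coe z =>
      by_cases hz : z ∈ K
      · have h3 := hcore n hn w z hz (fun y => h y) hh0 hhg (fun w' z' hz' => by
          show g _ * φ _ = 0
          rw [hφK z' hz', mul_zero])
        have h4 : 0 ≤ f (w, (z : Sphere)) := by
          show 0 ≤ 1 - φ _
          linarith [hφ1 (z : Sphere)]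
        have h5 : 0 ≤ M * (Dtot p q : ℝ) ^ n * f (w, (z : Sphere)) := by positivity
        linarith
      · exact hout _ (hφK z hz)
  have hsum : ((preimTn p q (n + m) x).map fun y => h y).sum ≤
      (Dtot p q : ℝ) ^ m * G + M * (Dtot p q : ℝ) ^ n * (2 * η * (Dtot p q : ℝ) ^ m) := by
    rw [add_comm n m, sum_preimTn_add]
    refine (Multiset.sum_map_le_sum_map _ _ fun y _ => hbd y).trans ?_
    rw [Multiset.sum_map_add, Multiset.sum_map_mul_left, Multiset.map_const', Multiset.sum_replicate,
      card_preimTn, nsmul_eq_mul]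
    push_cast
    gcongr
  have hfin : ((Dtot p q : ℝ) ^ (n + m))⁻¹ * ((preimTn p q (n + m) x).map fun y => h y).sum ≤
      ((Dtot p q : ℝ) ^ n)⁻¹ * Φ + ε / 8 + η * M + M * B * ((N : ℝ) / Dtot p q) ^ n +
        2 * (η * M) := by
    rw [inv_mul_le_iff₀ (by positivity)]
    refine hsum.trans (le_of_eq ?_)
    rw [hG, div_pow]
    field_simp
    ring
  linarith

/-! ### Counting fixed points and conclusion -/

lemma natDegree_compTerm (P : ℂ[X]) (d : ℕ) (b : ℂ[X] × ℂ[X]) :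
    (∑ i ∈ Finset.range (d + 1), Polynomial.C (P.coeff i) * b.1 ^ i * b.2 ^ (d - i)).natDegree ≤
      d * max b.1.natDegree b.2.natDegree := by
  refine natDegree_sum_le_of_forall_le _ _ fun i hi => ?_
  have hi : i ≤ d := by simpa [Nat.lt_succ_iff] using hi
  refine natDegree_mul_le.trans ?_
  have h1 : (C (P.coeff i) * b.1 ^ i).natDegree ≤ i * b.1.natDegree :=
    (natDegree_C_mul_le _ _).trans natDegree_pow_le
  have h2 : (b.2 ^ (d - i)).natDegree ≤ (d - i) * b.2.natDegree := natDegree_pow_le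
  calc _ ≤ i * b.1.natDegree + (d - i) * b.2.natDegree := add_le_add h1 h2
    _ ≤ i * max b.1.natDegree b.2.natDegree + (d - i) * max b.1.natDegree b.2.natDegree := by
        gcongr
        · exact le_max_left _ _
        · exact le_max_right _ _
    _ = d * max b.1.natDegree b.2.natDegree := by rw [← add_mul, Nat.add_sub_cancel' hi]

lemma natDegree_compPair (a b : ℂ[X] × ℂ[X]) :
    max (compPair a b).1.natDegree (compPair a b).2.natDegree ≤
      max a.1.natDegree a.2.natDegree * max b.1.natDegree b.2.natDegree :=
  max_le (natDegree_compTerm _ _ _) (natDegree_compTerm _ _ _)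

lemma natDegree_wordPair (l : List (Fin N)) :
    max (wordPair p q l).1.natDegree (wordPair p q l).2.natDegree ≤ (l.map (degR p q)).prod := by
  induction l with
  | nil => simp [wordPair]
  | cons v t ih =>
    rw [wordPair, List.map_cons, List.prod_cons, mul_comm]
    exact (natDegree_compPair _ _).trans (Nat.mul_le_mul ih le_rfl)

lemma card_fixMul (a : ℂ[X] × ℂ[X]) :
    (fixMul a).card ≤ max a.1.natDegree a.2.natDegree + 1 := by
  rw [fixMul_eq, Multiset.card_add, Multiset.card_map, Multiset.card_replicate]
  have h1 := card_roots' (a.1 - X * a.2)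
  have h2 : (a.1 - X * a.2).natDegree ≤ max a.1.natDegree a.2.natDegree + 1 := by
    refine (natDegree_sub_le _ _).trans (max_le ?_ ?_)
    · exact (le_max_left _ _).trans (Nat.le_succ _)
    · refine natDegree_mul_le.trans ?_
      rw [natDegree_X, add_comm]
      exact Nat.succ_le_succ (le_max_right _ _)
  omega

lemma card_fixMultiset (m : ℕ) : (fixMultiset p q m).card ≤ Dtot p q ^ m + N ^ m := by
  rw [fixMultiset]
  split_ifs with hm
  · rw [Multiset.card_sum]
    simp only [Multiset.card_map]
    calc _ ≤ ∑ v : Fin m → Fin N, (∏ i, degR p q (v i) + 1) := by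
          refine Finset.sum_le_sum fun v _ => (card_fixMul _).trans (Nat.succ_le_succ ?_)
          have := natDegree_wordPair p q (List.ofFn v)
          rwa [List.map_ofFn, List.prod_ofFn] at this
      _ = Dtot p q ^ m + N ^ m := by
          rw [Finset.sum_add_distrib, Dtot, Fintype.sum_pow]
          simp
  · simp

variable {p q} in
lemma lower' (hg : Good p q) {μ : Measure (SymX N)} [IsProbabilityMeasure μ]
    (hμ : ConvTo p q μ) (g : C(SymX N, ℝ)) {ε : ℝ} (hε : 0 < ε) :
    ∀ᶠ n in atTop, ∫ y, g y ∂μ - ε ≤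
      ((Dtot p q : ℝ) ^ n)⁻¹ * ((fixMultiset p q n).map fun y => g y).sum := by
  have hD := hg.Dpos
  obtain ⟨M, hM0, hM⟩ : ∃ M : ℝ, 0 ≤ M ∧ ∀ y, |g y| ≤ M :=
    ⟨‖g‖, norm_nonneg _, fun y => g.norm_coe_le_norm y⟩
  have h1 := lower hg hμ ⟨fun y => g y + M, g.continuous.add continuous_const⟩ (M := 2 * M)
    (fun y => by have := abs_le.mp (hM y); simp only [ContinuousMap.coe_mk]; linarith)
    (fun y => by have := abs_le.mp (hM y); simp only [ContinuousMap.coe_mk]; linarith)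
    (half_pos hε)
  have hr : Tendsto (fun n : ℕ => M * ((N : ℝ) / Dtot p q) ^ n) atTop (𝓝 0) := by
    have : (N : ℝ) / Dtot p q < 1 := by
      rw [div_lt_one hD]
      exact_mod_cast hg.lt
    simpa using (tendsto_pow_atTop_nhds_zero_of_lt_one (by positivity) this).const_mul M
  have h2 := hr.eventually (gt_mem_nhds (half_pos hε))
  filter_upwards [h1, h2] with n h3 h4
  simp only [ContinuousMap.coe_mk] at h3
  rw [integral_add (integrable_cont μ _ g.continuous) (integrable_const _), Multiset.sum_map_add,
    Multiset.map_const', Multiset.sum_replicate, nsmul_eq_mul] at h3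
  simp only [integral_const, probReal_univ, smul_eq_mul, one_mul] at h3
  have hc : ((fixMultiset p q n).card : ℝ) ≤ (Dtot p q : ℝ) ^ n + (N : ℝ) ^ n := by
    exact_mod_cast card_fixMultiset p q n
  have h5 : ((Dtot p q : ℝ) ^ n)⁻¹ * (((fixMultiset p q n).card : ℝ) * M) ≤
      M + M * ((N : ℝ) / Dtot p q) ^ n := by
    rw [inv_mul_le_iff₀ (by positivity), div_pow]
    refine (mul_le_mul_of_nonneg_right hc hM0).trans (le_of_eq ?_)
    field_simp
  rw [mul_add] at h3
  linarith

variable {p q} in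
lemma fix_tendsto (hg : Good p q) {μ : Measure (SymX N)} [IsProbabilityMeasure μ]
    (hμ : ConvTo p q μ) (g : C(SymX N, ℝ)) :
    Tendsto (fun n : ℕ => ((Dtot p q : ℝ) ^ n)⁻¹ * ((fixMultiset p q n).map fun y => g y).sum)
      atTop (𝓝 (∫ y, g y ∂μ)) := by
  rw [Metric.tendsto_nhds]
  intro ε hε
  filter_upwards [lower' hg hμ g (half_pos hε), lower' hg hμ (-g) (half_pos hε)] with n h1 h2
  simp only [ContinuousMap.coe_neg, Pi.neg_apply, integral_neg] at h2
  have h3 : ((fixMultiset p q n).map fun y => -g y).sum =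
      -((fixMultiset p q n).map fun y => g y).sum := by
    induction fixMultiset p q n using Multiset.induction with
    | empty => simp
    | cons a s ih => simp only [Multiset.map_cons, Multiset.sum_cons, ih]; ring
  rw [h3, mul_neg] at h2
  rw [Real.dist_eq, abs_lt]
  constructor <;> linarith

variable {p q} in
lemma ratio_tendsto (hg : Good p q) :
    Tendsto (fun m : ℕ => ((Dtot p q : ℝ) ^ m + N)⁻¹ * (Dtot p q : ℝ) ^ m) atTop (𝓝 1) := by
  have hD := hg.Dpos
  have h1 : (1 : ℝ) < Dtot p q := by
    have := hg.lt
    have := hg.1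
    exact_mod_cast (by omega : 1 < Dtot p q)
  have h2 : Tendsto (fun m : ℕ => 1 + (N : ℝ) * ((Dtot p q : ℝ) ^ m)⁻¹) atTop (𝓝 1) := by
    simpa using ((tendsto_pow_atTop_atTop_of_one_lt h1).inv_tendsto_atTop.const_mul
      (N : ℝ)).const_add 1
  have h3 := h2.inv₀ one_ne_zero
  rw [inv_one] at h3
  refine h3.congr fun m => ?_
  field_simp

theorem equidistribution_of_periodic_points
    (hg : Good p q) (hA1 : NoSuperAttract p q) :
    ∀ μ : Measure (SymX N), IsProbabilityMeasure μ →
      (∀ x ∈ juliaSet p q, ∀ g : C(SymX N, ℝ),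
        Tendsto (fun n : ℕ =>
            ((Dtot p q : ℝ) ^ n)⁻¹ * ((preimTn p q n x).map fun y => g y).sum)
          atTop (𝓝 (∫ y, g y ∂μ))) →
      ∀ g : C(SymX N, ℝ),
        Tendsto (fun m : ℕ =>
            ((Dtot p q : ℝ) ^ m + N)⁻¹ * ((fixMultiset p q m).map fun y => g y).sum)
          atTop (𝓝 (∫ y, g y ∂μ)) := by
  intro μ hprob hμ g
  have h1 := (ratio_tendsto hg).mul (fix_tendsto hg (show ConvTo p q μ from hμ) g)
  rw [one_mul] at h1
  refine h1.congr fun m => ?_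
  have hD := hg.Dpos
  have hne : (Dtot p q : ℝ) ^ m ≠ 0 := by positivity
  rw [mul_assoc, mul_inv_cancel_left₀ hne]

end SkewRational
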